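/- Let n, m be positive integers with m ≥ 2 and let μ > 0. Then every proper holomorphic self-mapping of the Fock–Bargmann–Hartogs domain D_{n,m}(μ) is an automorphism of D_{n,m}(μ), i.e., a holomorphic bijection of D_{n,m}(μ) onto itself with holomorphic inverse. -/

import Mathlib

/-- The Fock–Bargmann–Hartogs domain
`D_{n,m}(μ) = {(z,w) ∈ ℂ^n × ℂ^m : ‖w‖² < exp (−μ‖z‖²)}`. -/
def FBH (n m : ℕ) (μ : ℝ) :
    Set (EuclideanSpace ℂ (Fin n) × EuclideanSpace ℂ (Fin m)) :=
  {p | ‖p.2‖ ^ 2 < Real.exp (-μ * ‖p.1‖ ^ 2)}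

section partA

open MeasureTheory Set Filter Topology Metric

section regularity
variable {E F : Type*} [NormedAddCommGroup E] [NormedSpace ℂ E]
  [NormedAddCommGroup F] [NormedSpace ℂ F]

theorem fbh_cauchy_fderiv {f : E → F} {p : E} {ρ M : ℝ} (hρ : 0 < ρ)
    (hf : DifferentiableOn ℂ f (ball p ρ)) (hM : ∀ x ∈ ball p ρ, ‖f x‖ ≤ M) :
    ‖fderiv ℂ f p‖ ≤ 2 * M / ρ := by
  have hM0 : 0 ≤ M := (norm_nonneg _).trans (hM p (mem_ball_self hρ))
  refine ContinuousLinearMap.opNorm_le_bound _ (by positivity) fun u => ?_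
  by_cases hu : u = 0
  · simp [hu]
  have hu' : 0 < ‖u‖ := norm_pos_iff.2 hu
  have hmem : ∀ z ∈ closedBall (0 : ℂ) (ρ / (2 * ‖u‖)), p + z • u ∈ ball p ρ := by
    intro z hz
    rw [mem_closedBall, dist_zero_right] at hz
    rw [mem_ball, dist_eq_norm, add_sub_cancel_left, norm_smul]
    calc ‖z‖ * ‖u‖ ≤ ρ / (2 * ‖u‖) * ‖u‖ := by gcongr
      _ = ρ / 2 := by field_simp
      _ < ρ := by linarith
  have hd : ∀ z ∈ closedBall (0 : ℂ) (ρ / (2 * ‖u‖)),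
      DifferentiableAt ℂ (fun z : ℂ => f (p + z • u)) z := by
    intro z hz
    have h1 : DifferentiableAt ℂ f (p + z • u) :=
      (hf _ (hmem z hz)).differentiableAt (isOpen_ball.mem_nhds (hmem z hz))
    exact h1.comp z (by fun_prop)
  have key := Complex.norm_deriv_le_of_forall_mem_sphere_norm_le (f := fun z : ℂ => f (p + z • u))
    (c := 0) (R := ρ / (2 * ‖u‖)) (C := M) (by positivity)
    (DifferentiableOn.diffContOnCl_ball (U := closedBall (0 : ℂ) (ρ / (2 * ‖u‖)))
      (fun z hz => (hd z hz).differentiableWithinAt) le_rfl)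
    (fun z hz => hM _ (hmem z (sphere_subset_closedBall hz)))
  have h2 : deriv (fun z : ℂ => f (p + z • u)) 0 = fderiv ℂ f p u := by
    have h1 : HasFDerivAt f (fderiv ℂ f p) (p + (0 : ℂ) • u) := by
      simpa using ((hf p (mem_ball_self hρ)).differentiableAt
        (isOpen_ball.mem_nhds (mem_ball_self hρ))).hasFDerivAt
    have h3 : HasDerivAt (fun z : ℂ => p + z • u) u 0 := by
      simpa using ((hasDerivAt_id (0 : ℂ)).smul_const u).const_add p
    exact (h1.comp_hasDerivAt (0 : ℂ) h3).deriv
  rw [h2] at key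
  refine key.trans (le_of_eq ?_)
  field_simp

variable [FiniteDimensional ℂ E] [FiniteDimensional ℂ F]

theorem fbh_diff_dir {f : E → F} {V : Set E} (hV : IsOpen V)
    (hf : DifferentiableOn ℂ f V) (v : E) :
    DifferentiableOn ℂ (fun x => fderiv ℂ f x v) V := by
  intro x0 hx0
  have : CompleteSpace F := FiniteDimensional.complete ℂ F
  apply DifferentiableAt.differentiableWithinAt
  -- radius
  obtain ⟨ε, hε, hεV⟩ : ∃ ε > 0, ball x0 ε ⊆ V ∩ {x | ‖f x‖ ≤ ‖f x0‖ + 1} := by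
    have h1 : V ∈ 𝓝 x0 := hV.mem_nhds hx0
    have h2 : {x | ‖f x‖ ≤ ‖f x0‖ + 1} ∈ 𝓝 x0 := by
      have := ((hf x0 hx0).differentiableAt h1).continuousAt.norm
      filter_upwards [this.eventually (gt_mem_nhds (lt_add_one ‖f x0‖))] with x hx
      exact le_of_lt hx
    exact Metric.mem_nhds_iff.1 (inter_mem h1 h2)
  set δ := ε / 4 with hδ
  have hδ0 : 0 < δ := by positivity
  set r := δ / (‖v‖ + 1) with hr
  have hr0 : 0 < r := by positivity
  have hrv : ∀ z : ℂ, ‖z‖ ≤ r → ‖z • v‖ ≤ δ := by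
    intro z hz
    rw [norm_smul]
    calc ‖z‖ * ‖v‖ ≤ r * (‖v‖ + 1) := by gcongr; linarith
      _ = δ := by rw [hr]; field_simp
  have hmem : ∀ x ∈ ball x0 δ, ∀ z : ℂ, ‖z‖ ≤ r → x + z • v ∈ ball x0 (2 * δ) := by
    intro x hx z hz
    rw [mem_ball, dist_eq_norm] at hx ⊢
    have := norm_add_le (x - x0) (z • v)
    have h3 := hrv z hz
    have h4 : x + z • v - x0 = (x - x0) + z • v := by abel
    rw [h4]; linarith
  have hsub : ball x0 (2 * δ) ⊆ ball x0 ε := ball_subset_ball (by linarith)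
  have hdf : ∀ x ∈ ball x0 ε, DifferentiableAt ℂ f x := fun x hx =>
    (hf x (hεV hx).1).differentiableAt (hV.mem_nhds (hεV hx).1)
  have hbd : ∀ x ∈ ball x0 (2 * δ), ‖fderiv ℂ f x‖ ≤ 2 * (‖f x0‖ + 1) / δ := by
    intro x hx
    have hs : ball x δ ⊆ ball x0 ε := by
      apply ball_subset_ball'
      rw [mem_ball] at hx; linarith
    exact fbh_cauchy_fderiv hδ0 (fun y hy => (hdf y (hs hy)).differentiableWithinAt)
      (fun y hy => (hεV (hs hy)).2)
  -- formula
  have hform : (fun x => fderiv ℂ f x v) =ᶠ[𝓝 x0] fun x =>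
      (2 * ↑Real.pi * Complex.I)⁻¹ • ∮ (z : ℂ) in C(0, r), ((z - 0) ^ 2)⁻¹ • f (x + z • v) := by
    filter_upwards [ball_mem_nhds x0 hδ0] with x hx
    have hU : IsOpen ((fun z : ℂ => x + z • v) ⁻¹' (ball x0 ε)) :=
      isOpen_ball.preimage (by fun_prop)
    rw [Complex.two_pi_I_inv_smul_circleIntegral_sub_sq_inv_smul_of_differentiable hU
      (c := 0) (w₀ := 0) (R := r) (f := fun z : ℂ => f (x + z • v)) ?_ ?_ (mem_ball_self hr0)]
    · have h1 : HasFDerivAt f (fderiv ℂ f x) (x + (0 : ℂ) • v) := by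
        simpa using (hdf x (ball_subset_ball (by linarith) hx)).hasFDerivAt
      have h3 : HasDerivAt (fun z : ℂ => x + z • v) v 0 := by
        simpa using ((hasDerivAt_id (0 : ℂ)).smul_const v).const_add x
      exact (h1.comp_hasDerivAt (0 : ℂ) h3).deriv.symm
    · intro z hz
      exact hsub (hmem x hx z (by simpa using hz))
    · intro z hz
      exact ((hdf _ hz).comp z (by fun_prop)).differentiableWithinAt
  refine DifferentiableAt.congr_of_eventuallyEq ?_ hform
  refine DifferentiableAt.const_smul ?_ _
  unfold circleIntegral
  have hcm : ∀ θ : ℝ, ‖circleMap 0 r θ‖ ≤ r := by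
    intro θ; simp [abs_of_pos hr0]
  borelize E
  have hcont : ∀ x ∈ ball x0 δ, Continuous fun θ : ℝ =>
      deriv (circleMap 0 r) θ • ((circleMap 0 r θ - 0) ^ 2)⁻¹ • f (x + circleMap 0 r θ • v) := by
    intro x hx
    have h1 : Continuous fun θ : ℝ => f (x + circleMap 0 r θ • v) := by
      rw [continuous_iff_continuousAt]
      intro θ
      exact ContinuousAt.comp (g := f) (hdf _ (hsub (hmem x hx _ (hcm θ)))).continuousAt
        (by fun_prop)
    have h2 : ∀ θ : ℝ, (circleMap 0 r θ - 0) ^ 2 ≠ 0 := by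
      intro θ; simp [hr0.ne']
    have h3 : Continuous fun θ : ℝ => ((circleMap 0 r θ - 0) ^ 2)⁻¹ :=
      Continuous.inv₀ (by fun_prop) h2
    have h4 : Continuous (deriv (circleMap 0 r)) := by
      have : deriv (circleMap 0 r) = fun θ => circleMap 0 r θ * Complex.I := by
        ext θ; simp
      rw [this]; fun_prop
    exact h4.smul (h3.smul h1)
  set F' : E → ℝ → E →L[ℂ] F := fun x θ =>
    deriv (circleMap 0 r) θ • ((circleMap 0 r θ - 0) ^ 2)⁻¹ • fderiv ℂ f (x + circleMap 0 r θ • v)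
    with hF'
  have hmeas : AEStronglyMeasurable (F' x0) (volume.restrict (Set.uIoc 0 (2 * Real.pi))) := by
    have hp : ProperSpace (E →L[ℂ] F) := FiniteDimensional.proper ℂ _
    borelize (E →L[ℂ] F)
    have h1 : Measurable fun θ : ℝ => fderiv ℂ f (x0 + circleMap 0 r θ • v) :=
      (measurable_fderiv ℂ f).comp (Continuous.measurable (by fun_prop))
    have h4 : Measurable (deriv (circleMap 0 r)) := by
      have : deriv (circleMap 0 r) = fun θ => circleMap 0 r θ * Complex.I := by
        ext θ; simp
      rw [this]; exact Continuous.measurable (by fun_prop)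
    have h3 : Measurable fun θ : ℝ => ((circleMap 0 r θ - 0) ^ 2)⁻¹ :=
      (Continuous.measurable (by fun_prop)).inv
    exact (h4.smul (h3.smul h1)).stronglyMeasurable.aestronglyMeasurable
  have key := intervalIntegral.hasFDerivAt_integral_of_dominated_of_fderiv_le (𝕜 := ℂ)
    (μ := volume) (a := 0) (b := 2 * Real.pi) (s := ball x0 δ)
    (F := fun x θ => deriv (circleMap 0 r) θ • ((circleMap 0 r θ - 0) ^ 2)⁻¹ •
      f (x + circleMap 0 r θ • v)) (F' := F')
    (bound := fun _ => r * ((r ^ 2)⁻¹ * (2 * (‖f x0‖ + 1) / δ)))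
    (ball_mem_nhds x0 hδ0)
    (by filter_upwards [ball_mem_nhds x0 hδ0] with x hx
        exact (hcont x hx).aestronglyMeasurable)
    ((hcont x0 (mem_ball_self hδ0)).intervalIntegrable _ _)
    hmeas
    (by
      refine Eventually.of_forall fun θ _ x hx => ?_
      simp only [hF', norm_smul, deriv_circleMap, norm_mul, norm_inv, norm_pow, sub_zero,
        norm_circleMap_zero, Complex.norm_I, mul_one, abs_of_pos hr0]
      gcongr
      exact hbd _ (hmem x hx _ (hcm θ)))
    (by simp)
    (by
      refine Eventually.of_forall fun θ _ x hx => ?_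
      have h1 := (hdf _ (hsub (hmem x hx _ (hcm θ)))).hasFDerivAt
      have h2 : HasFDerivAt (fun x : E => f (x + circleMap 0 r θ • v))
          (fderiv ℂ f (x + circleMap 0 r θ • v)) x := by
        have := h1.comp x ((hasFDerivAt_id x).add_const (circleMap 0 r θ • v))
        rw [ContinuousLinearMap.comp_id] at this
        exact this
      exact (h2.const_smul _).const_smul _)
  exact key.differentiableAt

theorem fbh_contDiffOn_nat {f : E → F} {V : Set E} (hV : IsOpen V)
    (hf : DifferentiableOn ℂ f V) (n : ℕ) : ContDiffOn ℂ n f V := by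
  induction n generalizing f with
  | zero => simpa using hf.continuousOn
  | succ n ih =>
    push_cast
    rw [contDiffOn_succ_iff_fderiv_of_isOpen hV]
    refine ⟨hf, by simp, ?_⟩
    rw [contDiffOn_clm_apply]
    intro y
    exact ih (fbh_diff_dir hV hf y)

end regularity

end partA

section partB

open MeasureTheory Set Filter Topology Metric

section piola
variable {ι : Type*} [Fintype ι] [DecidableEq ι]

theorem fbh_piola_alg (M : Matrix ι ι ℂ) (i k : ι) (hik : i ≠ k) (S : ι → ι → ℂ)
    (hS : ∀ l p, S l p = S p l) :
    ∑ l, Matrix.det ((M.updateRow i (Pi.single l 1)).updateRow k (S l)) = 0 := by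
  have h1 : ∀ l, Matrix.det ((M.updateRow i (Pi.single l 1)).updateRow k (S l)) =
      ∑ p, S l p * Matrix.det ((M.updateRow i (Pi.single l 1)).updateRow k (Pi.single p 1)) := by
    intro l
    have h2 : S l = ∑ p, S l p • (Pi.single p 1 : ι → ℂ) := by
      ext q
      simp [Finset.sum_apply, Pi.single_apply]
    conv_lhs => rw [h2]
    have := (Matrix.detRowAlternating (R := ℂ) (n := ι)).toMultilinearMap.map_update_sum
      Finset.univ k (fun p => S l p • (Pi.single p 1 : ι → ℂ)) (M.updateRow i (Pi.single l 1))
    refine this.trans (Finset.sum_congr rfl fun p _ => ?_)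
    exact Matrix.det_updateRow_smul _ _ _ _
  have h2 : ∀ l p, Matrix.det ((M.updateRow i (Pi.single l 1)).updateRow k (Pi.single p 1)) =
      - Matrix.det ((M.updateRow i (Pi.single p 1)).updateRow k (Pi.single l 1)) := by
    intro l p
    have := (Matrix.detRowAlternating (R := ℂ) (n := ι)).map_swap
      ((M.updateRow i (Pi.single p 1)).updateRow k (Pi.single l 1)) hik
    rw [show Matrix.det ((M.updateRow i (Pi.single p 1)).updateRow k (Pi.single l 1)) =
      Matrix.detRowAlternating ((M.updateRow i (Pi.single p 1)).updateRow k (Pi.single l 1)) from rfl,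
      ← this]
    change Matrix.detRowAlternating _ = _
    congr 1
    ext a b
    change _ = ((M.updateRow i (Pi.single p 1)).updateRow k (Pi.single l 1)) (Equiv.swap i k a) b
    by_cases ha : a = i
    · subst ha; simp [Matrix.updateRow_apply, hik]
    · by_cases hb : a = k
      · subst hb; simp [Matrix.updateRow_apply, hik]
      · simp [Matrix.updateRow_apply, ha, hb, Equiv.swap_apply_of_ne_of_ne]
  simp_rw [h1]
  have h3 : ∑ l, ∑ p, S l p * Matrix.det ((M.updateRow i (Pi.single l 1)).updateRow k (Pi.single p 1))
      = - ∑ l, ∑ p, S l p * Matrix.det ((M.updateRow i (Pi.single l 1)).updateRow k (Pi.single p 1)) := by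
    conv_rhs => rw [Finset.sum_comm]
    rw [← Finset.sum_neg_distrib]
    refine Finset.sum_congr rfl fun l _ => ?_
    rw [← Finset.sum_neg_distrib]
    refine Finset.sum_congr rfl fun p _ => ?_
    rw [h2 l p, hS l p]; ring
  exact self_eq_neg.1 h3

/-- Jacobian matrix. -/
noncomputable def fbhJac (f : (ι → ℂ) → (ι → ℂ)) (x : ι → ℂ) : Matrix ι ι ℂ :=
  fun j k => fderiv ℂ f x (Pi.single k 1) j

theorem fbhJac_eq (f : (ι → ℂ) → (ι → ℂ)) (x : ι → ℂ) :
    fbhJac f x = LinearMap.toMatrix' (fderiv ℂ f x : (ι → ℂ) →ₗ[ℂ] (ι → ℂ)) := by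
  ext j k
  simp [fbhJac, LinearMap.toMatrix'_apply]

theorem fbhJac_det (f : (ι → ℂ) → (ι → ℂ)) (x : ι → ℂ) :
    (fbhJac f x).det = (fderiv ℂ f x).det := by
  rw [fbhJac_eq]
  exact LinearMap.det_toMatrix' _

noncomputable def fbhDetCM (ι : Type*) [Fintype ι] [DecidableEq ι] :
    ContinuousMultilinearMap ℂ (fun _ : ι => (ι → ℂ)) ℂ where
  toMultilinearMap := (Matrix.detRowAlternating (R := ℂ) (n := ι)).toMultilinearMap
  cont := by
    change Continuous fun M : Matrix ι ι ℂ => M.det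
    exact Continuous.matrix_det continuous_id

variable {f : (ι → ℂ) → (ι → ℂ)} {V : Set (ι → ℂ)}

theorem fbhJac_entry_diff (hV : IsOpen V) (hf : DifferentiableOn ℂ f V) (j k : ι) :
    DifferentiableOn ℂ (fun x => fbhJac f x j k) V := by
  have := fbh_diff_dir hV hf (Pi.single k 1)
  rw [differentiableOn_pi] at this
  exact this j

theorem fbh_piola (hV : IsOpen V) (hf : DifferentiableOn ℂ f V) (i : ι) {x : ι → ℂ} (hx : x ∈ V) :
    (∀ l, DifferentiableAt ℂ (fun x => (fbhJac f x).adjugate l i) x) ∧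
    ∑ l, fderiv ℂ (fun x => (fbhJac f x).adjugate l i) x (Pi.single l 1) = 0 := by
  have hrow : ∀ k, DifferentiableAt ℂ (fun x => fbhJac f x k) x := by
    intro k
    rw [differentiableAt_pi]
    intro p
    exact (fbhJac_entry_diff hV hf k p x hx).differentiableAt (hV.mem_nhds hx)
  have hA : ∀ l, HasFDerivAt (fun x => (fbhJac f x).adjugate l i)
      (∑ k, (fbhDetCM ι).toContinuousLinearMap
        (fun j => (fun (k : ι) x => if k = i then (Pi.single l 1 : ι → ℂ) else fbhJac f x k) j x) k ∘SL
        (if k = i then 0 else fderiv ℂ (fun x => fbhJac f x k) x)) x := by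
    intro l
    have h1 := HasFDerivAt.multilinear_comp (fbhDetCM ι)
      (g := fun (k : ι) x => if k = i then (Pi.single l 1 : ι → ℂ) else fbhJac f x k)
      (g' := fun k => if k = i then 0 else fderiv ℂ (fun x => fbhJac f x k) x) (x := x) (by
        intro k
        by_cases hk : k = i
        · simp only [hk, if_true]; exact hasFDerivAt_const _ _
        · simp only [hk, if_false]; exact (hrow k).hasFDerivAt)
    have h2 : (fun x => (fbhJac f x).adjugate l i) = fun x => fbhDetCM ι fun k =>
        (if k = i then (Pi.single l 1 : ι → ℂ) else fbhJac f x k) := by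
      funext y
      rw [Matrix.adjugate_apply]
      change _ = Matrix.det _
      congr 1
      ext a b
      simp only [Matrix.updateRow_apply]
      split_ifs <;> rfl
    rw [h2]
    exact h1
  refine ⟨fun l => (hA l).differentiableAt, ?_⟩
  have hval : ∀ l, fderiv ℂ (fun x => (fbhJac f x).adjugate l i) x (Pi.single l 1) =
      ∑ k, if k = i then 0 else Matrix.det (((fbhJac f x).updateRow i (Pi.single l 1)).updateRow k
        (fun p => fderiv ℂ (fun x => fbhJac f x k p) x (Pi.single l 1))) := by
    intro l
    rw [(hA l).fderiv, ContinuousLinearMap.sum_apply]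
    refine Finset.sum_congr rfl fun k _ => ?_
    by_cases hk : k = i
    · simp [hk]
    · simp only [hk, if_false, ContinuousLinearMap.comp_apply]
      change Matrix.det (Function.update _ _ _) = _
      congr 1
      ext a b
      by_cases ha : a = k
      · subst ha
        simp only [Function.update_self, Matrix.updateRow_self]
        rw [fderiv_apply (hrow a)]
        rfl
      · simp only [Function.update_of_ne ha, Matrix.updateRow_apply, ha, if_false]
        split_ifs <;> rfl
  simp_rw [hval]
  rw [Finset.sum_comm]
  refine Finset.sum_eq_zero fun k _ => ?_
  by_cases hk : k = i
  · simp [hk]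
  simp only [hk, if_false]
  refine fbh_piola_alg _ _ _ (Ne.symm hk)
    (fun l p => fderiv ℂ (fun x => fbhJac f x k p) x (Pi.single l 1)) ?_
  intro l p
  have hc : ContDiffAt ℂ 2 f x :=
    (fbh_contDiffOn_nat hV hf 2).contDiffAt (hV.mem_nhds hx)
  have hsym := hc.isSymmSndFDerivAt (by simp)
  have hd : DifferentiableAt ℂ (fderiv ℂ f) x :=
    (hc.fderiv_right (m := 1) (by norm_num)).differentiableAt (by simp)
  have he : ∀ p l, fderiv ℂ (fun x => fbhJac f x k p) x (Pi.single l 1) =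
      fderiv ℂ (fderiv ℂ f) x (Pi.single l 1) (Pi.single p 1) k := by
    intro p l
    have h1 : HasFDerivAt (fun x => fbhJac f x k p)
      ((ContinuousLinearMap.proj k : (ι → ℂ) →L[ℂ] ℂ) ∘L
        ((ContinuousLinearMap.apply ℂ (ι → ℂ) (Pi.single p 1 : ι → ℂ)) ∘L
          fderiv ℂ (fderiv ℂ f) x)) x := by
      exact ((ContinuousLinearMap.proj k : (ι → ℂ) →L[ℂ] ℂ).hasFDerivAt.comp x
        ((ContinuousLinearMap.apply ℂ (ι → ℂ) (Pi.single p 1 : ι → ℂ)).hasFDerivAt.comp x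
          hd.hasFDerivAt))
    rw [h1.fderiv]; rfl
  rw [he, he, hsym (Pi.single l 1) (Pi.single p 1)]

end piola

end partB

section partC

open MeasureTheory Set Filter Topology Metric ComplexConjugate

section dbar
variable {ι : Type*} [Fintype ι] [DecidableEq ι]

/-- (twice) the antiholomorphic derivative of `G` at `x` in direction `v`. -/
noncomputable def fbhDbar (G : (ι → ℂ) → ℂ) (x v : ι → ℂ) : ℂ :=
  fderiv ℝ G x v + Complex.I * fderiv ℝ G x (Complex.I • v)

variable {G H : (ι → ℂ) → ℂ} {x : ι → ℂ}

theorem fbhDbar_mul (hG : DifferentiableAt ℝ G x) (hH : DifferentiableAt ℝ H x) (v : ι → ℂ) :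
    fbhDbar (fun y => G y * H y) x v = G x * fbhDbar H x v + H x * fbhDbar G x v := by
  unfold fbhDbar
  rw [fderiv_fun_mul hG hH]
  simp only [ContinuousLinearMap.add_apply, ContinuousLinearMap.smul_apply, smul_eq_mul]
  ring

theorem fbh_fderiv_real {F : Type*} [NormedAddCommGroup F] [NormedSpace ℂ F]
    {G : (ι → ℂ) → F} (hG : DifferentiableAt ℂ G x) (v : ι → ℂ) :
    fderiv ℝ G x v = fderiv ℂ G x v := by
  have h : HasFDerivAt G ((fderiv ℂ G x).restrictScalars ℝ) x := hG.hasFDerivAt.restrictScalars ℝ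
  rw [h.fderiv]; rfl

theorem fbhDbar_holo (hG : DifferentiableAt ℂ G x) (v : ι → ℂ) : fbhDbar G x v = 0 := by
  unfold fbhDbar
  rw [fbh_fderiv_real hG, fbh_fderiv_real hG, map_smul, smul_eq_mul, ← mul_assoc, Complex.I_mul_I]
  ring

theorem fbhDbar_conj (hG : DifferentiableAt ℂ G x) (v : ι → ℂ) :
    fbhDbar (fun y => conj (G y)) x v = 2 * conj (fderiv ℂ G x v) := by
  have h : HasFDerivAt G ((fderiv ℂ G x).restrictScalars ℝ) x := hG.hasFDerivAt.restrictScalars ℝ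
  have h2 : HasFDerivAt (fun y => conj (G y))
      ((Complex.conjCLE : ℂ →L[ℝ] ℂ) ∘L ((fderiv ℂ G x).restrictScalars ℝ)) x :=
    (Complex.conjCLE : ℂ →L[ℝ] ℂ).hasFDerivAt.comp x h
  unfold fbhDbar
  rw [h2.fderiv]
  simp only [ContinuousLinearMap.comp_apply, ContinuousLinearMap.coe_restrictScalars', map_smul,
    smul_eq_mul, ContinuousLinearEquiv.coe_coe, Complex.conjCLE_apply, map_mul, Complex.conj_I]
  have := Complex.I_mul_I
  linear_combination (-(conj (fderiv ℂ G x v))) * this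

theorem fbhDbar_add (v w : ι → ℂ) : fbhDbar G x (v + w) = fbhDbar G x v + fbhDbar G x w := by
  unfold fbhDbar
  simp only [smul_add, map_add]; ring

theorem fbhDbar_smul (c : ℂ) (v : ι → ℂ) : fbhDbar G x (c • v) = conj c * fbhDbar G x v := by
  unfold fbhDbar
  have h1 : ∀ (c : ℂ) (v : ι → ℂ), c • v = c.re • v + c.im • (Complex.I • v) := by
    intro c v
    ext i
    simp only [Pi.smul_apply, Pi.add_apply, smul_eq_mul, Complex.real_smul]
    conv_lhs => rw [← Complex.re_add_im c]
    ring
  have h2 : Complex.I • c • v = (-c.im) • v + c.re • (Complex.I • v) := by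
    rw [smul_smul, h1]; simp
  rw [h2, h1 c v]
  simp only [map_add, map_smul, Complex.real_smul]
  conv_rhs => rw [← Complex.re_add_im c]
  simp only [map_add, map_mul, Complex.conj_ofReal, Complex.conj_I]
  push_cast
  have := Complex.I_mul_I
  linear_combination ((c.im : ℂ) * (fderiv ℝ G x) (Complex.I • v)) * this

theorem fbhDbar_sum {α : Type*} (s : Finset α) (v : α → ι → ℂ) :
    fbhDbar G x (∑ a ∈ s, v a) = ∑ a ∈ s, fbhDbar G x (v a) := by
  classical
  induction s using Finset.induction_on with
  | empty => simp [fbhDbar]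
  | insert a s ha ih => rw [Finset.sum_insert ha, Finset.sum_insert ha, fbhDbar_add, ih]

theorem fbhDbar_comp {f : (ι → ℂ) → (ι → ℂ)} (hf : DifferentiableAt ℂ f x)
    (hG : DifferentiableAt ℝ G (f x)) (v : ι → ℂ) :
    fbhDbar (fun y => G (f y)) x v = fbhDbar G (f x) (fderiv ℂ f x v) := by
  have h : HasFDerivAt f ((fderiv ℂ f x).restrictScalars ℝ) x := hf.hasFDerivAt.restrictScalars ℝ
  have h2 := hG.hasFDerivAt.comp x h
  unfold fbhDbar
  rw [show (fun y => G (f y)) = G ∘ f from rfl, h2.fderiv]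
  simp

theorem fbh_holo_of_dbar (hG : DifferentiableAt ℝ G x) (h : ∀ i, fbhDbar G x (Pi.single i 1) = 0) :
    DifferentiableAt ℂ G x := by
  have h0 : ∀ v, fbhDbar G x v = 0 := by
    intro v
    have : v = ∑ i, v i • (Pi.single i 1 : ι → ℂ) := by
      ext q; simp [Finset.sum_apply, Pi.single_apply]
    rw [this, fbhDbar_sum]
    exact Finset.sum_eq_zero fun i _ => by rw [fbhDbar_smul, h i, mul_zero]
  have hI : ∀ v, fderiv ℝ G x (Complex.I • v) = Complex.I * fderiv ℝ G x v := by
    intro v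
    have := h0 v
    unfold fbhDbar at this
    have h2 := Complex.I_mul_I
    linear_combination (-Complex.I) * this + (fderiv ℝ G x (Complex.I • v)) * h2
  let L : (ι → ℂ) →L[ℂ] ℂ :=
    { toFun := fderiv ℝ G x
      map_add' := map_add _
      map_smul' := by
        intro c v
        have h1 : c • v = c.re • v + c.im • (Complex.I • v) := by
          ext i
          simp only [Pi.smul_apply, Pi.add_apply, smul_eq_mul, Complex.real_smul]
          conv_lhs => rw [← Complex.re_add_im c]
          ring
        rw [h1]
        simp only [map_add, map_smul, Complex.real_smul, hI, RingHom.id_apply, smul_eq_mul]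
        conv_rhs => rw [← Complex.re_add_im c]
        ring
      cont := (fderiv ℝ G x).continuous }
  exact (hasFDerivAt_of_restrictScalars ℝ (f' := L) hG.hasFDerivAt rfl).differentiableAt

theorem fbh_integral_dbar (hG : ContDiff ℝ 1 G) (hc : HasCompactSupport G) (v : ι → ℂ) :
    Integrable (fun x => fbhDbar G x v) ∧ ∫ x, fbhDbar G x v = 0 := by
  have hcont : ∀ v, Continuous fun x => fderiv ℝ G x v := fun v =>
    (hG.continuous_fderiv (by simp)).clm_apply continuous_const
  have hcs : ∀ v, HasCompactSupport fun x => fderiv ℝ G x v := fun v =>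
    (hc.fderiv ℝ).comp_left (g := fun L : (ι → ℂ) →L[ℝ] ℂ => L v) (by simp)
  have hIntg : ∀ v, Integrable fun x => fderiv ℝ G x v := fun v =>
    (hcont v).integrable_of_hasCompactSupport (hcs v)
  have h0 : ∀ v, ∫ x, fderiv ℝ G x v = 0 := by
    intro v
    have := integral_mul_fderiv_eq_neg_fderiv_mul_of_integrable (μ := (volume : Measure (ι → ℂ)))
      (𝕜 := ℂ) (f := fun _ => (1 : ℂ)) (g := G) (v := v) (by simp)
      (by simpa using hIntg v)
      (by simpa using hG.continuous.integrable_of_hasCompactSupport hc)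
      (fun x _ => differentiableAt_const _) (fun x _ => (hG.differentiable (by simp)) x)
    simpa using this
  unfold fbhDbar
  refine ⟨(hIntg v).add ((hIntg _).const_mul _), ?_⟩
  rw [integral_add (hIntg v) ((hIntg _).const_mul _), integral_const_mul, h0, h0]
  simp

theorem fbh_extend {E F : Type*} [NormedAddCommGroup E] [NormedSpace ℝ E] [NormedAddCommGroup F]
    [NormedSpace ℝ F] {g : E → F} {V K : Set E} (hV : IsOpen V) (hg : ContDiffOn ℝ 1 g V)
    (hK : IsCompact K) (hKV : K ⊆ V) (h0 : ∀ x ∈ V, x ∉ K → g x = 0) :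
    ContDiff ℝ 1 (indicator V g) ∧ HasCompactSupport (indicator V g) := by
  have hz : ∀ x, x ∉ K → indicator V g x = 0 := by
    intro x hx
    by_cases hxV : x ∈ V
    · rw [indicator_of_mem hxV, h0 x hxV hx]
    · rw [indicator_of_notMem hxV]
  refine ⟨?_, HasCompactSupport.intro hK hz⟩
  rw [contDiff_iff_contDiffAt]
  intro x
  by_cases hx : x ∈ V
  · refine (hg.contDiffAt (hV.mem_nhds hx)).congr_of_eventuallyEq ?_
    filter_upwards [hV.mem_nhds hx] with y hy
    rw [indicator_of_mem hy]
  · refine (contDiffAt_const (c := (0 : F))).congr_of_eventuallyEq ?_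
    filter_upwards [hK.isClosed.isOpen_compl.mem_nhds (fun h => hx (hKV h))] with y hy
    exact hz y hy

variable {f : (ι → ℂ) → (ι → ℂ)} {V W : Set (ι → ℂ)} {h : (ι → ℂ) → ℂ}

theorem fbh_J_diff (hV : IsOpen V) (hf : DifferentiableOn ℂ f V) :
    DifferentiableOn ℂ (fun x => (fbhJac f x).det) V := by
  have h1 : DifferentiableOn ℂ (fun x => fun k => fbhJac f x k) V := by
    rw [differentiableOn_pi]; intro k
    rw [differentiableOn_pi]; intro p
    exact fbhJac_entry_diff hV hf k p
  have h2 : Differentiable ℂ (fbhDetCM ι) := fun x => ((fbhDetCM ι).hasFDerivAt x).differentiableAt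
  exact h2.comp_differentiableOn h1

theorem fbh_contDiffOn_real {F : Type*} [NormedAddCommGroup F] [NormedSpace ℂ F]
    [FiniteDimensional ℂ F] {g : (ι → ℂ) → F} (hV : IsOpen V)
    (hg : DifferentiableOn ℂ g V) : ContDiffOn ℝ 1 g V :=
  (by simpa using fbh_contDiffOn_nat hV hg 1 : ContDiffOn ℂ 1 g V).restrict_scalars ℝ

theorem fbh_key (hV : IsOpen V) (hf : DifferentiableOn ℂ f V)
    (hh : DifferentiableOn ℂ h V) (ψ : (ι → ℂ) → ℂ) (hψ : ContDiff ℝ 1 ψ)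
    (hK : IsCompact (f ⁻¹' (tsupport ψ) ∩ V)) (i : ι) :
    IntegrableOn (fun x => h x * (fbhJac f x).det * conj ((fbhJac f x).det) *
      fbhDbar ψ (f x) (Pi.single i 1)) V ∧
    ∫ x in V, h x * (fbhJac f x).det * conj ((fbhJac f x).det) *
      fbhDbar ψ (f x) (Pi.single i 1) = 0 := by
  set J := fun x => (fbhJac f x).det with hJ
  have hJd := fbh_J_diff hV hf
  set A := fun l x => (fbhJac f x).adjugate l i with hA
  have hAd : ∀ l, DifferentiableOn ℂ (A l) V := fun l x hx =>
    ((fbh_piola hV hf i hx).1 l).differentiableWithinAt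
  set g : ι → (ι → ℂ) → ℂ := fun l x => (h x * J x) * (conj (A l x) * ψ (f x)) with hg
  have hψf : ContDiffOn ℝ 1 (fun x => ψ (f x)) V :=
    hψ.comp_contDiffOn (fbh_contDiffOn_real hV hf)
  have hAc : ∀ l, ContDiffOn ℝ 1 (fun x => conj (A l x)) V := fun l =>
    (Complex.conjCLE : ℂ →L[ℝ] ℂ).contDiff.comp_contDiffOn (fbh_contDiffOn_real hV (hAd l))
  have hgc : ∀ l, ContDiffOn ℝ 1 (g l) V := fun l =>
    ((fbh_contDiffOn_real hV hh).mul (fbh_contDiffOn_real hV hJd)).mul ((hAc l).mul hψf)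
  have hext : ∀ l, ContDiff ℝ 1 (indicator V (g l)) ∧ HasCompactSupport (indicator V (g l)) := by
    intro l
    refine fbh_extend hV (hgc l) hK inter_subset_right ?_
    intro x hx hxK
    have : ψ (f x) = 0 := by
      by_contra hne
      exact hxK ⟨subset_tsupport _ hne, hx⟩
    simp [hg, this]
  have hpt : ∀ x, ∑ l, fbhDbar (indicator V (g l)) x (Pi.single l 1) =
      indicator V (fun x => h x * J x * conj (J x) * fbhDbar ψ (f x) (Pi.single i 1)) x := by
    intro x
    by_cases hx : x ∈ V
    · have hVx := hV.mem_nhds hx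
      rw [indicator_of_mem hx]
      have h1 : ∀ l, fbhDbar (indicator V (g l)) x (Pi.single l 1) =
          fbhDbar (g l) x (Pi.single l 1) := by
        intro l
        unfold fbhDbar
        have : indicator V (g l) =ᶠ[𝓝 x] g l := by
          filter_upwards [hVx] with y hy
          rw [indicator_of_mem hy]
        rw [this.fderiv_eq]
      have hhx := (hh x hx).differentiableAt hVx
      have hfx := (hf x hx).differentiableAt hVx
      have hJx := (hJd x hx).differentiableAt hVx
      have hψx : DifferentiableAt ℝ ψ (f x) := (hψ.differentiable (by simp)) _
      have hAx := fun l => ((hAd l) x hx).differentiableAt hVx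
      have h2 : ∀ l, fbhDbar (g l) x (Pi.single l 1) =
          h x * J x * (ψ (f x) * 2 * conj (fderiv ℂ (A l) x (Pi.single l 1)) +
            fbhDbar ψ (f x) (A l x • fderiv ℂ f x (Pi.single l 1))) := by
        intro l
        rw [hg]
        rw [fbhDbar_mul (G := fun x => h x * J x) (H := fun x => conj (A l x) * ψ (f x))
          ((hhx.mul hJx).restrictScalars ℝ)
          ((((hAc l).mul hψf).contDiffAt hVx).differentiableAt (by simp)),
          fbhDbar_holo (G := fun x => h x * J x) (hhx.mul hJx),
          fbhDbar_mul (G := fun x => conj (A l x)) (H := fun x => ψ (f x))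
            (((hAc l).contDiffAt hVx).differentiableAt (by simp))
            ((hψf.contDiffAt hVx).differentiableAt (by simp)),
          fbhDbar_conj (hAx l), fbhDbar_comp hfx hψx, fbhDbar_smul]
        ring
      simp_rw [h1, h2]
      rw [← Finset.mul_sum, Finset.sum_add_distrib, ← Finset.mul_sum, ← map_sum,
        (fbh_piola hV hf i hx).2, ← fbhDbar_sum]
      have h3 : ∑ l, A l x • fderiv ℂ f x (Pi.single l 1) = J x • (Pi.single i 1 : ι → ℂ) := by
        have h4 := congrArg (fun M : Matrix ι ι ℂ => fun j => M j i) (Matrix.mul_adjugate (fbhJac f x))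
        ext j
        have h5 := congrFun h4 j
        simp only [Matrix.mul_apply, Matrix.smul_apply, smul_eq_mul] at h5
        simp only [Finset.sum_apply, Pi.smul_apply, smul_eq_mul]
        rw [show (Pi.single i 1 : ι → ℂ) j = (1 : Matrix ι ι ℂ) j i by
          simp [Matrix.one_apply, Pi.single_apply], ← h5]
        refine Finset.sum_congr rfl fun l _ => ?_
        simp only [hA, fbhJac]; ring
      rw [h3, fbhDbar_smul]
      simp; ring
    · rw [indicator_of_notMem hx]
      refine Finset.sum_eq_zero fun l _ => ?_
      have hxx : x ∉ tsupport (indicator V (g l)) := by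
        intro hxs
        have : tsupport (indicator V (g l)) ⊆ f ⁻¹' (tsupport ψ) ∩ V := by
          refine closure_minimal ?_ hK.isClosed
          intro y hy
          rw [Function.mem_support] at hy
          have hyV : y ∈ V := by
            by_contra hc; exact hy (indicator_of_notMem hc _)
          refine ⟨subset_tsupport _ ?_, hyV⟩
          rw [indicator_of_mem hyV] at hy
          intro h0
          exact hy (by simp [hg, h0])
        exact hx (this hxs).2
      have h6 : indicator V (g l) =ᶠ[𝓝 x] fun _ => (0 : ℂ) := notMem_tsupport_iff_eventuallyEq.1 hxx
      unfold fbhDbar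
      rw [h6.fderiv_eq]
      simp
  have hIntg := integrable_finsetSum Finset.univ fun l _ =>
    (fbh_integral_dbar (hext l).1 (hext l).2 (Pi.single l 1)).1
  constructor
  · rw [← integrable_indicator_iff hV.measurableSet]
    exact hIntg.congr (Eventually.of_forall hpt)
  rw [← integral_indicator hV.measurableSet]
  refine (integral_congr_ae (Eventually.of_forall fun x => (hpt x).symm)).trans ?_
  rw [integral_finsetSum _ fun l _ => (fbh_integral_dbar (hext l).1 (hext l).2 _).1]
  exact Finset.sum_eq_zero fun l _ => (fbh_integral_dbar (hext l).1 (hext l).2 _).2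

end dbar

end partC

section partD

open MeasureTheory Set Filter Topology Metric ComplexConjugate

section param
variable {ι : Type*} [Fintype ι] [DecidableEq ι]
variable {f : (ι → ℂ) → (ι → ℂ)} {V W : Set (ι → ℂ)} {h : (ι → ℂ) → ℂ}

theorem fbh_param {T : Type*} [NormedAddCommGroup T] [NormedSpace ℝ T] [FiniteDimensional ℝ T]
    (hV : IsOpen V) (hf : ContinuousOn f V) {F : (ι → ℂ) → ℂ} (hF : ContinuousOn F V)
    {K : Set (ι → ℂ)} (hK : IsCompact K) (hQ : IsCompact (f ⁻¹' K ∩ V))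
    {ψ : T → (ι → ℂ) → ℂ} {U : Set T} (hU : IsOpen U) {t0 : T} (ht0 : t0 ∈ U)
    (hψ : ContDiffOn ℝ 1 (fun p : T × (ι → ℂ) => ψ p.1 p.2) (U ×ˢ univ))
    (hs : ∀ t ∈ U, ∀ y, y ∉ K → ψ t y = 0) :
    Integrable (fun x => F x • fderiv ℝ (fun t => ψ t (f x)) t0) (volume.restrict V) ∧
    HasFDerivAt (fun t => ∫ x in V, F x * ψ t (f x))
      (∫ x in V, F x • fderiv ℝ (fun t => ψ t (f x)) t0) t0 := by
  set Q := f ⁻¹' K ∩ V with hQdef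
  have hQV : Q ⊆ V := inter_subset_right
  have hUV : IsOpen (U ×ˢ (univ : Set (ι → ℂ))) := hU.prod isOpen_univ
  have hd : ∀ t ∈ U, ∀ y, HasFDerivAt (fun t => ψ t y)
      ((fderiv ℝ (fun p : T × (ι → ℂ) => ψ p.1 p.2) (t, y)) ∘L
        (ContinuousLinearMap.inl ℝ T (ι → ℂ))) t := by
    intro t ht y
    have h1 : HasFDerivAt (fun p : T × (ι → ℂ) => ψ p.1 p.2)
      (fderiv ℝ (fun p : T × (ι → ℂ) => ψ p.1 p.2) (t, y)) (t, y) :=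
      ((hψ.contDiffAt (hUV.mem_nhds ⟨ht, mem_univ _⟩)).differentiableAt (by simp)).hasFDerivAt
    exact HasFDerivAt.comp (g := fun p : T × (ι → ℂ) => ψ p.1 p.2) (f := fun e => (e, y)) t h1
      (hasFDerivAt_prodMk_left t y)
  have hcd : ContinuousOn (fderiv ℝ (fun p : T × (ι → ℂ) => ψ p.1 p.2)) (U ×ˢ univ) :=
    hψ.continuousOn_fderiv_of_isOpen hUV (by simp)
  -- compact neighbourhood
  obtain ⟨r, hr, hrU⟩ := Metric.nhds_basis_closedBall.mem_iff.1 (hU.mem_nhds ht0)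
  have : ProperSpace T := FiniteDimensional.proper ℝ T
  have hcomp : IsCompact (closedBall t0 r ×ˢ K) := (isCompact_closedBall t0 r).prod hK
  obtain ⟨C, hC⟩ := hcomp.exists_bound_of_continuousOn
    (hcd.mono (prod_mono hrU (subset_univ _)))
  have hQm : MeasurableSet Q := hQ.isClosed.measurableSet
  have hFQ : IntegrableOn F Q := (hF.mono hQV).integrableOn_compact hQ
  set F' : T → (ι → ℂ) → (T →L[ℝ] ℂ) := fun t x => F x • fderiv ℝ (fun t => ψ t (f x)) t with hF'
  have hcF : ∀ t ∈ U, ContinuousOn (fun x => F x * ψ t (f x)) Q := by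
    intro t ht
    refine (hF.mono hQV).mul ?_
    have : ContinuousOn (fun x => (t, f x)) Q := continuousOn_const.prodMk (hf.mono hQV)
    exact hψ.continuousOn.comp this (fun x _ => ⟨ht, mem_univ _⟩)
  have hcF' : ∀ t ∈ U, ContinuousOn (F' t) Q := by
    intro t ht
    refine (hF.mono hQV).smul ?_
    have : ContinuousOn (fun x => (t, f x)) Q := continuousOn_const.prodMk (hf.mono hQV)
    have h2 := hcd.comp this (fun x _ => ⟨ht, mem_univ _⟩)
    have h3 : ContinuousOn (fun x => (fderiv ℝ (fun p : T × (ι → ℂ) => ψ p.1 p.2) (t, f x)) ∘L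
        (ContinuousLinearMap.inl ℝ T (ι → ℂ))) Q := h2.clm_comp continuousOn_const
    exact h3.congr fun x _ => (hd t ht (f x)).fderiv
  have key := hasFDerivAt_integral_of_dominated_of_fderiv_le (𝕜 := ℝ)
    (μ := volume.restrict Q) (s := closedBall t0 r)
    (F := fun t x => F x * ψ t (f x)) (F' := F')
    (bound := fun x => ‖F x‖ * (C * ‖ContinuousLinearMap.inl ℝ T (ι → ℂ)‖)) (x₀ := t0)
    (closedBall_mem_nhds t0 hr)
    (by filter_upwards [hU.mem_nhds ht0] with t ht
        exact (hcF t ht).aestronglyMeasurable hQm)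
    ((hcF t0 ht0).integrableOn_compact hQ)
    ((hcF' t0 ht0).aestronglyMeasurable hQm)
    (by
      rw [ae_restrict_iff' hQm]
      refine Eventually.of_forall fun x hx t ht => ?_
      simp only [hF', norm_smul]
      gcongr
      rw [(hd t (hrU ht) (f x)).fderiv]
      refine (ContinuousLinearMap.opNorm_comp_le _ _).trans ?_
      gcongr
      exact hC (t, f x) ⟨ht, hx.1⟩)
    (hFQ.norm.mul_const _)
    (by
      refine Eventually.of_forall fun x t ht => ?_
      have h1 := hd t (hrU ht) (f x)
      have h2 := h1.const_smul (F x)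
      simp only [hF']
      rw [h1.fderiv]
      exact h2)
  have hz : ∀ t ∈ U, ∀ x ∈ V, x ∉ Q → ψ t (f x) = 0 := fun t ht x hx hxQ =>
    hs t ht _ (fun hk => hxQ ⟨hk, hx⟩)
  have hz' : ∀ t ∈ U, ∀ x ∈ V, x ∉ Q → F' t x = 0 := by
    intro t ht x hx hxQ
    have h1 : (fun t => ψ t (f x)) =ᶠ[𝓝 t] fun _ => 0 := by
      filter_upwards [hU.mem_nhds ht] with s hs'
      exact hz s hs' x hx hxQ
    simp only [hF']
    rw [h1.fderiv_eq, fderiv_fun_const]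
    refine ContinuousLinearMap.ext fun v => ?_
    change F x * (0 : ℂ) = 0
    exact mul_zero _
  have e1 : ∀ t ∈ U, ∫ x in V, F x * ψ t (f x) = ∫ x in Q, F x * ψ t (f x) := by
    intro t ht
    refine setIntegral_eq_of_subset_of_forall_diff_eq_zero hV.measurableSet hQV ?_
    intro x hx
    rw [hz t ht x hx.1 hx.2, mul_zero]
  have e2 : ∫ x in V, F' t0 x = ∫ x in Q, F' t0 x :=
    setIntegral_eq_of_subset_of_forall_diff_eq_zero hV.measurableSet hQV
      (fun x hx => hz' t0 ht0 x hx.1 hx.2)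
  constructor
  · have h1 : IntegrableOn (F' t0) Q := (hcF' t0 ht0).integrableOn_compact hQ
    have h2 : ∀ x ∈ V \ Q, F' t0 x = 0 := fun x hx => hz' t0 ht0 x hx.1 hx.2
    exact IntegrableOn.of_forall_diff_eq_zero (f := F' t0) h1 hV.measurableSet h2
  · change HasFDerivAt _ (∫ x in V, F' t0 x) t0
    rw [e2]
    refine key.congr_of_eventuallyEq ?_
    filter_upwards [hU.mem_nhds ht0] with t ht
    exact e1 t ht

end param

end partD

section partE1

open MeasureTheory Set Filter Topology Metric ComplexConjugate

section bump
variable {ι : Type*} [Fintype ι] [DecidableEq ι]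

/-- squared Euclidean norm -/
noncomputable def fbhN (y : ι → ℂ) : ℝ := ∑ i, ((y i).re ^ 2 + (y i).im ^ 2)

/-- mollifier -/
noncomputable def fbhEta (ε : ℝ) (y : ι → ℂ) : ℂ :=
  (((ε ^ (2 * Fintype.card ι))⁻¹ * Real.smoothTransition (1 - fbhN y / ε ^ 2) : ℝ) : ℂ)

theorem fbhN_contDiff : ContDiff ℝ 1 (fbhN : (ι → ℂ) → ℝ) := by
  unfold fbhN
  refine ContDiff.sum fun i _ => ?_
  have h0 : ContDiff ℝ 1 fun y : ι → ℂ => y i := contDiff_apply ℝ ℂ i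
  have h1 : ContDiff ℝ 1 fun y : ι → ℂ => (y i).re := Complex.reCLM.contDiff.comp h0
  have h2 : ContDiff ℝ 1 fun y : ι → ℂ => (y i).im := Complex.imCLM.contDiff.comp h0
  exact (h1.pow 2).add (h2.pow 2)

theorem fbhN_ge (y : ι → ℂ) {ε : ℝ} (hε : 0 ≤ ε) (h : ε < ‖y‖) : ε ^ 2 < fbhN y := by
  have : ∃ i, ε < ‖y i‖ := by
    by_contra hc
    push Not at hc
    exact absurd ((pi_norm_le_iff_of_nonneg hε).2 hc) (not_le.2 h)
  obtain ⟨i, hi⟩ := this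
  have h1 : (y i).re ^ 2 + (y i).im ^ 2 ≤ fbhN y :=
    Finset.single_le_sum (f := fun i => (y i).re ^ 2 + (y i).im ^ 2)
      (fun i _ => by positivity) (Finset.mem_univ i)
  have h2 : ‖y i‖ ^ 2 = (y i).re ^ 2 + (y i).im ^ 2 := by
    rw [Complex.sq_norm, Complex.normSq_apply]; ring
  nlinarith

theorem fbhEta_zero {ε : ℝ} (hε : 0 < ε) {y : ι → ℂ} (h : ε < ‖y‖) : fbhEta ε y = 0 := by
  have := fbhN_ge y hε.le h
  unfold fbhEta
  rw [Real.smoothTransition.zero_of_nonpos]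
  · simp
  · rw [sub_nonpos, le_div_iff₀ (by positivity)]; linarith

theorem fbhEta_contDiffOn :
    ContDiffOn ℝ 1 (fun p : ℝ × (ι → ℂ) => fbhEta p.1 p.2) (Ioi 0 ×ˢ univ) := by
  unfold fbhEta
  refine Complex.ofRealCLM.contDiff.comp_contDiffOn ?_
  have hfst : ContDiffOn ℝ 1 (fun p : ℝ × (ι → ℂ) => p.1) (Ioi 0 ×ˢ univ) := contDiff_fst.contDiffOn
  refine ContDiffOn.mul ((hfst.pow _).inv ?_) ?_
  · intro p hp; exact pow_ne_zero _ (ne_of_gt hp.1)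
  · refine (Real.smoothTransition.contDiff (n := 1)).comp_contDiffOn ?_
    refine contDiffOn_const.sub (ContDiffOn.div ?_ (hfst.pow 2) ?_)
    · exact (fbhN_contDiff.comp contDiff_snd).contDiffOn
    · intro p hp; exact pow_ne_zero _ (ne_of_gt hp.1)

theorem fbhEta_contDiff {ε : ℝ} (hε : 0 < ε) : ContDiff ℝ 1 (fbhEta ε : (ι → ℂ) → ℂ) := by
  have h1 : ContDiff ℝ 1 fun y : ι → ℂ => (ε, y) := contDiff_const.prodMk contDiff_id
  rw [← contDiffOn_univ]
  exact fbhEta_contDiffOn.comp h1.contDiffOn (fun y _ => ⟨hε, mem_univ _⟩)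

theorem fbhN_hasFDerivAt (y : ι → ℂ) :
    HasFDerivAt (fbhN : (ι → ℂ) → ℝ) (∑ i, ((2 * (y i).re) •
      (Complex.reCLM ∘L (ContinuousLinearMap.proj i : (ι → ℂ) →L[ℝ] ℂ)) + (2 * (y i).im) •
      (Complex.imCLM ∘L (ContinuousLinearMap.proj i : (ι → ℂ) →L[ℝ] ℂ)))) y := by
  unfold fbhN
  refine HasFDerivAt.fun_sum fun i _ => ?_
  have h0 : HasFDerivAt (fun y : ι → ℂ => y i) (ContinuousLinearMap.proj i : (ι → ℂ) →L[ℝ] ℂ) y :=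
    hasFDerivAt_apply i y
  have h1 : HasFDerivAt (fun y : ι → ℂ => (y i).re) _ y := Complex.reCLM.hasFDerivAt.comp y h0
  have h2 : HasFDerivAt (fun y : ι → ℂ => (y i).im) _ y := Complex.imCLM.hasFDerivAt.comp y h0
  have := (h1.pow 2).fun_add (h2.pow 2)
  simpa using this

theorem fbhEta_dbar {ε : ℝ} (hε : 0 < ε) (y : ι → ℂ) (i : ι) :
    fbhDbar (fbhEta ε) y (Pi.single i 1) = -(((ε ^ (2 * Fintype.card ι))⁻¹ *
      deriv Real.smoothTransition (1 - fbhN y / ε ^ 2) * (ε ^ 2)⁻¹ : ℝ) : ℂ) * (2 * y i) := by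
  have hst : HasDerivAt Real.smoothTransition (deriv Real.smoothTransition (1 - fbhN y / ε ^ 2))
      (1 - fbhN y / ε ^ 2) :=
    ((Real.smoothTransition.contDiff (n := 1)).differentiable (by simp) _).hasDerivAt
  have h1 := ((fbhN_hasFDerivAt y).mul_const (ε ^ 2)⁻¹).const_sub 1
  have h2 := (hst.comp_hasFDerivAt y (f := fun y => 1 - fbhN y * (ε ^ 2)⁻¹) h1).const_mul
    (ε ^ (2 * Fintype.card ι))⁻¹
  have h3 : HasFDerivAt (fbhEta ε) _ y := Complex.ofRealCLM.hasFDerivAt.comp y h2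
  unfold fbhDbar
  rw [h3.fderiv]
  simp [Finset.sum_apply, Pi.single_apply, Finset.sum_add_distrib, apply_ite]
  apply Complex.ext <;> simp <;> ring

theorem fbhEta_deriv {ε : ℝ} (hε : 0 < ε) (y : ι → ℂ) :
    HasDerivAt (fun ε => fbhEta ε y) (-(ε : ℂ)⁻¹ *
      ∑ i, fbhDbar (fun y' => conj (y' i) * fbhEta ε y') y (Pi.single i 1)) ε := by
  have hst : HasDerivAt Real.smoothTransition (deriv Real.smoothTransition (1 - fbhN y / ε ^ 2))
      (1 - fbhN y / ε ^ 2) :=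
    ((Real.smoothTransition.contDiff (n := 1)).differentiable (by simp) _).hasDerivAt
  have h0 : HasDerivAt (fun ε : ℝ => 1 - fbhN y / ε ^ 2) (2 * fbhN y / ε ^ 3) ε := by
    have := (((hasDerivAt_id ε).pow 2).fun_inv (by simpa using hε.ne')).const_mul (fbhN y) |>.const_sub 1
    refine this.congr_deriv ?_
    simp; field_simp
  have h1 := hst.comp ε h0
  have h2 : HasDerivAt (fun ε : ℝ => (ε ^ (2 * Fintype.card ι))⁻¹)
      (-(2 * Fintype.card ι : ℝ) / ε * (ε ^ (2 * Fintype.card ι))⁻¹) ε := by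
    have := ((hasDerivAt_id ε).pow (2 * Fintype.card ι)).fun_inv (pow_ne_zero _ hε.ne')
    refine this.congr_deriv ?_
    rcases Nat.eq_zero_or_pos (Fintype.card ι) with h | h
    · simp [h]
    · obtain ⟨k, hk⟩ : ∃ k, 2 * Fintype.card ι = k + 1 := ⟨2 * Fintype.card ι - 1, by omega⟩
      have hk' : (2 * Fintype.card ι : ℝ) = k + 1 := by exact_mod_cast hk
      rw [hk', hk]
      simp
      field_simp
      ring
  have h3 := (h2.mul h1).ofReal_comp
  refine HasDerivAt.congr_deriv (f := fun ε => fbhEta ε y) h3 ?_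
  have hconj : ∀ i, fbhDbar (fun y' => conj (y' i) * fbhEta ε y') y (Pi.single i 1) =
      conj (y i) * fbhDbar (fbhEta ε) y (Pi.single i 1) + fbhEta ε y * 2 := by
    intro i
    have hd : DifferentiableAt ℂ (fun y' : ι → ℂ => y' i) y := differentiableAt_apply i y
    rw [fbhDbar_mul (G := fun y' => conj (y' i))
      ((Complex.conjCLE : ℂ →L[ℝ] ℂ).differentiableAt.comp y (hd.restrictScalars ℝ))
      ((fbhEta_contDiff hε).differentiable (by simp) y), fbhDbar_conj hd]
    have : fderiv ℂ (fun y' : ι → ℂ => y' i) y (Pi.single i 1) = 1 := by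
      rw [(hasFDerivAt_apply i y).fderiv]; simp
    rw [this]; simp
  simp_rw [hconj, fbhEta_dbar hε]
  rw [Finset.sum_add_distrib]
  have h5 : ∑ i, conj (y i) * (-(((ε ^ (2 * Fintype.card ι))⁻¹ *
      deriv Real.smoothTransition (1 - fbhN y / ε ^ 2) * (ε ^ 2)⁻¹ : ℝ) : ℂ) * (2 * y i)) =
      -(((ε ^ (2 * Fintype.card ι))⁻¹ *
      deriv Real.smoothTransition (1 - fbhN y / ε ^ 2) * (ε ^ 2)⁻¹ : ℝ) : ℂ) * (2 * (fbhN y : ℂ)) := by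
    unfold fbhN
    push_cast
    rw [Finset.mul_sum, Finset.mul_sum]
    refine Finset.sum_congr rfl fun i _ => ?_
    have : conj (y i) * y i = ((y i).re ^ 2 + (y i).im ^ 2 : ℝ) := by
      rw [mul_comm, Complex.mul_conj, Complex.normSq_apply]; push_cast; ring
    push_cast at this
    rw [← this]; ring
  rw [h5]
  have hε' : (ε : ℂ) ≠ 0 := by exact_mod_cast hε.ne'
  simp only [Finset.sum_const, Finset.card_univ, nsmul_eq_mul, fbhEta, Function.comp]
  push_cast
  field_simp
  ring

end bump

end partE1

section partE2

open MeasureTheory Set Filter Topology Metric ComplexConjugate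

section Phi
variable {ι : Type*} [Fintype ι] [DecidableEq ι]
variable {f : (ι → ℂ) → (ι → ℂ)} {V W : Set (ι → ℂ)} {h : (ι → ℂ) → ℂ}

/-- mollified trace -/
noncomputable def fbhPhi (V : Set (ι → ℂ)) (f : (ι → ℂ) → (ι → ℂ)) (h : (ι → ℂ) → ℂ)
    (a : ι → ℂ) (ε : ℝ) : ℂ :=
  ∫ x in V, h x * (fbhJac f x).det * conj ((fbhJac f x).det) * fbhEta ε (f x - a)

theorem fbh_F_cont (hV : IsOpen V) (hf : DifferentiableOn ℂ f V) (hh : DifferentiableOn ℂ h V) :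
    ContinuousOn (fun x => h x * (fbhJac f x).det * conj ((fbhJac f x).det)) V := by
  have := (fbh_J_diff hV hf).continuousOn
  exact (hh.continuousOn.mul this).mul (Complex.continuous_conj.comp_continuousOn this)

theorem fbhDbar_translate {G : (ι → ℂ) → ℂ} (hG : Differentiable ℝ G) (a y v : ι → ℂ) :
    fbhDbar (fun y => G (y - a)) y v = fbhDbar G (y - a) v := by
  have h1 : HasFDerivAt (fun y : ι → ℂ => y - a) (ContinuousLinearMap.id ℂ (ι → ℂ)) y :=
    (hasFDerivAt_id y).sub_const a
  rw [fbhDbar_comp h1.differentiableAt (hG _), h1.fderiv]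
  rfl

theorem fbh_compact_tsupport {G : (ι → ℂ) → ℂ} {a : ι → ℂ} {ρ : ℝ}
    (hG : ∀ y, ρ < ‖y - a‖ → G y = 0) : tsupport G ⊆ closedBall a ρ := by
  refine closure_minimal ?_ isClosed_closedBall
  intro y hy
  rw [mem_closedBall, dist_eq_norm]
  by_contra hc
  exact hy (hG y (not_le.1 hc))

theorem fbhPhi_holo (hV : IsOpen V) (hf : DifferentiableOn ℂ f V) (hh : DifferentiableOn ℂ h V)
    (hprop : ∀ K, K ⊆ W → IsCompact K → IsCompact (f ⁻¹' K ∩ V)) {a : ι → ℂ} {ρ ε : ℝ}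
    (hρ : closedBall a ρ ⊆ W) (hε : 0 < ε) (hερ : ε < ρ) :
    DifferentiableAt ℂ (fun a => fbhPhi V f h a ε) a := by
  have hηd : Differentiable ℝ (fbhEta ε : (ι → ℂ) → ℂ) := (fbhEta_contDiff hε).differentiable (by simp)
  obtain ⟨hIntg, hder⟩ := fbh_param (T := ι → ℂ) hV hf.continuousOn (fbh_F_cont hV hf hh)
    (isCompact_closedBall a ρ) (hprop _ hρ (isCompact_closedBall a ρ))
    (ψ := fun a y => fbhEta ε (y - a)) (U := ball a (ρ - ε)) isOpen_ball
    (mem_ball_self (by linarith)) (t0 := a)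
    (((fbhEta_contDiff hε).comp (contDiff_snd.sub contDiff_fst)).contDiffOn)
    (by
      intro t ht y hy
      refine fbhEta_zero hε ?_
      rw [mem_ball, dist_eq_norm] at ht
      rw [mem_closedBall, dist_eq_norm, not_le] at hy
      have := norm_add_le (y - t) (t - a)
      rw [sub_add_sub_cancel] at this
      linarith)
  refine fbh_holo_of_dbar hder.differentiableAt fun i => ?_
  have key := (fbh_key hV hf hh (fun y => fbhEta ε (y - a))
    ((fbhEta_contDiff hε).comp (contDiff_id.sub contDiff_const)) (by
      have hsub : tsupport (fun y => fbhEta ε (y - a)) ⊆ closedBall a ε :=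
        fbh_compact_tsupport fun y hy => fbhEta_zero hε hy
      exact hprop _ (hsub.trans ((closedBall_subset_closedBall hερ.le).trans hρ))
        ((isCompact_closedBall a ε).of_isClosed_subset (isClosed_tsupport _) hsub)) i).2
  unfold fbhDbar
  have hfd : ∀ (y v : ι → ℂ), fderiv ℝ (fun a => fbhEta ε (y - a)) a v =
      - fderiv ℝ (fun y => fbhEta ε (y - a)) y v := by
    intro y v
    have h1 : HasFDerivAt (fun a : ι → ℂ => y - a) (-ContinuousLinearMap.id ℝ (ι → ℂ)) a :=
      (hasFDerivAt_id a).const_sub y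
    have h2 : HasFDerivAt (fun y : ι → ℂ => y - a) (ContinuousLinearMap.id ℝ (ι → ℂ)) y :=
      (hasFDerivAt_id y).sub_const a
    have h3 := HasFDerivAt.comp (g := fbhEta ε) (f := fun a : ι → ℂ => y - a) a (hηd (y - a)).hasFDerivAt h1
    have h4 := HasFDerivAt.comp (g := fbhEta ε) (f := fun y : ι → ℂ => y - a) y (hηd (y - a)).hasFDerivAt h2
    rw [show (fun a => fbhEta ε (y - a)) = fbhEta ε ∘ (fun a : ι → ℂ => y - a) from rfl,
      show (fun y => fbhEta ε (y - a)) = fbhEta ε ∘ (fun y : ι → ℂ => y - a) from rfl,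
      h3.fderiv, h4.fderiv]
    simp
  have hfP : fderiv ℝ (fun a => fbhPhi V f h a ε) a = _ := hder.fderiv
  have hI : ∀ v, Integrable (fun x => (h x * (fbhJac f x).det * conj ((fbhJac f x).det)) *
      fderiv ℝ (fun t => fbhEta ε (f x - t)) a v) (volume.restrict V) := fun v =>
    hIntg.apply_continuousLinearMap v
  rw [hfP, ContinuousLinearMap.integral_apply hIntg, ContinuousLinearMap.integral_apply hIntg]
  have e1 : ∀ v, ∫ x in V, ((h x * (fbhJac f x).det * conj ((fbhJac f x).det)) •
      fderiv ℝ (fun t => fbhEta ε (f x - t)) a) v =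
      ∫ x in V, (h x * (fbhJac f x).det * conj ((fbhJac f x).det)) *
      fderiv ℝ (fun t => fbhEta ε (f x - t)) a v := fun v => rfl
  rw [e1, e1, ← integral_const_mul, ← integral_add (hI _) ((hI _).const_mul _)]
  rw [← neg_eq_zero, ← integral_neg]
  rw [← key]
  refine integral_congr_ae (Eventually.of_forall fun x => ?_)
  simp only [hfd, fbhDbar]
  ring

theorem fbhPhi_deriv (hV : IsOpen V) (hf : DifferentiableOn ℂ f V) (hh : DifferentiableOn ℂ h V)
    (hprop : ∀ K, K ⊆ W → IsCompact K → IsCompact (f ⁻¹' K ∩ V)) {a : ι → ℂ} {ρ ε : ℝ}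
    (hρ : closedBall a ρ ⊆ W) (hε : 0 < ε) (hερ : ε < ρ) :
    HasDerivAt (fun ε => fbhPhi V f h a ε) 0 ε := by
  have hηd : Differentiable ℝ (fbhEta ε : (ι → ℂ) → ℂ) := (fbhEta_contDiff hε).differentiable (by simp)
  obtain ⟨hIntg, hder⟩ := fbh_param (T := ℝ) hV hf.continuousOn (fbh_F_cont hV hf hh)
    (isCompact_closedBall a ρ) (hprop _ hρ (isCompact_closedBall a ρ))
    (ψ := fun ε y => fbhEta ε (y - a)) (U := Ioo 0 ρ) isOpen_Ioo
    (t0 := ε) ⟨hε, hερ⟩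
    (fbhEta_contDiffOn.comp (t := Ioi 0 ×ˢ univ)
      (contDiff_fst.prodMk (contDiff_snd.sub contDiff_const)).contDiffOn
      (fun p hp => ⟨hp.1.1, mem_univ _⟩))
    (by
      intro t ht y hy
      refine fbhEta_zero ht.1 ?_
      rw [mem_closedBall, dist_eq_norm, not_le] at hy
      linarith [ht.2])
  have hd : HasDerivAt (fun ε => fbhPhi V f h a ε) _ ε := hder.hasDerivAt
  refine hd.congr_deriv ?_
  rw [ContinuousLinearMap.integral_apply hIntg]
  have key := fun i => (fbh_key hV hf hh (fun y => conj ((y - a) i) * fbhEta ε (y - a))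
    (by
      have h1 : ContDiff ℝ 1 fun y : ι → ℂ => y - a := contDiff_id.sub contDiff_const
      have h2 : ContDiff ℝ 1 fun y : ι → ℂ => (y - a) i := (contDiff_apply ℝ ℂ i).comp h1
      exact ((Complex.conjCLE : ℂ →L[ℝ] ℂ).contDiff.comp h2).mul ((fbhEta_contDiff hε).comp h1)) (by
      have hsub : tsupport (fun y => conj ((y - a) i) * fbhEta ε (y - a)) ⊆ closedBall a ε :=
        fbh_compact_tsupport fun y hy => by rw [fbhEta_zero hε hy, mul_zero]
      exact hprop _ (hsub.trans ((closedBall_subset_closedBall hερ.le).trans hρ))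
        ((isCompact_closedBall a ε).of_isClosed_subset (isClosed_tsupport _) hsub)) i)
  have e1 : ∀ x, ((h x * (fbhJac f x).det * conj ((fbhJac f x).det)) •
      fderiv ℝ (fun t => fbhEta t (f x - a)) ε) 1 = -(ε : ℂ)⁻¹ * ∑ i,
      (h x * (fbhJac f x).det * conj ((fbhJac f x).det)) *
      fbhDbar (fun y => conj ((y - a) i) * fbhEta ε (y - a)) (f x) (Pi.single i 1) := by
    intro x
    change (h x * (fbhJac f x).det * conj ((fbhJac f x).det)) *
      (fderiv ℝ (fun t => fbhEta t (f x - a)) ε 1) = _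
    rw [fderiv_eq_smul_deriv, (fbhEta_deriv hε (f x - a)).deriv, one_smul, ← Finset.mul_sum]
    have : ∀ i, fbhDbar (fun y => conj ((y - a) i) * fbhEta ε (y - a)) (f x) (Pi.single i 1) =
        fbhDbar (fun y' => conj (y' i) * fbhEta ε y') (f x - a) (Pi.single i 1) := fun i =>
      fbhDbar_translate (G := fun y' => conj (y' i) * fbhEta ε y') (by
        have h2 : Differentiable ℝ fun y : ι → ℂ => y i := differentiable_apply i
        exact ((Complex.conjCLE : ℂ →L[ℝ] ℂ).differentiable.comp h2).mul hηd) a (f x) _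
    simp_rw [this]
    ring
  simp_rw [e1]
  rw [integral_const_mul, integral_finsetSum _ fun i _ => (key i).1]
  rw [Finset.sum_eq_zero fun i _ => (key i).2, mul_zero]

theorem fbhPhi_const (hV : IsOpen V) (hf : DifferentiableOn ℂ f V) (hh : DifferentiableOn ℂ h V)
    (hprop : ∀ K, K ⊆ W → IsCompact K → IsCompact (f ⁻¹' K ∩ V)) {a : ι → ℂ} {ρ ε ε' : ℝ}
    (hρ : closedBall a ρ ⊆ W) (hε : ε ∈ Ioo 0 ρ) (hε' : ε' ∈ Ioo 0 ρ) :
    fbhPhi V f h a ε = fbhPhi V f h a ε' := by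
  refine (convex_Ioo 0 ρ).is_const_of_fderivWithin_eq_zero (𝕜 := ℝ)
    (f := fun ε => fbhPhi V f h a ε) ?_ ?_ hε hε'
  · intro x hx
    exact (fbhPhi_deriv hV hf hh hprop hρ hx.1 hx.2).differentiableAt.differentiableWithinAt
  · intro x hx
    have := (fbhPhi_deriv hV hf hh hprop hρ hx.1 hx.2).hasFDerivAt.hasFDerivWithinAt (s := Ioo 0 ρ)
    rw [this.fderivWithin (isOpen_Ioo.uniqueDiffWithinAt hx)]
    ext; simp

end Phi

end partE2

section partE3

open MeasureTheory Set Filter Topology Metric ComplexConjugate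

section reg
variable {ι : Type*} [Fintype ι] [DecidableEq ι]
variable {f : (ι → ℂ) → (ι → ℂ)} {V W : Set (ι → ℂ)} {h : (ι → ℂ) → ℂ}

/-- mass of the mollifier -/
noncomputable def fbhC (ι : Type*) [Fintype ι] : ℂ := ∫ y : ι → ℂ, fbhEta 1 y

theorem fbhN_smul (c : ℝ) (y : ι → ℂ) : fbhN (c • y) = c ^ 2 * fbhN y := by
  unfold fbhN
  rw [Finset.mul_sum]
  refine Finset.sum_congr rfl fun i _ => ?_
  simp; ring

theorem fbhEta_integral {ε : ℝ} (hε : 0 < ε) (a : ι → ℂ) :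
    ∫ y : ι → ℂ, fbhEta ε (y - a) = fbhC ι := by
  rw [integral_sub_right_eq_self (fun y => fbhEta ε y) a]
  have h1 : ∀ y : ι → ℂ, fbhEta ε y = ((ε ^ (2 * Fintype.card ι))⁻¹ : ℝ) • fbhEta 1 (ε⁻¹ • y) := by
    intro y
    unfold fbhEta
    rw [fbhN_smul]
    simp
    left
    congr 2
    rw [div_eq_mul_inv, mul_comm]
  simp_rw [h1]
  rw [integral_smul, Measure.integral_comp_smul, fbhC, smul_smul]
  have hfr : Module.finrank ℝ (ι → ℂ) = 2 * Fintype.card ι := by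
    rw [Module.finrank_pi_fintype]; simp [mul_comm]
  rw [hfr]
  have : (ε ^ (2 * Fintype.card ι))⁻¹ * |((ε⁻¹) ^ (2 * Fintype.card ι))⁻¹| = 1 := by
    rw [abs_of_pos (by positivity), inv_pow, inv_inv]
    exact inv_mul_cancel₀ (by positivity)
  rw [this, one_smul]

theorem fbhEta_nonneg {ε : ℝ} (hε : 0 < ε) (y : ι → ℂ) : ∃ r : ℝ, 0 ≤ r ∧ fbhEta ε y = r :=
  ⟨_, mul_nonneg (by positivity) (Real.smoothTransition.nonneg _), rfl⟩

theorem fbhEta_hcs {ε : ℝ} (hε : 0 < ε) (a : ι → ℂ) :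
    HasCompactSupport fun y : ι → ℂ => fbhEta ε (y - a) :=
  HasCompactSupport.intro (isCompact_closedBall a ε) fun y hy => by
    rw [mem_closedBall, dist_eq_norm, not_le] at hy
    exact fbhEta_zero hε hy

theorem fbhEta_cont {ε : ℝ} (hε : 0 < ε) (a : ι → ℂ) :
    Continuous fun y : ι → ℂ => fbhEta ε (y - a) :=
  (fbhEta_contDiff hε).continuous.comp (continuous_id.sub continuous_const)

theorem fbhC_pos : ∃ c : ℝ, 0 < c ∧ fbhC ι = c := by
  have h1 : fbhC ι = ((∫ y : ι → ℂ, ((1 : ℝ) ^ (2 * Fintype.card ι))⁻¹ *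
      Real.smoothTransition (1 - fbhN y / 1 ^ 2) : ℝ) : ℂ) := by
    unfold fbhC fbhEta
    exact integral_ofReal
  refine ⟨_, ?_, h1⟩
  have hc : Continuous fun y : ι → ℂ => ((1 : ℝ) ^ (2 * Fintype.card ι))⁻¹ *
      Real.smoothTransition (1 - fbhN y / 1 ^ 2) := by
    refine continuous_const.mul ((Real.smoothTransition.contDiff (n := 1)).continuous.comp ?_)
    exact continuous_const.sub (fbhN_contDiff.continuous.div_const _)
  refine hc.integral_pos_of_hasCompactSupport_nonneg_nonzero (x := 0) ?_ ?_ ?_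
  · refine HasCompactSupport.intro (isCompact_closedBall 0 1) fun y hy => ?_
    rw [mem_closedBall, dist_zero_right, not_le] at hy
    have := fbhEta_zero one_pos hy
    unfold fbhEta at this
    exact_mod_cast this
  · intro y
    exact mul_nonneg (by positivity) (Real.smoothTransition.nonneg _)
  · simp [fbhN]

theorem fbh_approx {u : (ι → ℂ) → ℂ} {B : Set (ι → ℂ)} {a : ι → ℂ} (hB : IsOpen B) (ha : a ∈ B)
    (hu : ContinuousOn u B) :
    Tendsto (fun ε => ∫ y in B, u y * fbhEta ε (y - a)) (𝓝[>] 0) (𝓝 (fbhC ι * u a)) := by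
  obtain ⟨c, hc0, hc⟩ := fbhC_pos (ι := ι)
  rw [Metric.tendsto_nhds]
  intro δ hδ
  have hδ' : 0 < δ / (2 * c) := by positivity
  obtain ⟨r, hr, hrB⟩ := Metric.nhds_basis_closedBall.mem_iff.1
    (inter_mem (hB.mem_nhds ha)
      ((hu.continuousAt (hB.mem_nhds ha)).eventually (ball_mem_nhds (u a) hδ')))
  filter_upwards [Ioo_mem_nhdsGT hr] with ε hε
  have hz : ∀ y, y ∉ closedBall a r → fbhEta ε (y - a) = 0 := by
    intro y hy
    rw [mem_closedBall, dist_eq_norm, not_le] at hy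
    exact fbhEta_zero hε.1 (hε.2.trans hy)
  have hηi : Integrable fun y : ι → ℂ => fbhEta ε (y - a) :=
    (fbhEta_cont hε.1 a).integrable_of_hasCompactSupport (fbhEta_hcs hε.1 a)
  have hrB' : closedBall a r ⊆ B := fun y hy => (hrB hy).1
  have e1 : ∫ y in B, u y * fbhEta ε (y - a) = ∫ y in closedBall a r, u y * fbhEta ε (y - a) :=
    setIntegral_eq_of_subset_of_forall_diff_eq_zero hB.measurableSet hrB'
      (fun y hy => by rw [hz y hy.2, mul_zero])
  have e2 : fbhC ι = ∫ y in closedBall a r, fbhEta ε (y - a) := by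
    rw [← fbhEta_integral hε.1 a]
    exact (setIntegral_eq_integral_of_forall_compl_eq_zero hz).symm
  have hi1 : IntegrableOn (fun y => u y * fbhEta ε (y - a)) (closedBall a r) :=
    ((hu.mono hrB').mul (fbhEta_cont hε.1 a).continuousOn).integrableOn_compact
      (isCompact_closedBall a r)
  rw [e1, dist_eq_norm]
  conv_lhs => rw [e2]
  rw [← integral_mul_const, ← integral_sub hi1 (hηi.integrableOn.mul_const _)]
  have hb : ‖∫ y in closedBall a r, (u y * fbhEta ε (y - a) - fbhEta ε (y - a) * u a)‖ ≤
      ∫ y in closedBall a r, δ / (2 * c) * ‖fbhEta ε (y - a)‖ := by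
    refine norm_integral_le_of_norm_le (hηi.norm.integrableOn.const_mul _) ?_
    rw [ae_restrict_iff' isClosed_closedBall.measurableSet]
    refine Eventually.of_forall fun y hy => ?_
    have h1 := (hrB hy).2
    rw [mem_setOf_eq, dist_eq_norm] at h1
    rw [show u y * fbhEta ε (y - a) - fbhEta ε (y - a) * u a = (u y - u a) * fbhEta ε (y - a) by ring,
      norm_mul]
    gcongr
  have hn : ∫ y in closedBall a r, ‖fbhEta ε (y - a)‖ = c := by
    have h1 : ∀ y, ((‖fbhEta ε (y - a)‖ : ℝ) : ℂ) = fbhEta ε (y - a) := by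
      intro y
      obtain ⟨s, hs, he⟩ := fbhEta_nonneg hε.1 (y - a)
      rw [he, Complex.norm_real, Real.norm_of_nonneg hs]
    have h2 : ((∫ y in closedBall a r, ‖fbhEta ε (y - a)‖ : ℝ) : ℂ) = c := by
      rw [← hc, e2]
      exact (integral_ofReal (𝕜 := ℂ) (f := fun y => ‖fbhEta ε (y - a)‖)).symm.trans
        (integral_congr_ae (Eventually.of_forall fun y => h1 y))
    exact_mod_cast h2
  rw [integral_const_mul, hn] at hb
  refine hb.trans_lt ?_
  rw [show δ / (2 * c) * c = δ / 2 by field_simp]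
  linarith

theorem fbh_det_real (L : (ι → ℂ) →L[ℂ] (ι → ℂ)) :
    |(L.restrictScalars ℝ).det| = ‖L.det‖ ^ 2 := by
  have : (L.restrictScalars ℝ).det = LinearMap.det ((L : (ι → ℂ) →ₗ[ℂ] (ι → ℂ)).restrictScalars ℝ) := rfl
  rw [this, LinearMap.det_restrictScalars, Algebra.norm_complex_apply, Complex.normSq_eq_norm_sq,
    abs_of_nonneg (by positivity)]

theorem fbh_local (hV : IsOpen V) (hf : DifferentiableOn ℂ f V) {x0 : ι → ℂ} (hx0 : x0 ∈ V)
    (hdet : (fbhJac f x0).det ≠ 0) {O : Set (ι → ℂ)} (hO : O ∈ 𝓝 x0) :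
    ∃ U : Set (ι → ℂ), IsOpen U ∧ x0 ∈ U ∧ U ⊆ O ∩ V ∧ InjOn f U ∧ IsOpen (f '' U) ∧
      ∃ g : (ι → ℂ) → (ι → ℂ), (∀ x ∈ U, g (f x) = x) ∧ ContinuousOn g (f '' U) := by
  have hc : ContDiffAt ℂ 1 f x0 :=
    (by simpa using fbh_contDiffOn_nat hV hf 1 : ContDiffOn ℂ 1 f V).contDiffAt (hV.mem_nhds hx0)
  rw [fbhJac_det] at hdet
  have hs : HasStrictFDerivAt f
      ((fderiv ℂ f x0).toContinuousLinearEquivOfDetNeZero hdet : (ι → ℂ) →L[ℂ] (ι → ℂ)) x0 := by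
    have := hc.hasStrictFDerivAt (by simp)
    exact this
  set Φ := hs.toOpenPartialHomeomorph f with hΦ
  have hcoe : (Φ : (ι → ℂ) → (ι → ℂ)) = f := hs.toOpenPartialHomeomorph_coe
  have hmem : x0 ∈ Φ.source := hs.mem_toOpenPartialHomeomorph_source
  have hnhds : interior (O ∩ V) ∈ 𝓝 x0 := interior_mem_nhds.2 (inter_mem hO (hV.mem_nhds hx0))
  set Ψ := Φ.restrOpen (interior (O ∩ V)) isOpen_interior with hΨ
  have hcoe' : (Ψ : (ι → ℂ) → (ι → ℂ)) = f := hcoe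
  have himg : f '' Ψ.source = Ψ.target := by
    rw [← hcoe']; exact Ψ.image_source_eq_target
  refine ⟨Ψ.source, Ψ.open_source, ?_, ?_, ?_, ?_, Ψ.symm, ?_, ?_⟩
  · exact ⟨hmem, mem_of_mem_nhds hnhds⟩
  · intro x hx
    exact interior_subset hx.2
  · rw [← hcoe']; exact Ψ.injOn
  · rw [himg]; exact Ψ.open_target
  · intro x hx
    rw [← hcoe']; exact Ψ.left_inv hx
  · rw [himg]; exact Ψ.continuousOn_symm

theorem fbh_local_limit (hV : IsOpen V) (hf : DifferentiableOn ℂ f V) (hh : DifferentiableOn ℂ h V)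
    {x0 : ι → ℂ} {U : Set (ι → ℂ)} (hU : IsOpen U) (hx0 : x0 ∈ U) (hUV : U ⊆ V) (hinj : InjOn f U)
    (himg : IsOpen (f '' U)) {g : (ι → ℂ) → (ι → ℂ)} (hg : ∀ x ∈ U, g (f x) = x)
    (hgc : ContinuousOn g (f '' U)) :
    Tendsto (fun ε => ∫ x in U, h x * (fbhJac f x).det * conj ((fbhJac f x).det) *
      fbhEta ε (f x - f x0)) (𝓝[>] 0) (𝓝 (fbhC ι * h x0)) := by
  have hgm : MapsTo g (f '' U) V := by
    rintro _ ⟨x, hx, rfl⟩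
    rw [hg x hx]; exact hUV hx
  have := fbh_approx (u := fun y => h (g y)) himg (mem_image_of_mem f hx0)
    (hh.continuousOn.comp hgc hgm)
  rw [hg x0 hx0] at this
  refine this.congr fun ε => ?_
  rw [integral_image_eq_integral_abs_det_fderiv_smul (μ := volume) hU.measurableSet
    (f' := fun x => (fderiv ℂ f x).restrictScalars ℝ) ?_ hinj]
  · refine setIntegral_congr_fun hU.measurableSet fun x hx => ?_
    rw [hg x hx, fbh_det_real, ← fbhJac_det, Complex.real_smul, mul_assoc (h x), Complex.mul_conj,
      Complex.normSq_eq_norm_sq]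
    ring
  · intro x hx
    exact (((hf x (hUV hx)).differentiableAt (hV.mem_nhds (hUV hx))).hasFDerivAt.restrictScalars
      ℝ).hasFDerivWithinAt

end reg

end partE3

section partE4

open MeasureTheory Set Filter Topology Metric ComplexConjugate

section lim
variable {ι : Type*} [Fintype ι] [DecidableEq ι]
variable {f : (ι → ℂ) → (ι → ℂ)} {V W : Set (ι → ℂ)} {h : (ι → ℂ) → ℂ}

theorem fbh_fibre_finite (hV : IsOpen V) (hf : DifferentiableOn ℂ f V)
    (hprop : ∀ K, K ⊆ W → IsCompact K → IsCompact (f ⁻¹' K ∩ V)) {a : ι → ℂ} (ha : a ∈ W)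
    (hreg : ∀ x ∈ V, f x = a → (fbhJac f x).det ≠ 0) : (f ⁻¹' {a} ∩ V).Finite := by
  have hK := hprop {a} (by simpa using ha) isCompact_singleton
  have : ∀ x, ∃ U ∈ 𝓝 x, x ∈ f ⁻¹' {a} ∩ V → InjOn f U := by
    intro x
    by_cases hx : x ∈ f ⁻¹' {a} ∩ V
    · obtain ⟨U, hU, hxU, -, hinj, -⟩ := fbh_local hV hf hx.2 (hreg x hx.2 hx.1) univ_mem
      exact ⟨U, hU.mem_nhds hxU, fun _ => hinj⟩
    · exact ⟨univ, univ_mem, fun h => absurd h hx⟩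
  choose U hU hinj using this
  obtain ⟨t, ht, hcov⟩ := hK.elim_nhds_subcover U (fun x _ => hU x)
  refine t.finite_toSet.subset fun x hx => ?_
  obtain ⟨y, hy, hxy⟩ := mem_iUnion₂.1 (hcov hx)
  have : x = y := hinj y (ht y hy) hxy (mem_of_mem_nhds (hU y)) (hx.1.trans (ht y hy).1.symm)
  rw [this]; exact hy

theorem fbhPhi_tendsto (hV : IsOpen V) (hf : DifferentiableOn ℂ f V) (hh : DifferentiableOn ℂ h V)
    (hprop : ∀ K, K ⊆ W → IsCompact K → IsCompact (f ⁻¹' K ∩ V)) (hW : IsOpen W)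
    {a : ι → ℂ} (ha : a ∈ W) (F : Finset (ι → ℂ)) (hF : ∀ x, x ∈ F ↔ x ∈ V ∧ f x = a)
    (hreg : ∀ x ∈ V, f x = a → (fbhJac f x).det ≠ 0) :
    Tendsto (fun ε => fbhPhi V f h a ε) (𝓝[>] 0) (𝓝 (fbhC ι * ∑ x ∈ F, h x)) := by
  obtain ⟨O, hO, hOd⟩ := F.finite_toSet.t2_separation
  have : ∀ x : ι → ℂ, ∃ U : Set (ι → ℂ), x ∈ F → (IsOpen U ∧ x ∈ U ∧ U ⊆ O x ∩ V ∧ InjOn f U ∧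
      IsOpen (f '' U) ∧
      ∃ g : (ι → ℂ) → (ι → ℂ), (∀ x ∈ U, g (f x) = x) ∧ ContinuousOn g (f '' U)) := by
    intro x
    by_cases hx : x ∈ F
    · obtain ⟨U, hU⟩ := fbh_local hV hf ((hF x).1 hx).1 (hreg x ((hF x).1 hx).1 ((hF x).1 hx).2)
        ((hO x).2.mem_nhds (hO x).1)
      exact ⟨U, fun _ => hU⟩
    · exact ⟨univ, fun h => absurd h hx⟩
  choose U hU using this
  obtain ⟨ρ, hρ, hρW⟩ := Metric.nhds_basis_closedBall.mem_iff.1 (hW.mem_nhds ha)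
  have hQ := hprop _ hρW (isCompact_closedBall a ρ)
  have hUo : IsOpen (⋃ x ∈ F, U x) := isOpen_biUnion fun x hx => (hU x hx).1
  have hUV : (⋃ x ∈ F, U x) ⊆ V := iUnion₂_subset fun x hx => (hU x hx).2.2.1.trans inter_subset_right
  have hQ' : IsCompact (f '' ((f ⁻¹' closedBall a ρ ∩ V) \ ⋃ x ∈ F, U x)) :=
    (hQ.diff hUo).image_of_continuousOn (hf.continuousOn.mono fun x hx => hx.1.2)
  have haQ : a ∉ f '' ((f ⁻¹' closedBall a ρ ∩ V) \ ⋃ x ∈ F, U x) := by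
    rintro ⟨x, hx, hxa⟩
    have hxF := (hF x).2 ⟨hx.1.2, hxa⟩
    exact hx.2 (mem_iUnion₂.2 ⟨x, hxF, (hU x hxF).2.1⟩)
  obtain ⟨δ, hδ, hδQ⟩ := Metric.nhds_basis_ball.mem_iff.1 (hQ'.isClosed.isOpen_compl.mem_nhds haQ)
  have hlim : Tendsto (fun ε => ∑ x ∈ F, ∫ y in U x, h y * (fbhJac f y).det *
      conj ((fbhJac f y).det) * fbhEta ε (f y - a)) (𝓝[>] 0) (𝓝 (∑ x ∈ F, fbhC ι * h x)) := by
    refine tendsto_finsetSum _ fun x hx => ?_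
    obtain ⟨h1, h2, h3, h4, h5, g, h6, h7⟩ := hU x hx
    have := fbh_local_limit hV hf hh h1 h2 (h3.trans inter_subset_right) h4 h5 h6 h7
    rwa [((hF x).1 hx).2] at this
  rw [Finset.mul_sum]
  refine hlim.congr' ?_
  filter_upwards [Ioo_mem_nhdsGT (lt_min hρ hδ)] with ε hε
  have hε1 := hε.2.trans_le (min_le_left _ _)
  have hε2 := hε.2.trans_le (min_le_right _ _)
  have hIntg : IntegrableOn (fun y => h y * (fbhJac f y).det *
      conj ((fbhJac f y).det) * fbhEta ε (f y - a)) V := by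
    have h1 : ContinuousOn (fun y => h y * (fbhJac f y).det *
      conj ((fbhJac f y).det) * fbhEta ε (f y - a)) V :=
      (fbh_F_cont hV hf hh).mul (((fbhEta_cont hε.1 a)).comp_continuousOn hf.continuousOn)
    refine IntegrableOn.of_forall_diff_eq_zero
      ((h1.mono inter_subset_right).integrableOn_compact hQ) hV.measurableSet fun x hx => ?_
    have : ¬ (f x ∈ closedBall a ρ) := fun h => hx.2 ⟨h, hx.1⟩
    rw [mem_closedBall, dist_eq_norm, not_le] at this
    rw [fbhEta_zero hε.1 (hε1.trans this), mul_zero]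
  rw [← integral_biUnion_finset F (fun x hx => (hU x hx).1.measurableSet) ?_ ?_]
  · symm
    refine setIntegral_eq_of_subset_of_forall_diff_eq_zero hV.measurableSet hUV fun x hx => ?_
    rw [fbhEta_zero hε.1, mul_zero]
    by_contra hcon
    rw [not_lt, ← dist_eq_norm] at hcon
    have h1 : x ∈ (f ⁻¹' closedBall a ρ ∩ V) \ ⋃ x ∈ F, U x :=
      ⟨⟨mem_closedBall.2 (hcon.trans hε1.le), hx.1⟩, hx.2⟩
    exact hδQ (mem_ball.2 (hcon.trans_lt hε2)) (mem_image_of_mem f h1)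
  · intro x hx y hy hxy
    exact (hOd hx hy hxy).mono ((hU x hx).2.2.1.trans inter_subset_left)
      ((hU y hy).2.2.1.trans inter_subset_left)
  · intro x hx
    exact hIntg.mono_set ((hU x hx).2.2.1.trans inter_subset_right)

/-- The trace (push-forward) of a holomorphic function under a proper holomorphic map. -/
theorem fbh_trace (hV : IsOpen V) (hW : IsOpen W) (hf : DifferentiableOn ℂ f V)
    (hprop : ∀ K, K ⊆ W → IsCompact K → IsCompact (f ⁻¹' K ∩ V)) :
    ∃ P : ((ι → ℂ) → ℂ) → (ι → ℂ) → ℂ, ∀ h, DifferentiableOn ℂ h V →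
      DifferentiableOn ℂ (P h) W ∧
      ∀ a ∈ W, (∀ x ∈ V, f x = a → (fbhJac f x).det ≠ 0) →
        ∀ F : Finset (ι → ℂ), (∀ x, x ∈ F ↔ x ∈ V ∧ f x = a) → P h a = ∑ x ∈ F, h x := by
  obtain ⟨c, hc0, hc⟩ := fbhC_pos (ι := ι)
  have hcne : fbhC ι ≠ 0 := by rw [hc]; exact_mod_cast hc0.ne'
  have hr : ∀ a : ι → ℂ, ∃ r : ℝ, a ∈ W → 0 < r ∧ closedBall a r ⊆ W := by
    intro a
    by_cases ha : a ∈ W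
    · obtain ⟨ρ, hρ, hρW⟩ := Metric.nhds_basis_closedBall.mem_iff.1 (hW.mem_nhds ha)
      exact ⟨ρ, fun _ => ⟨hρ, hρW⟩⟩
    · exact ⟨0, fun h => absurd h ha⟩
  choose r hr using hr
  refine ⟨fun h a => (fbhC ι)⁻¹ * fbhPhi V f h a (r a / 2), fun h hh => ⟨?_, ?_⟩⟩
  · intro a0 ha0
    obtain ⟨hr0, hrW⟩ := hr a0 ha0
    have hd := fbhPhi_holo hV hf hh hprop hrW (ε := r a0 / 4) (by linarith) (by linarith)
    refine ((hd.const_mul (fbhC ι)⁻¹).congr_of_eventuallyEq ?_).differentiableWithinAt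
    filter_upwards [ball_mem_nhds a0 (show 0 < r a0 / 2 by linarith)] with a ha
    rw [mem_ball] at ha
    have haW : a ∈ W := hrW (mem_closedBall.2 (by linarith))
    obtain ⟨hra, hraW⟩ := hr a haW
    congr 1
    have hsub : closedBall a (r a0 / 2) ⊆ W := by
      refine (closedBall_subset_closedBall' ?_).trans hrW
      linarith
    set e := min (r a / 2) (r a0 / 4) with he
    have he0 : 0 < e := lt_min (by linarith) (by linarith)
    rw [fbhPhi_const hV hf hh hprop hraW (ε := r a / 2) (ε' := e) ⟨by linarith, by linarith⟩
      ⟨he0, (min_le_left _ _).trans_lt (by linarith)⟩]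
    exact fbhPhi_const hV hf hh hprop hsub ⟨he0, (min_le_right _ _).trans_lt (by linarith)⟩
      ⟨by linarith, by linarith⟩
  · intro a ha hreg F hF
    obtain ⟨hra, hraW⟩ := hr a ha
    have h1 := fbhPhi_tendsto hV hf hh hprop hW ha F hF hreg
    have h2 : Tendsto (fun ε => fbhPhi V f h a ε) (𝓝[>] 0) (𝓝 (fbhPhi V f h a (r a / 2))) := by
      refine tendsto_const_nhds.congr' ?_
      filter_upwards [Ioo_mem_nhdsGT hra] with ε hε
      exact fbhPhi_const hV hf hh hprop hraW ⟨by linarith, by linarith⟩ hε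
    change (fbhC ι)⁻¹ * _ = _
    rw [tendsto_nhds_unique h2 h1]
    field_simp

end lim

end partE4

section partF1

open MeasureTheory Set Filter Topology Metric ComplexConjugate

section ident
variable {E : Type*} [NormedAddCommGroup E] [NormedSpace ℂ E]

/-- Identity theorem. -/
theorem fbh_identity {g : E → ℂ} {D : Set E} (hD : IsOpen D) (hDc : IsPreconnected D)
    (hg : DifferentiableOn ℂ g D) {x0 : E} (hx0 : x0 ∈ D) (h0 : g =ᶠ[𝓝 x0] 0) :
    ∀ x ∈ D, g x = 0 := by
  set A : Set E := {x | ∀ᶠ y in 𝓝 x, g y = 0} with hA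
  have hAo : IsOpen A := isOpen_setOf_eventually_nhds
  have hsub : D ⊆ A := by
    refine hDc.subset_of_closure_inter_subset hAo ⟨x0, hx0, h0⟩ ?_
    rintro x ⟨hxA, hxD⟩
    obtain ⟨r, hr, hrD⟩ := Metric.nhds_basis_ball.mem_iff.1 (hD.mem_nhds hxD)
    obtain ⟨y, hyb, hyA⟩ := mem_closure_iff_nhds.1 hxA _ (ball_mem_nhds x hr)
    change ∀ᶠ y in 𝓝 x, g y = 0
    filter_upwards [ball_mem_nhds x hr] with p hp
    set S : Set ℂ := {t | y + t • (p - y) ∈ ball x r} with hS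
    have hcont : Continuous fun t : ℂ => y + t • (p - y) := by fun_prop
    have hSo : IsOpen S := isOpen_ball.preimage hcont
    have hSc : Convex ℝ S := by
      intro s hs t ht a b ha hb hab
      have := (convex_ball x r) hs ht ha hb hab
      change y + (a • s + b • t) • (p - y) ∈ ball x r
      convert this using 1
      have h3 : a • y + b • y = y := by rw [← add_smul, hab, one_smul]
      simp only [add_smul, smul_add, smul_assoc]
      generalize a • s • (p - y) = A1
      generalize b • t • (p - y) = A2
      conv_lhs => rw [← h3]
      abel
    have hd : DifferentiableOn ℂ (fun t : ℂ => g (y + t • (p - y))) S := by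
      refine (hg.mono hrD).comp ?_ (fun t ht => ht)
      fun_prop
    have h1 := (hd.analyticOnNhd hSo).eqOn_zero_of_preconnected_of_eventuallyEq_zero
      hSc.isPreconnected (z₀ := 0) (by simpa [hS] using hyb) (by
        have : Tendsto (fun t : ℂ => y + t • (p - y)) (𝓝 0) (𝓝 y) := by
          simpa using hcont.tendsto 0
        exact this.eventually hyA)
    have := h1 (x := 1) (by simpa [hS] using hp)
    simpa using this
  intro x hx
  exact (hsub hx).self_of_nhds

end ident

section prop
variable {ι : Type*} [Fintype ι] [DecidableEq ι]
variable {f : (ι → ℂ) → (ι → ℂ)} {V W : Set (ι → ℂ)} {h : (ι → ℂ) → ℂ}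

/-- regular values -/
def fbhReg (f : (ι → ℂ) → (ι → ℂ)) (V : Set (ι → ℂ)) (a : ι → ℂ) : Prop :=
  ∀ x ∈ V, f x = a → (fbhJac f x).det ≠ 0

theorem fbh_sard (hV : IsOpen V) (hf : DifferentiableOn ℂ f V) {C : Set (ι → ℂ)} (hC : C ⊆ V)
    (hC0 : ∀ x ∈ C, (fbhJac f x).det = 0) : volume (f '' C) = 0 := by
  refine addHaar_image_eq_zero_of_det_fderivWithin_eq_zero volume
    (f' := fun x => (fderiv ℂ f x).restrictScalars ℝ) (fun x hx => ?_) (fun x hx => ?_)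
  · exact (((hf x (hC hx)).differentiableAt (hV.mem_nhds (hC hx))).hasFDerivAt.restrictScalars
      ℝ).hasFDerivWithinAt
  · have := fbh_det_real (fderiv ℂ f x)
    rw [← fbhJac_det, hC0 x hx] at this
    simpa using this

theorem fbh_reg_dense (hV : IsOpen V) (hf : DifferentiableOn ℂ f V) {O : Set (ι → ℂ)}
    (hO : IsOpen O) (hne : O.Nonempty) : ∃ a ∈ O, fbhReg f V a := by
  by_contra hcon
  push Not at hcon
  have h1 : O ⊆ f '' {x ∈ V | (fbhJac f x).det = 0} := by
    intro a ha
    have := hcon a ha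
    unfold fbhReg at this
    push Not at this
    obtain ⟨x, hx, hfx, hd⟩ := this
    exact ⟨x, ⟨hx, hd⟩, hfx⟩
  have h2 := fbh_sard hV hf (C := {x ∈ V | (fbhJac f x).det = 0}) (fun x hx => hx.1) (fun x hx => hx.2)
  exact (hO.measure_pos volume hne).ne' (measure_mono_null h1 h2)

theorem fbh_count (hV : IsOpen V) (hW : IsOpen W) (hWc : IsPreconnected W)
    (hf : DifferentiableOn ℂ f V)
    (hprop : ∀ K, K ⊆ W → IsCompact K → IsCompact (f ⁻¹' K ∩ V)) {a b : ι → ℂ} (ha : a ∈ W)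
    (hb : b ∈ W) (hra : fbhReg f V a) (hrb : fbhReg f V b) {F G : Finset (ι → ℂ)}
    (hF : ∀ x, x ∈ F ↔ x ∈ V ∧ f x = a) (hG : ∀ x, x ∈ G ↔ x ∈ V ∧ f x = b) :
    F.card = G.card := by
  obtain ⟨P, hP⟩ := fbh_trace hV hW hf hprop
  obtain ⟨h1, h2⟩ := hP (fun _ => 1) (differentiableOn_const _)
  set u : (ι → ℂ) → ℝ := fun a => (P (fun _ => 1) a).re with hu
  have huc : ContinuousOn u W := Complex.continuous_re.comp_continuousOn h1.continuousOn
  have hval : ∀ a ∈ W, fbhReg f V a → ∀ F : Finset (ι → ℂ), (∀ x, x ∈ F ↔ x ∈ V ∧ f x = a) →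
      u a = F.card := by
    intro a ha hra F hF
    simp only [hu]
    rw [h2 a ha hra F hF]
    simp
  have key : ∀ a ∈ W, ∀ n : ℕ, u a ≠ n + 1 / 2 := by
    intro a ha n hn
    have hev : {x | x ∈ W ∧ u x ∈ Ioo (n : ℝ) (n + 1)} ∈ 𝓝 a := by
      have h5 : Ioo (n : ℝ) (n + 1) ∈ 𝓝 (u a) := by
        rw [hn]
        exact Ioo_mem_nhds (by linarith) (by linarith)
      exact inter_mem (hW.mem_nhds ha) ((huc.continuousAt (hW.mem_nhds ha)).preimage_mem_nhds h5)
    obtain ⟨O, hOs, hOo, haO⟩ := _root_.mem_nhds_iff.1 hev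
    obtain ⟨b, hbO, hrb⟩ := fbh_reg_dense hV hf hOo ⟨a, haO⟩
    obtain ⟨hbW, hb1, hb2⟩ := hOs hbO
    have hfin := fbh_fibre_finite hV hf hprop hbW hrb
    rw [hval b hbW hrb hfin.toFinset (fun x => by simp [and_comm])] at hb1 hb2
    have h3 : n < hfin.toFinset.card := by exact_mod_cast hb1
    have h4 : hfin.toFinset.card < n + 1 := by exact_mod_cast hb2
    omega
  have aux : ∀ a ∈ W, ∀ b ∈ W, ∀ n m : ℕ, u a = n → u b = m → ¬ (n < m) := by
    intro a ha b hb n m hn hm hnm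
    have hiv := hWc.intermediate_value ha hb huc
    have : (n : ℝ) + 1 / 2 ∈ Icc (u a) (u b) := by
      have : (n : ℝ) + 1 ≤ m := by exact_mod_cast hnm
      rw [hn, hm]; constructor <;> linarith
    obtain ⟨c, hc, hcu⟩ := hiv this
    exact key c hc n hcu
  have e1 := hval a ha hra F hF
  have e2 := hval b hb hrb G hG
  have := aux a ha b hb _ _ e1 e2
  have := aux b hb a ha _ _ e2 e1
  omega

theorem fbh_surj (hV : IsOpen V) (hW : IsOpen W) (hWc : IsPreconnected W)
    (hf : DifferentiableOn ℂ f V)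
    (hprop : ∀ K, K ⊆ W → IsCompact K → IsCompact (f ⁻¹' K ∩ V)) {x0 : ι → ℂ} (hx0 : x0 ∈ V)
    (hfx0 : f x0 ∈ W) (hdet : (fbhJac f x0).det ≠ 0) : W ⊆ f '' V := by
  obtain ⟨U, hU, hxU, hUV, hinj, himg, -⟩ := fbh_local hV hf hx0 hdet univ_mem
  obtain ⟨a, ⟨haU, haW⟩, hra⟩ := fbh_reg_dense hV hf (himg.inter hW) ⟨f x0, mem_image_of_mem f hxU, hfx0⟩
  obtain ⟨x1, hx1U, hx1⟩ := haU
  have hfa := fbh_fibre_finite hV hf hprop haW hra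
  have hpos : 0 < hfa.toFinset.card := Finset.card_pos.2 ⟨x1, by simp [hx1, (hUV hx1U).2]⟩
  have hreg : ∀ b ∈ W, fbhReg f V b → b ∈ f '' V := by
    intro b hb hrb
    have hfb := fbh_fibre_finite hV hf hprop hb hrb
    have := fbh_count hV hW hWc hf hprop haW hb hra hrb (F := hfa.toFinset) (G := hfb.toFinset)
      (fun x => by simp [and_comm]) (fun x => by simp [and_comm])
    rw [this] at hpos
    obtain ⟨x, hx⟩ := Finset.card_pos.1 hpos
    simp at hx
    exact ⟨x, hx.2, hx.1⟩
  intro b hb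
  obtain ⟨ρ, hρ, hρW⟩ := Metric.nhds_basis_closedBall.mem_iff.1 (hW.mem_nhds hb)
  have hQ := hprop _ hρW (isCompact_closedBall b ρ)
  have hfQ : IsClosed (f '' (f ⁻¹' closedBall b ρ ∩ V)) :=
    (hQ.image_of_continuousOn (hf.continuousOn.mono inter_subset_right)).isClosed
  have : b ∈ closure (f '' (f ⁻¹' closedBall b ρ ∩ V)) := by
    rw [mem_closure_iff_nhds]
    intro t ht
    obtain ⟨O, hOs, hOo, hbO⟩ := _root_.mem_nhds_iff.1 (inter_mem ht (closedBall_mem_nhds b hρ))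
    obtain ⟨c, hcO, hrc⟩ := fbh_reg_dense hV hf hOo ⟨b, hbO⟩
    obtain ⟨x, hx, rfl⟩ := hreg c (hρW (hOs hcO).2) hrc
    exact ⟨f x, (hOs hcO).1, x, ⟨(hOs hcO).2, hx⟩, rfl⟩
  rw [hfQ.closure_eq] at this
  exact image_mono inter_subset_right this

end prop

end partF1

section partF2

open MeasureTheory Set Filter Topology Metric ComplexConjugate

section jac
variable {ι : Type*} [Fintype ι] [DecidableEq ι]
variable {f : (ι → ℂ) → (ι → ℂ)} {V W : Set (ι → ℂ)} {h : (ι → ℂ) → ℂ}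

theorem fbh_perturb_det (A : Matrix ι ι ℂ) : ∀ᶠ ε : ℂ in 𝓝[≠] 0, (A + ε • (1 : Matrix ι ι ℂ)).det ≠ 0 := by
  have hne : A.charpoly ≠ 0 := A.charpoly_monic.ne_zero
  have hfin : {ε : ℂ | A.charpoly.IsRoot (-ε)}.Finite := by
    exact Set.Finite.preimage (f := fun ε : ℂ => -ε) (neg_injective (G := ℂ)).injOn
      (Polynomial.finite_setOf_isRoot hne)
  have h1 : ({ε : ℂ | A.charpoly.IsRoot (-ε)} \ {0})ᶜ ∈ 𝓝 (0 : ℂ) :=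
    (hfin.subset diff_subset).isClosed.isOpen_compl.mem_nhds (by simp)
  filter_upwards [mem_nhdsWithin_of_mem_nhds h1, self_mem_nhdsWithin] with ε hε hε0 hdet
  apply hε
  refine ⟨?_, hε0⟩
  change A.charpoly.eval (-ε) = 0
  rw [Matrix.eval_charpoly, Matrix.scalar_apply, ← Matrix.smul_one_eq_diagonal,
    show (-ε) • (1 : Matrix ι ι ℂ) - A = -(A + ε • 1) by rw [neg_smul]; abel,
    Matrix.det_neg, hdet, mul_zero]

theorem fbh_jac_ne (hV : IsOpen V) (hW : IsOpen W) (hf : DifferentiableOn ℂ f V)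
    (hprop : ∀ K, K ⊆ W → IsCompact K → IsCompact (f ⁻¹' K ∩ V)) {x0 : ι → ℂ} (hx0 : x0 ∈ V)
    (hfx0 : f x0 ∈ W) : ∃ x ∈ V, (fbhJac f x).det ≠ 0 := by
  by_contra hcon
  push Not at hcon
  have hnull := fbh_sard hV hf (C := V) subset_rfl hcon
  have hK := hprop {f x0} (by simpa using hfx0) isCompact_singleton
  obtain ⟨L, hL, hKL, hLV⟩ := exists_compact_between hK hV inter_subset_right
  have hfL : ContinuousOn f L := hf.continuousOn.mono hLV
  have hfr : IsCompact (f '' frontier L) :=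
    (hL.of_isClosed_subset isClosed_frontier hL.isClosed.frontier_subset).image_of_continuousOn
      (hfL.mono hL.isClosed.frontier_subset)
  have hnot : f x0 ∉ f '' frontier L := by
    rintro ⟨x, hx, hxe⟩
    have h1 : x ∈ interior L := hKL ⟨hxe, hLV (hL.isClosed.frontier_subset hx)⟩
    exact hx.2 h1
  obtain ⟨δ, hδ, hδb⟩ := Metric.nhds_basis_ball.mem_iff.1 (hfr.isClosed.isOpen_compl.mem_nhds hnot)
  obtain ⟨M, hM0, hM⟩ : ∃ M : ℝ, 0 < M ∧ ∀ x ∈ L, ‖x - x0‖ ≤ M := by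
    obtain ⟨M, hM⟩ := hL.isBounded.subset_closedBall x0
    refine ⟨max M 1, by positivity, fun x hx => ?_⟩
    rw [← dist_eq_norm]
    exact (mem_closedBall.1 (hM hx)).trans (le_max_left _ _)
  have hx0L : x0 ∈ interior L := hKL ⟨rfl, hx0⟩
  have hev : ∀ᶠ ε : ℂ in 𝓝[≠] 0, ball (f x0) (δ / 2) ⊆ (fun x => f x + ε • (x - x0)) '' L := by
    have hsm : ∀ᶠ ε : ℂ in 𝓝[≠] 0, ‖ε‖ * M < δ / 2 := by
      refine mem_nhdsWithin_of_mem_nhds ?_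
      have : Tendsto (fun ε : ℂ => ‖ε‖ * M) (𝓝 0) (𝓝 0) := by
        simpa using (continuous_norm.mul continuous_const).tendsto (0 : ℂ) (f := fun ε : ℂ => ‖ε‖ * M)
      exact this.eventually (gt_mem_nhds (by linarith))
    filter_upwards [hsm, fbh_perturb_det (fbhJac f x0)] with ε hε hdet
    set fe : (ι → ℂ) → (ι → ℂ) := fun x => f x + ε • (x - x0) with hfe
    have hfed : DifferentiableOn ℂ fe V := by
      refine hf.add ?_
      fun_prop
    set Ve := interior L ∩ fe ⁻¹' ball (f x0) (δ / 2) with hVe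
    have hLi : interior L ⊆ V := interior_subset.trans hLV
    have hVeo : IsOpen Ve := (hfed.continuousOn.mono hLi).isOpen_inter_preimage isOpen_interior isOpen_ball
    have hVeV : Ve ⊆ V := inter_subset_left.trans hLi
    have hjac : (fbhJac fe x0).det ≠ 0 := by
      convert hdet using 2
      have h1 : HasFDerivAt fe (fderiv ℂ f x0 + ε • ContinuousLinearMap.id ℂ (ι → ℂ)) x0 :=
        ((hf x0 hx0).differentiableAt (hV.mem_nhds hx0)).hasFDerivAt.add
          (((hasFDerivAt_id x0).sub_const x0).const_smul ε)
      ext i j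
      simp only [fbhJac_eq, h1.fderiv]
      simp [Matrix.one_apply, Pi.single_apply]
    have := fbh_surj hVeo isOpen_ball (convex_ball (f x0) (δ / 2)).isPreconnected (hfed.mono hVeV) ?_
      (x0 := x0) ⟨hx0L, by simp [hfe, hδ]⟩ (by simp [hfe, hδ]) hjac
    · exact this.trans (image_mono (inter_subset_left.trans interior_subset))
    · intro K hKb hK
      have heq : fe ⁻¹' K ∩ Ve = L ∩ fe ⁻¹' K := by
        ext x
        constructor
        · rintro ⟨h1, h2, h3⟩
          exact ⟨interior_subset h2, h1⟩
        · rintro ⟨h1, h2⟩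
          refine ⟨h2, ?_, hKb h2⟩
          by_contra h3
          have h4 : x ∈ frontier L := by
            rw [hL.isClosed.frontier_eq]; exact ⟨h1, h3⟩
          have h5 : f x ∉ ball (f x0) δ := fun h => hδb h (mem_image_of_mem f h4)
          rw [mem_ball, not_lt] at h5
          have h6 := hKb h2
          rw [mem_ball] at h6
          have h7 : dist (f x) (fe x) ≤ ‖ε‖ * M := by
            rw [dist_eq_norm, hfe]
            simp only [sub_add_cancel_left, norm_neg, norm_smul]
            have := hM x h1
            gcongr
          have := dist_triangle (f x) (fe x) (f x0)
          linarith
      rw [heq]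
      exact hL.of_isClosed_subset
        ((hfed.continuousOn.mono hLV).preimage_isClosed_of_isClosed hL.isClosed hK.isClosed)
        inter_subset_left
  have hball : ball (f x0) (δ / 2) ⊆ f '' L := by
    intro y hy
    have hcl : IsClosed (f '' L) := (hL.image_of_continuousOn hfL).isClosed
    rw [← hcl.closure_eq, Metric.mem_closure_iff]
    intro r hr
    have hsm : ∀ᶠ ε : ℂ in 𝓝[≠] 0, ‖ε‖ * M < r := by
      refine mem_nhdsWithin_of_mem_nhds ?_
      have : Tendsto (fun ε : ℂ => ‖ε‖ * M) (𝓝 0) (𝓝 0) := by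
        simpa using (continuous_norm.mul continuous_const).tendsto (0 : ℂ) (f := fun ε : ℂ => ‖ε‖ * M)
      exact this.eventually (gt_mem_nhds hr)
    obtain ⟨ε, h1, h2⟩ := (hsm.and hev).exists
    obtain ⟨x, hx, hxy⟩ := h2 hy
    refine ⟨f x, mem_image_of_mem f hx, lt_of_le_of_lt ?_ h1⟩
    rw [← hxy, dist_eq_norm]
    simp only [add_sub_cancel_left, norm_smul]
    have := hM x hx
    gcongr
  exact (isOpen_ball.measure_pos volume ⟨f x0, mem_ball_self (half_pos hδ)⟩).ne'
    (measure_mono_null (hball.trans (image_mono hLV)) hnull)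

theorem fbh_regpt_dense (hV : IsOpen V) (hVc : IsPreconnected V) (hW : IsOpen W)
    (hf : DifferentiableOn ℂ f V) (hmap : MapsTo f V W)
    (hprop : ∀ K, K ⊆ W → IsCompact K → IsCompact (f ⁻¹' K ∩ V)) {O : Set (ι → ℂ)}
    (hO : IsOpen O) (hOV : O ⊆ V) (hne : O.Nonempty) :
    ∃ x ∈ O, fbhReg f V (f x) := by
  obtain ⟨x0, hx0⟩ := hne
  have : ∃ x1 ∈ O, (fbhJac f x1).det ≠ 0 := by
    by_contra hcon
    push Not at hcon
    obtain ⟨x, hx, hxd⟩ := fbh_jac_ne hV hW hf hprop (hOV hx0) (hmap (hOV hx0))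
    exact hxd (fbh_identity hV hVc (fbh_J_diff hV hf) (hOV hx0)
      (by filter_upwards [hO.mem_nhds hx0] with y hy using hcon y hy) x hx)
  obtain ⟨x1, hx1, hd⟩ := this
  obtain ⟨U, hU, hxU, hUO, -, himg, -⟩ := fbh_local hV hf (hOV hx1) hd (hO.mem_nhds hx1)
  obtain ⟨a, ⟨x, hx, hxa⟩, hra⟩ := fbh_reg_dense hV hf himg ⟨_, mem_image_of_mem f hxU⟩
  exact ⟨x, (hUO hx).1, hxa ▸ hra⟩

end jac

end partF2

section partF3

open MeasureTheory Set Filter Topology Metric ComplexConjugate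

section tup
variable {ι : Type*} [Fintype ι] [DecidableEq ι]
variable {f : (ι → ℂ) → (ι → ℂ)} {V W : Set (ι → ℂ)} {h : (ι → ℂ) → ℂ}

theorem fbh_tuple (hV : IsOpen V) (hVc : IsPreconnected V) (hVn : V.Nonempty) (hW : IsOpen W)
    (hWc : IsPreconnected W) (hf : DifferentiableOn ℂ f V) (hmap : MapsTo f V W)
    (hprop : ∀ K, K ⊆ W → IsCompact K → IsCompact (f ⁻¹' K ∩ V)) :
    W ⊆ f '' V ∧ ∃ N : ℕ, ∃ P : ((ι → ℂ) → ℂ) → (ι → ℂ) → ℂ,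
      (∀ h, DifferentiableOn ℂ h V → DifferentiableOn ℂ (P h) W) ∧
      ∀ x0 ∈ V, ∃ X : Fin N → (ι → ℂ), (∀ i, X i ∈ V) ∧ (∀ i, f (X i) = f x0) ∧
        (∃ i, X i = x0) ∧ ∀ h, DifferentiableOn ℂ h V → P h (f x0) = ∑ i, h (X i) := by
  obtain ⟨x1, hx1⟩ := hVn
  obtain ⟨x2, hx2, hr2⟩ := fbh_regpt_dense hV hVc hW hf hmap hprop hV subset_rfl ⟨x1, hx1⟩
  have hfin2 := fbh_fibre_finite hV hf hprop (hmap hx2) hr2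
  refine ⟨fbh_surj hV hW hWc hf hprop hx2 (hmap hx2) (hr2 x2 hx2 rfl), hfin2.toFinset.card, ?_⟩
  set N := hfin2.toFinset.card with hN
  obtain ⟨P, hP⟩ := fbh_trace hV hW hf hprop
  refine ⟨P, fun h hh => (hP h hh).1, ?_⟩
  -- regular case
  have hreg : ∀ x ∈ V, fbhReg f V (f x) → ∃ X : Fin N → (ι → ℂ), ∃ i0 : Fin N,
      (∀ i, X i ∈ V) ∧ (∀ i, f (X i) = f x) ∧ X i0 = x ∧
      ∀ h, DifferentiableOn ℂ h V → P h (f x) = ∑ i, h (X i) := by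
    intro x hx hrx
    have hfin := fbh_fibre_finite hV hf hprop (hmap hx) hrx
    have hF : ∀ y, y ∈ hfin.toFinset ↔ y ∈ V ∧ f y = f x := fun y => by simp [and_comm]
    have hcard : hfin.toFinset.card = N :=
      fbh_count hV hW hWc hf hprop (hmap hx) (hmap hx2) hrx hr2 hF (fun y => by simp [and_comm])
    let e : Fin N ≃ hfin.toFinset := (Finset.equivFinOfCardEq hcard).symm
    refine ⟨fun i => (e i : ι → ℂ), e.symm ⟨x, (hF x).2 ⟨hx, rfl⟩⟩, fun i => ((hF _).1 (e i).2).1,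
      fun i => ((hF _).1 (e i).2).2, by simp, fun h hh => ?_⟩
    rw [(hP h hh).2 (f x) (hmap hx) hrx hfin.toFinset hF]
    rw [← Finset.sum_coe_sort hfin.toFinset h]
    exact (Equiv.sum_comp e (fun y : hfin.toFinset => h y)).symm
  intro x0 hx0
  obtain ⟨ρ, hρ, hρW⟩ := Metric.nhds_basis_closedBall.mem_iff.1 (hW.mem_nhds (hmap hx0))
  set Q := f ⁻¹' closedBall (f x0) ρ ∩ V with hQdef
  have hQ : IsCompact Q := hprop _ hρW (isCompact_closedBall _ ρ)
  have hx : ∀ j : ℕ, ∃ x ∈ V, dist x x0 < 1 / ((j : ℝ) + 1) ∧ f x ∈ closedBall (f x0) ρ ∧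
      fbhReg f V (f x) := by
    intro j
    have hO : IsOpen (V ∩ f ⁻¹' ball (f x0) ρ) := hf.continuousOn.isOpen_inter_preimage hV isOpen_ball
    obtain ⟨x, hx, hrx⟩ := fbh_regpt_dense hV hVc hW hf hmap hprop
      (O := (V ∩ f ⁻¹' ball (f x0) ρ) ∩ ball x0 (1 / ((j : ℝ) + 1)))
      (hO.inter isOpen_ball) (fun y hy => hy.1.1)
      ⟨x0, ⟨⟨hx0, mem_ball_self hρ⟩, mem_ball_self (by positivity)⟩⟩
    exact ⟨x, hx.1.1, hx.2, ball_subset_closedBall hx.1.2, hrx⟩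
  choose x hxV hxd hxb hxr using hx
  choose X i0 hXV hXf hXi hXs using fun j => hreg (x j) (hxV j) (hxr j)
  have hxlim : Tendsto x atTop (𝓝 x0) := by
    rw [tendsto_iff_dist_tendsto_zero]
    exact squeeze_zero (fun _ => dist_nonneg) (fun j => (hxd j).le) tendsto_one_div_add_atTop_nhds_zero_nat
  have hflim : Tendsto (fun j => f (x j)) atTop (𝓝 (f x0)) :=
    ((hf x0 hx0).continuousWithinAt.continuousAt (hV.mem_nhds hx0)).tendsto.comp hxlim
  have hcpt : IsCompact ((Set.pi univ (fun _ : Fin N => Q)) ×ˢ (univ : Set (Fin N))) :=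
    (isCompact_univ_pi fun _ => hQ).prod isCompact_univ
  obtain ⟨⟨Y, k⟩, hY, φ, hφ, hlim⟩ := hcpt.tendsto_subseq (x := fun j => (X j, i0 j))
    (fun j => ⟨fun i _ => ⟨by rw [mem_preimage, hXf]; exact hxb j, hXV j i⟩, mem_univ _⟩)
  have hYQ : ∀ i, Y i ∈ Q := fun i => hY.1 i (mem_univ i)
  have hlim1 : ∀ i, Tendsto (fun j => X (φ j) i) atTop (𝓝 (Y i)) := fun i =>
    (tendsto_pi_nhds.1 ((continuous_fst.tendsto _).comp hlim)) i
  have hlim2 : ∀ᶠ j in atTop, i0 (φ j) = k := by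
    have : Tendsto (fun j => i0 (φ j)) atTop (𝓝 k) := (continuous_snd.tendsto _).comp hlim
    rw [nhds_discrete] at this
    exact tendsto_pure.1 this
  have hYf : ∀ i, f (Y i) = f x0 := by
    intro i
    have h1 : Tendsto (fun j => f (X (φ j) i)) atTop (𝓝 (f (Y i))) :=
      ((hf _ (hYQ i).2).continuousWithinAt.continuousAt (hV.mem_nhds (hYQ i).2)).tendsto.comp (hlim1 i)
    have h2 : Tendsto (fun j => f (X (φ j) i)) atTop (𝓝 (f x0)) := by
      simp_rw [hXf]
      exact hflim.comp hφ.tendsto_atTop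
    exact tendsto_nhds_unique h1 h2
  refine ⟨Y, fun i => (hYQ i).2, hYf, ⟨k, ?_⟩, ?_⟩
  · refine tendsto_nhds_unique (hlim1 k) ((hxlim.comp hφ.tendsto_atTop).congr' ?_)
    filter_upwards [hlim2] with j hj
    rw [← hj, hXi]; rfl
  · intro h hh
    have h1 : Tendsto (fun j => ∑ i, h (X (φ j) i)) atTop (𝓝 (∑ i, h (Y i))) :=
      tendsto_finsetSum _ fun i _ =>
        ((hh _ (hYQ i).2).continuousWithinAt.continuousAt (hV.mem_nhds (hYQ i).2)).tendsto.comp (hlim1 i)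
    have h2 : Tendsto (fun j => P h (f (x (φ j)))) atTop (𝓝 (P h (f x0))) :=
      (((hP h hh).1.continuousOn).continuousAt (hW.mem_nhds (hmap hx0))).tendsto.comp
        (hflim.comp hφ.tendsto_atTop)
    refine tendsto_nhds_unique h2 (h1.congr fun j => ?_)
    rw [hXs _ h hh]

end tup

theorem fbh_tuple_gen {E : Type*} [NormedAddCommGroup E] [NormedSpace ℂ E] [FiniteDimensional ℂ E]
    {f : E → E} {V : Set E} (hV : IsOpen V) (hVc : IsPreconnected V) (hVn : V.Nonempty)
    (hf : DifferentiableOn ℂ f V) (hmap : MapsTo f V V)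
    (hprop : ∀ K, K ⊆ V → IsCompact K → IsCompact (f ⁻¹' K ∩ V)) :
    V ⊆ f '' V ∧ ∃ N : ℕ, ∃ P : (E → ℂ) → E → ℂ,
      (∀ h, DifferentiableOn ℂ h V → DifferentiableOn ℂ (P h) V) ∧
      ∀ x0 ∈ V, ∃ X : Fin N → E, (∀ i, X i ∈ V) ∧ (∀ i, f (X i) = f x0) ∧
        (∃ i, X i = x0) ∧ ∀ h, DifferentiableOn ℂ h V → P h (f x0) = ∑ i, h (X i) := by
  let e : E ≃L[ℂ] (Fin (Module.finrank ℂ E) → ℂ) :=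
    (Module.finBasis ℂ E).equivFun.toContinuousLinearEquiv
  have hde : Differentiable ℂ e := e.differentiable
  have hdes : Differentiable ℂ e.symm := e.symm.differentiable
  have hV' : IsOpen (e.symm ⁻¹' V) := hV.preimage e.symm.continuous
  have himg : e.symm ⁻¹' V = e '' V := by
    ext x; constructor
    · intro hx; exact ⟨e.symm x, hx, by simp⟩
    · rintro ⟨y, hy, rfl⟩; simpa using hy
  have hVc' : IsPreconnected (e.symm ⁻¹' V) := by
    rw [himg]; exact hVc.image e e.continuous.continuousOn
  obtain ⟨hs, N, P, hP1, hP2⟩ := fbh_tuple (f := fun y => e (f (e.symm y))) hV' hVc'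
    (by rw [himg]; exact hVn.image e) hV' hVc'
    (hde.comp_differentiableOn (hf.comp hdes.differentiableOn (fun y hy => hy)))
    (fun y hy => by simpa using hmap hy)
    (fun K hK hKc => by
      have h1 := hprop (e.symm '' K) (by rintro _ ⟨y, hy, rfl⟩; exact hK hy)
        (hKc.image e.symm.continuous)
      have h2 := h1.image e.continuous
      convert h2 using 1
      ext x
      constructor
      · rintro ⟨hx1, hx2⟩
        exact ⟨e.symm x, ⟨⟨e (f (e.symm x)), hx1, by simp⟩, hx2⟩, by simp⟩
      · rintro ⟨y, ⟨⟨k, hk, hky⟩, hy⟩, rfl⟩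
        refine ⟨?_, by simpa using hy⟩
        simp only [mem_preimage, ContinuousLinearEquiv.symm_apply_apply]
        rw [← hky]; simpa using hk)
  refine ⟨?_, N, fun h y => P (fun x => h (e.symm x)) (e y), ?_, ?_⟩
  · intro y hy
    obtain ⟨x, hx, hxy⟩ := hs (show e y ∈ e.symm ⁻¹' V by simpa using hy)
    exact ⟨e.symm x, hx, e.injective hxy⟩
  · intro h hh
    exact (hP1 _ (hh.comp hdes.differentiableOn fun y hy => hy)).comp hde.differentiableOn
      (fun y hy => by simpa using hy)
  · intro x0 hx0
    obtain ⟨X, h1, h2, ⟨i, h3⟩, h4⟩ := hP2 (e x0) (by simpa using hx0)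
    refine ⟨fun i => e.symm (X i), h1, fun i => ?_, ⟨i, by simp [h3]⟩, fun h hh => ?_⟩
    · have := h2 i
      simp only [ContinuousLinearEquiv.symm_apply_apply] at this
      exact e.injective this
    · have := h4 (fun x => h (e.symm x)) (hh.comp hdes.differentiableOn fun y hy => hy)
      simpa using this

end partF3

section partG1

open Set Filter Topology Metric ComplexConjugate

section basics
variable {E1 E2 : Type*} [NormedAddCommGroup E1] [InnerProductSpace ℂ E1]
  [NormedAddCommGroup E2] [InnerProductSpace ℂ E2]

/-- the Fock–Bargmann–Hartogs domain, general inner product spaces -/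
def fbhD (E1 E2 : Type*) [NormedAddCommGroup E1] [NormedAddCommGroup E2] (μ : ℝ) : Set (E1 × E2) :=
  {p | ‖p.2‖ ^ 2 < Real.exp (-μ * ‖p.1‖ ^ 2)}

noncomputable def fbhS (μ : ℝ) (p : E1 × E2) : ℝ := ‖p.2‖ * Real.exp (μ * ‖p.1‖ ^ 2 / 2)

variable {μ : ℝ}

theorem fbhS_nonneg (p : E1 × E2) : 0 ≤ fbhS μ p := by unfold fbhS; positivity

theorem fbhS_continuous : Continuous (fbhS μ : E1 × E2 → ℝ) := by unfold fbhS; fun_prop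

theorem fbhD_iff {p : E1 × E2} : p ∈ fbhD E1 E2 μ ↔ fbhS μ p < 1 := by
  have h1 : fbhS μ p ^ 2 = ‖p.2‖ ^ 2 * Real.exp (μ * ‖p.1‖ ^ 2) := by
    unfold fbhS
    rw [mul_pow, ← Real.exp_nat_mul]
    congr 2; push_cast; ring
  have h2 : p ∈ fbhD E1 E2 μ ↔ fbhS μ p ^ 2 < 1 := by
    rw [h1]
    change ‖p.2‖ ^ 2 < Real.exp (-μ * ‖p.1‖ ^ 2) ↔ _
    rw [neg_mul, Real.exp_neg, ← one_div, lt_div_iff₀ (Real.exp_pos _)]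
  rw [h2, sq_lt_one_iff₀ (fbhS_nonneg p)]

theorem fbhD_isOpen : IsOpen (fbhD E1 E2 μ) := by
  have : fbhD E1 E2 μ = fbhS μ ⁻¹' Iio 1 := by ext p; exact fbhD_iff
  rw [this]; exact isOpen_Iio.preimage fbhS_continuous

theorem fbhS_smul_snd (z : E1) (w : E2) (c : ℂ) : fbhS μ (z, c • w) = ‖c‖ * fbhS μ (z, w) := by
  simp [fbhS, norm_smul]; ring

theorem fbhS_smul_le (hμ : 0 < μ) (p : E1 × E2) {c : ℂ} (hc : ‖c‖ ≤ 1) :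
    fbhS μ (c • p) ≤ ‖c‖ * fbhS μ p := by
  unfold fbhS
  rw [Prod.smul_fst, Prod.smul_snd, norm_smul, norm_smul, mul_assoc]
  have : ‖c‖ * ‖p.1‖ ≤ ‖p.1‖ := mul_le_of_le_one_left (norm_nonneg _) hc
  gcongr

theorem fbhD_zero_mem : (0 : E1 × E2) ∈ fbhD E1 E2 μ := by simp [fbhD_iff, fbhS]

theorem fbhD_mem_zero (z : E1) : (z, (0 : E2)) ∈ fbhD E1 E2 μ := by simp [fbhD_iff, fbhS]

theorem fbhD_smul_mem (hμ : 0 < μ) {p : E1 × E2} (hp : p ∈ fbhD E1 E2 μ) {c : ℂ} (hc : ‖c‖ ≤ 1) :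
    c • p ∈ fbhD E1 E2 μ := by
  rw [fbhD_iff] at *
  refine (fbhS_smul_le hμ p hc).trans_lt ?_
  exact (mul_le_of_le_one_left (fbhS_nonneg p) hc).trans_lt hp

theorem fbhD_preconnected (hμ : 0 < μ) : IsPreconnected (fbhD E1 E2 μ) := by
  have : StarConvex ℝ (0 : E1 × E2) (fbhD E1 E2 μ) := by
    intro p hp a b ha hb hab
    have := fbhD_smul_mem hμ hp (c := (b : ℂ)) (by
      rw [Complex.norm_real, Real.norm_of_nonneg hb]; linarith)
    simpa using this
  exact (this.isPathConnected fbhD_zero_mem).isConnected.isPreconnected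

theorem fbhD_compact [FiniteDimensional ℂ E1] [FiniteDimensional ℂ E2] (hμ : 0 < μ) (c R : ℝ) :
    IsCompact {p : E1 × E2 | fbhS μ p ≤ c ∧ ‖p.1‖ ≤ R} := by
  have : ProperSpace E1 := FiniteDimensional.proper ℂ E1
  have : ProperSpace E2 := FiniteDimensional.proper ℂ E2
  refine ((isCompact_closedBall (0 : E1) R).prod (isCompact_closedBall (0 : E2) c)).of_isClosed_subset
    ?_ ?_
  · exact (isClosed_le fbhS_continuous continuous_const).inter
      (isClosed_le (continuous_norm.comp continuous_fst) continuous_const)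
  · rintro p ⟨h1, h2⟩
    refine ⟨by simpa using h2, ?_⟩
    have h3 : ‖p.2‖ ≤ fbhS μ p := by
      unfold fbhS
      refine le_mul_of_one_le_right (norm_nonneg _) ?_
      exact Real.one_le_exp (by positivity)
    simpa using h3.trans h1

theorem fbhS_norm_le (hμ : 0 < μ) (p : E1 × E2) : ‖p.2‖ ≤ fbhS μ p := by
  unfold fbhS
  refine le_mul_of_one_le_right (norm_nonneg _) ?_
  exact Real.one_le_exp (by positivity)

/-- test functions -/
noncomputable def fbhH (μ : ℝ) (u : E2) (d : E1) (p : E1 × E2) : ℂ :=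
  inner ℂ u p.2 * Complex.exp (μ * inner ℂ d p.1 - μ * ‖d‖ ^ 2 / 2)

theorem fbhH_diff (u : E2) (d : E1) : Differentiable ℂ (fbhH μ u d) := by
  have h1 : Differentiable ℂ fun p : E1 × E2 => (inner ℂ u p.2 : ℂ) :=
    (innerSL ℂ u).differentiable.comp differentiable_snd
  have h2 : Differentiable ℂ fun p : E1 × E2 => (inner ℂ d p.1 : ℂ) :=
    (innerSL ℂ d).differentiable.comp differentiable_fst
  unfold fbhH
  fun_prop

theorem fbhH_norm (u : E2) (d : E1) (p : E1 × E2) :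
    ‖fbhH μ u d p‖ = ‖(inner ℂ u p.2 : ℂ)‖ *
      Real.exp (μ * ((inner ℂ d p.1 : ℂ).re) - μ * ‖d‖ ^ 2 / 2) := by
  unfold fbhH
  rw [norm_mul, Complex.norm_exp]
  congr 2
  have : (μ * inner ℂ d p.1 - μ * ‖d‖ ^ 2 / 2 : ℂ) =
      (μ : ℂ) * inner ℂ d p.1 - ((μ * ‖d‖ ^ 2 / 2 : ℝ) : ℂ) := by push_cast; ring
  rw [this, Complex.sub_re, Complex.re_ofReal_mul, Complex.ofReal_re]

theorem fbhH_le (hμ : 0 < μ) {u : E2} (hu : ‖u‖ ≤ 1) (d : E1) (p : E1 × E2) :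
    ‖fbhH μ u d p‖ ≤ fbhS μ p := by
  rw [fbhH_norm]
  unfold fbhS
  have h1 : ‖(inner ℂ u p.2 : ℂ)‖ ≤ ‖p.2‖ :=
    (norm_inner_le_norm u p.2).trans (mul_le_of_le_one_left (norm_nonneg _) hu)
  have h2 : (inner ℂ d p.1 : ℂ).re ≤ ‖d‖ * ‖p.1‖ :=
    (Complex.re_le_norm _).trans (norm_inner_le_norm d p.1)
  have h3 : μ * ((inner ℂ d p.1 : ℂ).re) - μ * ‖d‖ ^ 2 / 2 ≤ μ * ‖p.1‖ ^ 2 / 2 := by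
    have : μ * ((inner ℂ d p.1 : ℂ).re) ≤ μ * (‖d‖ * ‖p.1‖) := by gcongr
    nlinarith [mul_nonneg hμ.le (sq_nonneg (‖d‖ - ‖p.1‖))]
  gcongr

theorem fbhH_attain (p : E1 × E2) : ∃ u : E2, ‖u‖ ≤ 1 ∧ ‖fbhH μ u p.1 p‖ = fbhS μ p := by
  by_cases hw : p.2 = 0
  · exact ⟨0, by simp, by simp [fbhH, fbhS, hw]⟩
  · have hn : ‖p.2‖ ≠ 0 := by simpa using hw
    refine ⟨((‖p.2‖ : ℂ)⁻¹) • p.2, ?_, ?_⟩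
    · rw [norm_smul]; simp [hn]
    · rw [fbhH_norm, inner_smul_left, inner_self_eq_norm_sq_to_K, inner_self_eq_norm_sq_to_K]
      unfold fbhS
      congr 1
      · simp [hn]
        field_simp
      · congr 1
        have : (((‖p.1‖ : ℂ)) ^ 2).re = ‖p.1‖ ^ 2 := by norm_cast
        erw [this]
        ring

end basics

end partG1

section partG2

open Set Filter Topology Metric ComplexConjugate Asymptotics

section onevar

theorem fbh_schwarz_one (s : ℕ) : ∀ {g : ℂ → ℂ} {R M : ℝ}, 0 < R → DifferentiableOn ℂ g (ball 0 R) →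
    (∀ x ∈ ball (0 : ℂ) R, ‖g x‖ ≤ M) → (∀ j < s, g =o[𝓝[≠] 0] fun x => x ^ j) →
    ∀ x ∈ ball (0 : ℂ) R, ‖g x‖ ≤ M * (‖x‖ / R) ^ s := by
  induction s with
  | zero => intro g R M hR hg hM _ x hx; simpa using hM x hx
  | succ s ih =>
    intro g R M hR hg hM ho x hx
    have hgc : ContinuousAt g 0 := (hg.continuousOn).continuousAt (ball_mem_nhds 0 hR)
    have hg0 : g 0 = 0 := by
      have h1 : Tendsto g (𝓝[≠] 0) (𝓝 0) := by
        have := ho 0 (by omega)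
        simp only [pow_zero] at this
        exact (isLittleO_one_iff ℂ).1 this
      exact tendsto_nhds_unique (hgc.tendsto.mono_left nhdsWithin_le_nhds) h1
    have hmem : ball (0 : ℂ) R ∈ 𝓝 (0 : ℂ) := ball_mem_nhds 0 hR
    have hd : DifferentiableOn ℂ (dslope g 0) (ball 0 R) :=
      (Complex.differentiableOn_dslope hmem).2 hg
    have heq : ∀ x : ℂ, g x = x * dslope g 0 x := by
      intro x
      have := sub_smul_dslope g 0 x
      rw [hg0] at this
      simpa using this.symm
    have hM0 : 0 ≤ M := (norm_nonneg _).trans (hM 0 (mem_ball_self hR))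
    have hb : ∀ x ∈ ball (0 : ℂ) R, ‖dslope g 0 x‖ ≤ M / R := by
      intro x hx
      have key : ∀ ε > 0, ‖dslope g 0 x‖ ≤ (M + ε) / R := by
        intro ε hε
        refine Complex.norm_dslope_le_div_of_mapsTo_ball hg (R₂ := M + ε) ?_ hx
        intro y hy
        rw [hg0, mem_closedBall, dist_zero_right]
        linarith [hM y hy]
      have hlim : Tendsto (fun ε : ℝ => (M + ε) / R) (𝓝[>] 0) (𝓝 (M / R)) := by
        have : ContinuousAt (fun ε : ℝ => (M + ε) / R) 0 := by fun_prop
        simpa using this.tendsto.mono_left nhdsWithin_le_nhds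
      exact ge_of_tendsto hlim (by filter_upwards [self_mem_nhdsWithin] with ε hε using key ε hε)
    have ho' : ∀ j < s, dslope g 0 =o[𝓝[≠] 0] fun x => x ^ j := by
      intro j hj
      have h1 := ho (j + 1) (by omega)
      have h2 := h1.mul_isBigO (isBigO_refl (fun x : ℂ => x⁻¹) (𝓝[≠] 0))
      refine h2.congr' ?_ ?_
      · filter_upwards [self_mem_nhdsWithin] with x hx
        have hx' : x ≠ 0 := hx
        rw [heq x]; field_simp
      · filter_upwards [self_mem_nhdsWithin] with x hx
        have hx' : x ≠ 0 := hx
        rw [pow_succ, mul_assoc, mul_inv_cancel₀ hx', mul_one]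
    have := ih hR hd hb ho' x hx
    rw [heq x, norm_mul]
    calc ‖x‖ * ‖dslope g 0 x‖ ≤ ‖x‖ * (M / R * (‖x‖ / R) ^ s) := by gcongr
      _ = M * (‖x‖ / R) ^ (s + 1) := by rw [pow_succ]; ring

theorem fbh_quot_one {s : ℕ} {g : ℂ → ℂ} {R C : ℝ} (hR : 0 < R) (hg : DifferentiableOn ℂ g (ball 0 R))
    (hC : ∀ x ∈ ball (0 : ℂ) R, ‖g x‖ ≤ C * ‖x‖ ^ s) :
    ∃ L : ℂ, ∀ x ∈ ball (0 : ℂ) R, x ≠ 0 → ‖g x / x ^ s - L‖ ≤ (2 * C + 1) / R * ‖x‖ := by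
  set q : ℂ → ℂ := fun x => g x / x ^ s with hq
  have hmem : ball (0 : ℂ) R ∈ 𝓝 (0 : ℂ) := ball_mem_nhds 0 hR
  have hqb : ∀ x ∈ ball (0 : ℂ) R, x ≠ 0 → ‖q x‖ ≤ C := by
    intro x hx hx0
    have := hC x hx
    simp only [hq, norm_div, norm_pow]
    rw [div_le_iff₀ (by positivity)]
    exact this
  have hqd : DifferentiableOn ℂ q (ball 0 R \ {0}) := by
    intro x hx
    have hx0 : x ≠ 0 := hx.2
    refine DifferentiableWithinAt.div ((hg x hx.1).mono diff_subset) (by fun_prop) (by simp [hx0])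
  have hG := Complex.differentiableOn_update_limUnder_of_bddAbove hmem hqd
    ⟨C, by rintro _ ⟨x, hx, rfl⟩; exact hqb x hx.1 hx.2⟩
  set L := limUnder (𝓝[≠] 0) q with hL
  have hval : ∀ x, x ≠ 0 → Function.update q 0 L x = q x := fun x hx => Function.update_of_ne hx _ _
  have hlim : Tendsto q (𝓝[≠] 0) (𝓝 L) := by
    have h1 := (hG.continuousOn.continuousAt hmem).tendsto.mono_left
      (nhdsWithin_le_nhds (s := {0}ᶜ))
    rw [Function.update_self] at h1
    refine h1.congr' ?_
    filter_upwards [self_mem_nhdsWithin] with x hx using hval x hx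
  have hLb : ‖L‖ ≤ C := by
    refine le_of_tendsto hlim.norm ?_
    filter_upwards [self_mem_nhdsWithin, mem_nhdsWithin_of_mem_nhds hmem] with x hx hx2
    exact hqb x hx2 hx
  refine ⟨L, fun x hx hx0 => ?_⟩
  have := Complex.dist_le_div_mul_dist_of_mapsTo_ball hG (R₂ := 2 * C + 1) ?_ hx
  · rw [hval x hx0, Function.update_self, dist_eq_norm, dist_zero_right] at this
    exact this
  · intro y hy
    rw [Function.update_self]
    by_cases hy0 : y = 0
    · rw [hy0, Function.update_self]
      have := (norm_nonneg L).trans hLb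
      exact mem_closedBall_self (by linarith)
    · rw [hval y hy0, mem_closedBall, dist_eq_norm]
      have := norm_sub_le (q y) L
      have := hqb y hy hy0
      linarith

end onevar

end partG2

section partG3

open Set Filter Topology Metric ComplexConjugate Asymptotics

section slices
variable {E1 E2 : Type*} [NormedAddCommGroup E1] [InnerProductSpace ℂ E1]
  [NormedAddCommGroup E2] [InnerProductSpace ℂ E2] {μ : ℝ}

theorem fbh_slice_mem {z : E1} {w : E2} {S0 : ℝ} (hS0 : 0 < S0) (hS : fbhS μ (z, w) ≤ S0) {c : ℂ}
    (hc : c ∈ ball (0 : ℂ) (1 / S0)) : (z, c • w) ∈ fbhD E1 E2 μ := by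
  rw [mem_ball, dist_zero_right, lt_div_iff₀ hS0] at hc
  rw [fbhD_iff, fbhS_smul_snd]
  refine lt_of_le_of_lt ?_ hc
  gcongr

theorem fbh_slice_diff {H : E1 × E2 → ℂ} (hH : DifferentiableOn ℂ H (fbhD E1 E2 μ)) {z : E1} {w : E2}
    {S0 : ℝ} (hS0 : 0 < S0) (hS : fbhS μ (z, w) ≤ S0) :
    DifferentiableOn ℂ (fun c : ℂ => H (z, c • w)) (ball 0 (1 / S0)) := by
  refine hH.comp ?_ fun c hc => fbh_slice_mem hS0 hS hc
  fun_prop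

theorem fbh_lemS {H : E1 × E2 → ℂ} {M : ℝ} {s : ℕ} (hH : DifferentiableOn ℂ H (fbhD E1 E2 μ))
    (hM : ∀ p ∈ fbhD E1 E2 μ, ‖H p‖ ≤ M)
    (ho : ∀ z w, ∀ j < s, (fun c : ℂ => H (z, c • w)) =o[𝓝[≠] 0] fun c => c ^ j) :
    ∀ p ∈ fbhD E1 E2 μ, ‖H p‖ ≤ M * fbhS μ p ^ s := by
  rintro ⟨z, w⟩ hp
  by_cases hS : fbhS μ (z, w) = 0
  · rcases Nat.eq_zero_or_pos s with rfl | hs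
    · simpa using hM _ hp
    · have hw : w = 0 := by
        unfold fbhS at hS
        simpa using hS
      have h1 := ho z w 0 hs
      subst hw
      simp only [smul_zero, pow_zero] at h1
      have h2 : H (z, 0) = 0 := by
        have := (isLittleO_one_iff ℂ).1 h1
        exact tendsto_nhds_unique tendsto_const_nhds this
      rw [h2, hS]
      simp [hs.ne']
  · have hS0 : 0 < fbhS μ (z, w) := lt_of_le_of_ne (fbhS_nonneg _) (Ne.symm hS)
    have h1 := fbh_schwarz_one s (R := 1 / fbhS μ (z, w)) (by positivity)
      (fbh_slice_diff hH hS0 le_rfl) (fun c hc => hM _ (fbh_slice_mem hS0 le_rfl hc)) (ho z w) 1 (by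
        rw [mem_ball, dist_zero_right, norm_one, lt_div_iff₀ hS0, one_mul]
        exact fbhD_iff.1 hp)
    simpa using h1

theorem fbh_lemV_aux {H : E1 × E2 → ℂ} {M : ℝ} {s : ℕ} (hH : DifferentiableOn ℂ H (fbhD E1 E2 μ))
    (hM0 : 0 ≤ M)
    (hM : ∀ p ∈ fbhD E1 E2 μ, ‖H p‖ ≤ M * fbhS μ p ^ s) {z : E1} {w : E2} {S0 : ℝ} (hS0 : 0 < S0)
    (hS : fbhS μ (z, w) ≤ S0) :
    ∃ L : ℂ, ∀ c ∈ ball (0 : ℂ) (1 / S0), c ≠ 0 →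
      ‖H (z, c • w) / c ^ s - L‖ ≤ (2 * (M * S0 ^ s) + 1) / (1 / S0) * ‖c‖ := by
  refine fbh_quot_one (by positivity) (fbh_slice_diff hH hS0 hS) fun c hc => ?_
  refine (hM _ (fbh_slice_mem hS0 hS hc)).trans ?_
  rw [fbhS_smul_snd, mul_pow, mul_assoc, mul_comm (S0 ^ s)]
  have := fbhS_nonneg (μ := μ) (z, w)
  gcongr

theorem fbh_tendsto_of_bound {g : ℂ → ℂ} {L : ℂ} {R K : ℝ} (hR : 0 < R)
    (h : ∀ c ∈ ball (0 : ℂ) R, c ≠ 0 → ‖g c - L‖ ≤ K * ‖c‖) : Tendsto g (𝓝[≠] 0) (𝓝 L) := by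
  rw [tendsto_iff_norm_sub_tendsto_zero]
  have h1 : Tendsto (fun c : ℂ => K * ‖c‖) (𝓝[≠] 0) (𝓝 0) := by
    have : Continuous fun c : ℂ => K * ‖c‖ := by fun_prop
    simpa using (this.tendsto 0).mono_left nhdsWithin_le_nhds
  refine squeeze_zero' (Eventually.of_forall fun _ => norm_nonneg _) ?_ h1
  filter_upwards [self_mem_nhdsWithin, mem_nhdsWithin_of_mem_nhds (ball_mem_nhds 0 hR)] with c h1 h2
  exact h c h2 h1

theorem fbh_lemV {H : E1 × E2 → ℂ} {M : ℝ} {s : ℕ} (hH : DifferentiableOn ℂ H (fbhD E1 E2 μ))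
    (hM0 : 0 ≤ M) (hM : ∀ p ∈ fbhD E1 E2 μ, ‖H p‖ ≤ M * fbhS μ p ^ s) :
    ∃ q : E1 → E2 → ℂ,
      (∀ z w, Tendsto (fun c : ℂ => H (z, c • w) / c ^ s) (𝓝[≠] 0) (𝓝 (q z w))) ∧
      (∀ z w, ‖q z w‖ ≤ M * fbhS μ (z, w) ^ s) ∧
      ∀ z v w, Differentiable ℂ fun t : ℂ => q (z + t • v) w := by
  have hpos : ∀ p : E1 × E2, 0 < fbhS μ p + 1 := fun p => by linarith [fbhS_nonneg (μ := μ) p]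
  choose q hq using fun z w => fbh_lemV_aux hH hM0 hM (hpos (z, w)) (le_add_of_nonneg_right zero_le_one)
  have hlim : ∀ z w, Tendsto (fun c : ℂ => H (z, c • w) / c ^ s) (𝓝[≠] 0) (𝓝 (q z w)) := fun z w =>
    fbh_tendsto_of_bound (one_div_pos.2 (hpos (z, w))) (hq z w)
  refine ⟨q, hlim, fun z w => ?_, fun z v w => ?_⟩
  · refine le_of_tendsto (hlim z w).norm ?_
    filter_upwards [self_mem_nhdsWithin, mem_nhdsWithin_of_mem_nhds
      (ball_mem_nhds 0 (one_div_pos.2 (hpos (z, w))))] with c h1 h2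
    have h3 := hM _ (fbh_slice_mem (hpos (z, w)) (by linarith) h2)
    have h4 : 0 < ‖c‖ := norm_pos_iff.2 h1
    rw [norm_div, norm_pow, div_le_iff₀ (by positivity)]
    rw [fbhS_smul_snd, mul_pow] at h3
    linarith
  · intro t0
    -- uniform bound near t0
    have hSc : Continuous fun t : ℂ => fbhS μ (z + t • v, w) := fbhS_continuous.comp (by fun_prop)
    obtain ⟨B, hB⟩ := (isCompact_closedBall t0 1).bddAbove_image hSc.continuousOn
    have hB1 : ∀ t ∈ ball t0 1, fbhS μ (z + t • v, w) ≤ max B 1 := fun t ht =>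
      (hB (mem_image_of_mem _ (ball_subset_closedBall ht))).trans (le_max_left _ _)
    have hB0 : 0 < max B 1 := by positivity
    have hu : TendstoLocallyUniformlyOn (fun (c : ℂ) (t : ℂ) => H (z + t • v, c • w) / c ^ s)
        (fun t => q (z + t • v) w) (𝓝[≠] 0) (ball t0 1) := by
      refine TendstoUniformlyOn.tendstoLocallyUniformlyOn ?_
      rw [Metric.tendstoUniformlyOn_iff]
      intro ε hε
      have h1 : Tendsto (fun c : ℂ => (2 * (M * (max B 1) ^ s) + 1) / (1 / max B 1) * ‖c‖) (𝓝[≠] 0) (𝓝 0) := by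
        have : Continuous fun c : ℂ => (2 * (M * (max B 1) ^ s) + 1) / (1 / max B 1) * ‖c‖ := by fun_prop
        simpa using (this.tendsto 0).mono_left nhdsWithin_le_nhds
      filter_upwards [self_mem_nhdsWithin, mem_nhdsWithin_of_mem_nhds
        (ball_mem_nhds 0 (one_div_pos.2 hB0)), h1.eventually (gt_mem_nhds hε)] with c hc1 hc2 hc3 t ht
      obtain ⟨L, hL⟩ := fbh_lemV_aux hH hM0 hM hB0 (hB1 t ht)
      have hLq : L = q (z + t • v) w :=
        tendsto_nhds_unique (fbh_tendsto_of_bound (one_div_pos.2 hB0) hL) (hlim _ _)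
      rw [dist_comm, dist_eq_norm, ← hLq]
      exact (hL c hc2 hc1).trans_lt hc3
    have hd := hu.differentiableOn (by
      filter_upwards [self_mem_nhdsWithin, mem_nhdsWithin_of_mem_nhds
        (ball_mem_nhds 0 (one_div_pos.2 hB0))] with c hc1 hc2
      refine DifferentiableOn.div_const ?_ _
      refine hH.comp ?_ fun t ht => fbh_slice_mem hB0 (hB1 t ht) hc2
      fun_prop) isOpen_ball
    exact (hd t0 (mem_ball_self one_pos)).differentiableAt (ball_mem_nhds t0 one_pos)

theorem fbh_lemV_zero {H : E1 × E2 → ℂ} {M : ℝ} {s : ℕ} (hH : DifferentiableOn ℂ H (fbhD E1 E2 μ))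
    (hM0 : 0 ≤ M) (hM : ∀ p ∈ fbhD E1 E2 μ, ‖H p‖ ≤ M * fbhS μ p ^ s)
    (hq : ∀ z w, Tendsto (fun c : ℂ => H (z, c • w) / c ^ s) (𝓝[≠] 0) (𝓝 0)) :
    ∀ p ∈ fbhD E1 E2 μ, ‖H p‖ ≤ M * fbhS μ p ^ (s + 1) := by
  refine fbh_lemS hH (fun p hp => (hM p hp).trans ?_) fun z w j hj => ?_
  · refine mul_le_of_le_one_right hM0 (pow_le_one₀ (fbhS_nonneg p) (fbhD_iff.1 hp).le)
  · have h1 : (fun c : ℂ => H (z, c • w)) =o[𝓝[≠] 0] fun c => c ^ s := by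
      rw [isLittleO_iff_tendsto']
      · exact hq z w
      · filter_upwards [self_mem_nhdsWithin] with c hc h0
        exact absurd h0 (pow_ne_zero _ hc)
    refine h1.trans_isBigO ?_
    rw [isBigO_iff]
    refine ⟨1, ?_⟩
    filter_upwards [mem_nhdsWithin_of_mem_nhds (ball_mem_nhds (0 : ℂ) one_pos)] with c hc
    rw [mem_ball, dist_zero_right] at hc
    rw [norm_pow, norm_pow, one_mul]
    exact pow_le_pow_of_le_one (norm_nonneg _) hc.le (by omega)

end slices

end partG3

section partG4

open Set Filter Topology Metric ComplexConjugate Asymptotics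

section proper
variable {E1 E2 : Type*} [NormedAddCommGroup E1] [InnerProductSpace ℂ E1]
  [NormedAddCommGroup E2] [InnerProductSpace ℂ E2] {μ : ℝ} {f : E1 × E2 → E1 × E2}

structure FbhProper (μ : ℝ) (f : E1 × E2 → E1 × E2) : Prop where
  mu : 0 < μ
  diff : DifferentiableOn ℂ f (fbhD E1 E2 μ)
  maps : MapsTo f (fbhD E1 E2 μ) (fbhD E1 E2 μ)
  proper : ∀ K : Set (E1 × E2), K ⊆ fbhD E1 E2 μ → IsCompact K → IsCompact (f ⁻¹' K ∩ fbhD E1 E2 μ)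

theorem FbhProper.line_const (h : FbhProper μ f) {z v : E1} {p0 : E1 × E2}
    (hc : ∀ t : ℂ, f (z + t • v, 0) = p0) : v = 0 := by
  by_contra hv
  have hp0 : p0 ∈ fbhD E1 E2 μ := by rw [← hc 0]; exact h.maps (fbhD_mem_zero _)
  have hK := h.proper {p0} (by simpa using hp0) isCompact_singleton
  obtain ⟨R, hR⟩ := hK.isBounded.exists_norm_le
  have hvn : 0 < ‖v‖ := norm_pos_iff.2 hv
  have h1 := hR (z + (((‖z‖ + |R| + 1) / ‖v‖ : ℝ) : ℂ) • v, 0) ⟨by simp [hc], fbhD_mem_zero _⟩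
  have h2 : ‖z + (((‖z‖ + |R| + 1) / ‖v‖ : ℝ) : ℂ) • v‖ ≤ R := (norm_fst_le _).trans h1
  have h3 : ‖(((‖z‖ + |R| + 1) / ‖v‖ : ℝ) : ℂ) • v‖ = ‖z‖ + |R| + 1 := by
    rw [norm_smul, Complex.norm_real, Real.norm_of_nonneg (by positivity)]
    field_simp
  have h4 := norm_sub_le (z + (((‖z‖ + |R| + 1) / ‖v‖ : ℝ) : ℂ) • v) z
  rw [add_sub_cancel_left, h3] at h4
  linarith [le_abs_self R]

theorem FbhProper.diff_base (h : FbhProper μ f) : Differentiable ℂ fun z : E1 => f (z, 0) := by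
  intro z
  have h1 : DifferentiableAt ℂ f (z, 0) :=
    (h.diff _ (fbhD_mem_zero z)).differentiableAt (fbhD_isOpen.mem_nhds (fbhD_mem_zero z))
  exact h1.comp z (by fun_prop)

theorem FbhProper.snd_lt (h : FbhProper μ f) {p} (hp : p ∈ fbhD E1 E2 μ) : ‖(f p).2‖ < 1 :=
  (fbhS_norm_le h.mu _).trans_lt (fbhD_iff.1 (h.maps hp))

theorem FbhProper.base_snd [Nontrivial E1] (h : FbhProper μ f) (z : E1) : (f (z, 0)).2 = 0 := by
  by_contra hne
  have h2 : ∀ x, (f (x, 0)).2 = (f (z, 0)).2 := by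
    intro x
    have hd : Differentiable ℂ fun z : E1 => (f (z, 0)).2 := h.diff_base.snd
    refine hd.apply_eq_apply_of_bounded ?_ x z
    rw [isBounded_iff_forall_norm_le]
    refine ⟨1, ?_⟩
    rintro _ ⟨y, rfl⟩
    exact (h.snd_lt (fbhD_mem_zero y)).le
  have hcn : 0 < ‖(f (z, 0)).2‖ := norm_pos_iff.2 hne
  set c := ‖(f (z, 0)).2‖ with hc
  have h1 : ∀ x, (f (x, 0)).1 = (f (z, 0)).1 := by
    intro x
    have hd : Differentiable ℂ fun z : E1 => (f (z, 0)).1 := h.diff_base.fst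
    refine hd.apply_eq_apply_of_bounded ?_ x z
    rw [isBounded_iff_forall_norm_le]
    refine ⟨2 / (μ * c) + 1, ?_⟩
    rintro _ ⟨y, rfl⟩
    have h3 := fbhD_iff.1 (h.maps (fbhD_mem_zero y))
    unfold fbhS at h3
    rw [h2 y, ← hc] at h3
    have h4 := Real.add_one_le_exp (μ * ‖(f (y, 0)).1‖ ^ 2 / 2)
    have h5 : c * (μ * ‖(f (y, 0)).1‖ ^ 2 / 2) < 1 := by nlinarith
    have h6 : ‖(f (y, 0)).1‖ ^ 2 ≤ 2 / (μ * c) := by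
      have := h.mu
      rw [le_div_iff₀ (by positivity)]; nlinarith
    have h7 : 0 ≤ 2 / (μ * c) := by have := h.mu; positivity
    nlinarith [sq_nonneg (‖(f (y, 0)).1‖ - 1)]
  obtain ⟨v, hv⟩ := exists_ne (0 : E1)
  exact hv (h.line_const (z := 0) (p0 := f (z, 0)) fun t => Prod.ext (h1 _) (h2 _))

theorem FbhProper.exists_k [FiniteDimensional ℂ E1] [FiniteDimensional ℂ E2] [Nontrivial E2]
    (h : FbhProper μ f) :
    ∃ k : ℕ, (∀ x ∈ fbhD E1 E2 μ, fbhS μ (f x) ≤ fbhS μ x ^ k) ∧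
      ¬ ∀ x ∈ fbhD E1 E2 μ, fbhS μ (f x) ≤ fbhS μ x ^ (k + 1) := by
  by_contra hcon
  push Not at hcon
  have hall : ∀ k : ℕ, ∀ x ∈ fbhD E1 E2 μ, fbhS μ (f x) ≤ fbhS μ x ^ k := by
    intro k
    induction k with
    | zero => intro x hx; simpa using (fbhD_iff.1 (h.maps hx)).le
    | succ k ih => exact hcon k ih
  have hz : ∀ x ∈ fbhD E1 E2 μ, fbhS μ (f x) = 0 := by
    intro x hx
    have h1 := tendsto_pow_atTop_nhds_zero_of_lt_one (fbhS_nonneg x) (fbhD_iff.1 hx)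
    exact le_antisymm (ge_of_tendsto' h1 fun k => hall k x hx) (fbhS_nonneg _)
  have hsurj := (fbh_tuple_gen fbhD_isOpen (fbhD_preconnected h.mu) ⟨0, fbhD_zero_mem⟩ h.diff h.maps
    h.proper).1
  obtain ⟨w, hw⟩ := exists_ne (0 : E2)
  have hwn : 0 < ‖w‖ := norm_pos_iff.2 hw
  have hy : ((0 : E1), (((1 / 2) / ‖w‖ : ℝ) : ℂ) • w) ∈ fbhD E1 E2 μ := by
    rw [fbhD_iff, fbhS_smul_snd, Complex.norm_real, Real.norm_of_nonneg (by positivity)]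
    simp [fbhS]
    field_simp
    norm_num
  obtain ⟨x, hx, hxy⟩ := hsurj hy
  have := hz x hx
  rw [hxy, fbhS_smul_snd] at this
  simp [fbhS, hw] at this
end proper

end partG4

section partG5

open Set Filter Topology Metric ComplexConjugate Asymptotics

section proper
variable {E1 E2 : Type*} [NormedAddCommGroup E1] [InnerProductSpace ℂ E1]
  [NormedAddCommGroup E2] [InnerProductSpace ℂ E2] {μ : ℝ} {f : E1 × E2 → E1 × E2}

/-- the exponential weight -/
noncomputable def fbhW (μ : ℝ) (d z : E1) : ℂ := Complex.exp (μ * inner ℂ d z - μ * ‖d‖ ^ 2 / 2)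

theorem fbhW_continuous (d : E1) : Continuous (fbhW μ d) := by
  unfold fbhW; fun_prop

theorem fbhH_eq (u : E2) (d : E1) (p : E1 × E2) : fbhH μ u d p = fbhH μ u 0 p * fbhW μ d p.1 := by
  simp [fbhH, fbhW]

theorem fbhW_self (z : E1) : ‖fbhW μ z z‖ = Real.exp (μ * ‖z‖ ^ 2 / 2) := by
  unfold fbhW
  rw [Complex.norm_exp, inner_self_eq_norm_sq_to_K]
  congr 1
  have : ((μ : ℂ) * ((‖z‖ : ℝ) : ℂ) ^ 2 - μ * ((‖z‖ : ℝ) : ℂ) ^ 2 / 2) = ((μ * ‖z‖ ^ 2 / 2 : ℝ) : ℂ) := by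
    push_cast; ring
  erw [this, Complex.ofReal_re]

theorem fbhW_ne (d z : E1) : fbhW μ d z ≠ 0 := Complex.exp_ne_zero _

theorem FbhProper.tendsto_slice (h : FbhProper μ f) (z : E1) (w : E2) :
    Tendsto (fun c : ℂ => f (z, c • w)) (𝓝[≠] 0) (𝓝 (f (z, 0))) := by
  have h1 : ContinuousAt f (z, 0) :=
    h.diff.continuousOn.continuousAt (fbhD_isOpen.mem_nhds (fbhD_mem_zero z))
  have h2 : Tendsto (fun c : ℂ => (z, c • w)) (𝓝[≠] 0) (𝓝 (z, 0)) := by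
    have : Continuous fun c : ℂ => (z, c • w) := by fun_prop
    simpa using (this.tendsto 0).mono_left nhdsWithin_le_nhds
  exact h1.tendsto.comp h2

theorem FbhProper.exists_p (h : FbhProper μ f) {k : ℕ}
    (hk : ∀ x ∈ fbhD E1 E2 μ, fbhS μ (f x) ≤ fbhS μ x ^ k)
    (hk1 : ¬ ∀ x ∈ fbhD E1 E2 μ, fbhS μ (f x) ≤ fbhS μ x ^ (k + 1)) :
    ∃ (w0 : E2) (p : E1 → ℂ) (z0 : E1), p z0 ≠ 0 ∧ (∀ z v, Differentiable ℂ fun t : ℂ => p (z + t • v)) ∧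
      ∀ z, ‖p z‖ * Real.exp (μ * ‖(f (z, 0)).1‖ ^ 2 / 2) ≤ fbhS μ (z, w0) ^ k := by
  push Not at hk1
  obtain ⟨x, hx, hlt⟩ := hk1
  obtain ⟨u, hu, hatt⟩ := fbhH_attain (μ := μ) (f x)
  have hd : ∀ d, DifferentiableOn ℂ (fun p => fbhH μ u d (f p)) (fbhD E1 E2 μ) := fun d =>
    (fbhH_diff u d).comp_differentiableOn h.diff
  have hb : ∀ d, ∀ p ∈ fbhD E1 E2 μ, ‖fbhH μ u d (f p)‖ ≤ 1 * fbhS μ p ^ k := fun d p hp => by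
    rw [one_mul]; exact (fbhH_le h.mu hu d _).trans (hk p hp)
  choose q hq1 hq2 hq3 using fun d => fbh_lemV (hd d) zero_le_one (hb d)
  have hrel : ∀ d z w, q d z w = q 0 z w * fbhW μ d (f (z, 0)).1 := by
    intro d z w
    refine tendsto_nhds_unique (hq1 d z w) ?_
    have h2 : Tendsto (fun c : ℂ => fbhW μ d (f (z, c • w)).1) (𝓝[≠] 0) (𝓝 (fbhW μ d (f (z, 0)).1)) :=
      ((fbhW_continuous d).comp continuous_fst).continuousAt.tendsto.comp (h.tendsto_slice z w)
    refine ((hq1 0 z w).mul h2).congr fun c => ?_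
    rw [fbhH_eq u d]; ring
  have hex : ∃ z0 w0, q 0 z0 w0 ≠ 0 := by
    by_contra hcon
    push Not at hcon
    have := fbh_lemV_zero (hd (f x).1) zero_le_one (hb (f x).1) (fun z w => by
      have h3 := hq1 (f x).1 z w
      rwa [hrel, hcon, zero_mul] at h3) x hx
    rw [hatt, one_mul] at this
    exact absurd this (not_le.2 hlt)
  obtain ⟨z0, w0, h0⟩ := hex
  refine ⟨w0, fun z => q 0 z w0, z0, h0, fun z v => hq3 0 z v w0, fun z => ?_⟩
  have h4 := hq2 (f (z, 0)).1 z w0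
  rw [hrel, norm_mul, fbhW_self, one_mul] at h4
  exact h4
end proper

end partG5

section partH1

open Set Filter Topology Metric ComplexConjugate Asymptotics

section jensen
theorem fbh_jensen {p : ℂ → ℂ} (hp : Differentiable ℂ p) (h0 : p 0 ≠ 0) {G : ℂ → ℝ} (hG : Continuous G)
    (hb : ∀ t, ‖p t‖ ≤ Real.exp (G t)) {R : ℝ} (hR : 0 < R) :
    Real.log ‖p 0‖ ≤ Real.circleAverage G 0 R := by
  have han : AnalyticOnNhd ℂ p univ := fun x _ => hp.analyticAt x
  have hcod : (fun x => Real.log ‖p x‖) =ᶠ[codiscreteWithin (sphere 0 |R|)]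
      fun x => min (Real.log ‖p x‖) (G x) := by
    have h1 := han.preimage_zero_mem_codiscreteWithin h0 (mem_univ _) isConnected_univ
    have h2 := codiscreteWithin_mono (subset_univ (sphere (0 : ℂ) |R|)) h1
    filter_upwards [h2] with x hx
    have hx : p x ≠ 0 := by simpa using hx
    rw [min_eq_left]
    rw [Real.log_le_iff_le_exp (norm_pos_iff.2 hx)]
    exact hb x
  have hIntg : CircleIntegrable (fun x => Real.log ‖p x‖) 0 R :=
    MeromorphicOn.circleIntegrable_log_norm fun x _ => (han x (mem_univ x)).meromorphicAt
  have h3 : Real.circleAverage (fun x => Real.log ‖p x‖) 0 R ≤ Real.circleAverage G 0 R := by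
    rw [Real.circleAverage_congr_codiscreteWithin hcod hR.ne']
    refine Real.circleAverage_mono (hIntg.congr_codiscreteWithin hcod) ?_ fun x _ => min_le_right _ _
    exact hG.continuousOn.circleIntegrable'
  have hcb : AnalyticOnNhd ℂ p (closedBall 0 |R|) := han.mono (subset_univ _)
  have h4 := hcb.circleAverage_log_norm hR.ne' h0
  have h5 : 0 ≤ ∑ᶠ u, (MeromorphicOn.divisor p (closedBall 0 |R|) u : ℝ) * Real.log (R * ‖0 - u‖⁻¹) := by
    refine finsum_nonneg fun u => ?_
    by_cases hu : u ∈ closedBall (0 : ℂ) |R|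
    · by_cases hu0 : u = 0
      · simp [hu0]
      refine mul_nonneg (mod_cast MeromorphicOn.AnalyticOnNhd.divisor_nonneg hcb _) (Real.log_nonneg ?_)
      have hun : 0 < ‖u‖ := norm_pos_iff.2 hu0
      rw [mem_closedBall, dist_zero_right, abs_of_pos hR] at hu
      rw [zero_sub, norm_neg, ← div_eq_mul_inv, le_div_iff₀ hun]
      linarith
    · simp [hu]
  linarith

theorem fbh_cauchy_avg {F : Type*} [NormedAddCommGroup F] [NormedSpace ℂ F] [CompleteSpace F]
    {g : ℂ → F} (hg : Differentiable ℂ g) {R : ℝ} (hR : 0 < R) :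
    ‖deriv g 0‖ ≤ Real.circleAverage (fun x => ‖g x‖) 0 R / R := by
  have h1 : deriv g 0 = Real.circleAverage (fun x => x⁻¹ • g x) 0 R := by
    have h2 := hg.diffContOnCl (s := ball (0 : ℂ) R)
    have h3 := h2.deriv_eq_smul_circleIntegral hR
    rw [Real.circleAverage_eq_circleIntegral hR.ne']
    have h4 : (∮ z in C(0, R), (z - 0)⁻¹ • z⁻¹ • g z) = ∮ z in C(0, R), (1 / (z - 0) ^ 2) • g z := by
      congr 1; ext z; rw [smul_smul]; congr 1; simp; ring
    rw [h4, h3, smul_smul, inv_mul_cancel₀, one_smul]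
    simp [Real.pi_ne_zero]
  rw [h1, Real.circleAverage_def, Real.circleAverage_def, norm_smul, smul_eq_mul, mul_div_assoc]
  rw [Real.norm_of_nonneg (by positivity)]
  gcongr
  refine (intervalIntegral.norm_integral_le_integral_norm (by positivity)).trans (le_of_eq ?_)
  rw [← intervalIntegral.integral_div]
  congr 1
  ext θ
  simp [norm_smul, abs_of_pos hR]
  ring

theorem fbh_deriv_bound {F : Type*} [NormedAddCommGroup F] [NormedSpace ℂ F] [CompleteSpace F]
    {g : ℂ → F} (hg : Differentiable ℂ g) {p : ℂ → ℂ} (hp : Differentiable ℂ p) (h0 : p 0 ≠ 0)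
    {μ C k A B : ℝ} (hμ : 0 < μ) (hC : 0 < C)
    (hb : ∀ t, ‖p t‖ * Real.exp (μ * ‖g t‖ ^ 2 / 2) ≤ C * Real.exp (k * μ * (A + B * ‖t‖) ^ 2 / 2)) :
    ‖deriv g 0‖ ^ 2 ≤ k * B ^ 2 := by
  set a := ‖deriv g 0‖ with ha
  set C' := 2 / μ * (Real.log C - Real.log ‖p 0‖) with hC'
  have hgc : Continuous g := hg.continuous
  have key : ∀ R : ℝ, 0 < R → a ^ 2 ≤ k * (A / R + B) ^ 2 + C' / R ^ 2 := by
    intro R hR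
    have hci2 : CircleIntegrable (fun x => ‖g x‖ ^ 2) 0 R :=
      (by fun_prop : Continuous fun x => ‖g x‖ ^ 2).continuousOn.circleIntegrable'
    have hci1 : CircleIntegrable (fun x => ‖g x‖) 0 R :=
      (by fun_prop : Continuous fun x => ‖g x‖).continuousOn.circleIntegrable'
    have hcc : ∀ c : ℝ, CircleIntegrable (fun _ => c) 0 R := fun c => circleIntegrable_const c 0 R
    have h1 := fbh_jensen hp h0 (G := fun t => (Real.log C + k * μ * (A + B * ‖t‖) ^ 2 / 2)
      - μ * ‖g t‖ ^ 2 / 2) (by fun_prop) (fun t => by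
        rw [Real.exp_sub, Real.exp_add, Real.exp_log hC, le_div_iff₀ (Real.exp_pos _)]
        exact hb t) hR
    have h2 : Real.circleAverage (fun t => (Real.log C + k * μ * (A + B * ‖t‖) ^ 2 / 2)
      - μ * ‖g t‖ ^ 2 / 2) 0 R = Real.log C + k * μ * (A + B * R) ^ 2 / 2 -
        μ / 2 * Real.circleAverage (fun x => ‖g x‖ ^ 2) 0 R := by
      rw [← smul_eq_mul (μ / 2), ← Real.circleAverage_fun_smul,
        ← Real.circleAverage_const (Real.log C + k * μ * (A + B * R) ^ 2 / 2) 0 R,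
        ← Real.circleAverage_fun_sub (hcc _)]
      · refine Real.circleAverage_congr_sphere fun x hx => ?_
        have : ‖x‖ = R := by simpa [abs_of_pos hR] using hx
        simp [this]; ring
      · exact (by fun_prop : Continuous fun x => (μ / 2) • ‖g x‖ ^ 2).continuousOn.circleIntegrable'
    rw [h2] at h1
    set I2 := Real.circleAverage (fun x => ‖g x‖ ^ 2) 0 R with hI2
    have h3 : I2 ≤ k * (A + B * R) ^ 2 + C' := by
      have : μ / 2 * I2 ≤ μ / 2 * (k * (A + B * R) ^ 2 + C') := by
        have : μ / 2 * C' = Real.log C - Real.log ‖p 0‖ := by rw [hC']; field_simp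
        rw [mul_add, this]; linarith
      exact le_of_mul_le_mul_left this (by positivity)
    have h4 : a ^ 2 ≤ I2 / R ^ 2 := by
      rcases (norm_nonneg (deriv g 0)).eq_or_lt with h | h
      · rw [ha, ← h]
        have : 0 ≤ I2 := Real.circleAverage_nonneg_of_nonneg fun x _ => by positivity
        simp only [ne_eq, OfNat.ofNat_ne_zero, not_false_eq_true, zero_pow]
        positivity
      · have h5 := fbh_cauchy_avg hg hR
        rw [← ha, le_div_iff₀ hR] at h5
        rw [← ha] at h
        have h6 : Real.circleAverage (fun x => ‖g x‖) 0 R ≤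
            Real.circleAverage (fun x => (a * R / 2) + (1 / (2 * a * R)) • ‖g x‖ ^ 2) 0 R := by
          refine Real.circleAverage_mono hci1 ?_ fun x _ => ?_
          · exact (by fun_prop : Continuous fun x => (a * R / 2) + (1 / (2 * a * R)) • ‖g x‖ ^ 2).continuousOn.circleIntegrable'
          · have : (a * R / 2) + (1 / (2 * a * R)) • ‖g x‖ ^ 2 - ‖g x‖ =
              (‖g x‖ - a * R) ^ 2 / (2 * a * R) := by rw [smul_eq_mul]; field_simp; ring
            have h7 : 0 ≤ (‖g x‖ - a * R) ^ 2 / (2 * a * R) := by positivity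
            linarith
        rw [Real.circleAverage_fun_add (hcc _), Real.circleAverage_const, Real.circleAverage_fun_smul, ← hI2, smul_eq_mul] at h6
        · have h8 : a * R / 2 ≤ 1 / (2 * a * R) * I2 := by linarith
          rw [div_mul_eq_mul_div, one_mul, le_div_iff₀ (by positivity)] at h8
          rw [le_div_iff₀ (by positivity)]
          nlinarith
        · exact (by fun_prop : Continuous fun x => (1 / (2 * a * R)) • ‖g x‖ ^ 2).continuousOn.circleIntegrable'
    refine h4.trans ?_
    rw [div_le_iff₀ (by positivity)]
    refine h3.trans (le_of_eq ?_)
    field_simp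
  have hlim : Tendsto (fun R : ℝ => k * (A / R + B) ^ 2 + C' / R ^ 2) atTop (𝓝 (k * (0 + B) ^ 2 + 0)) := by
    refine Tendsto.add (Tendsto.const_mul _ (Tendsto.pow (Tendsto.add ?_ tendsto_const_nhds) _)) ?_
    · exact tendsto_const_nhds.div_atTop tendsto_id
    · exact tendsto_const_nhds.div_atTop (tendsto_pow_atTop (by norm_num))
  have := ge_of_tendsto hlim (by filter_upwards [eventually_gt_atTop 0] with R hR using key R hR)
  simpa using this
end jensen

end partH1

section partH2

open Set Filter Topology Metric ComplexConjugate Asymptotics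

section affine
variable {E1 E2 : Type*} [NormedAddCommGroup E1] [InnerProductSpace ℂ E1]
  [NormedAddCommGroup E2] [InnerProductSpace ℂ E2] {μ : ℝ} {f : E1 × E2 → E1 × E2}

theorem fbh_frequently_ne {p : ℂ → ℂ} (hp : Differentiable ℂ p) {t0 : ℂ} (h0 : p t0 ≠ 0) :
    ∀ᶠ t in 𝓝[≠] 0, p t ≠ 0 := by
  rcases (hp.analyticAt 0).eventually_eq_zero_or_eventually_ne_zero with h | h
  · exfalso
    have han : AnalyticOnNhd ℂ p univ := fun x _ => hp.analyticAt x
    have := han.eq_of_eventuallyEq (g := fun _ => 0) (fun x _ => analyticAt_const) h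
    exact h0 (congrFun this t0)
  · exact h

theorem FbhProper.affine [FiniteDimensional ℂ E1] [FiniteDimensional ℂ E2] [Nontrivial E1] [Nontrivial E2]
    (h : FbhProper μ f) {k : ℕ}
    (hk : ∀ x ∈ fbhD E1 E2 μ, fbhS μ (f x) ≤ fbhS μ x ^ k)
    (hk1 : ¬ ∀ x ∈ fbhD E1 E2 μ, fbhS μ (f x) ≤ fbhS μ x ^ (k + 1)) :
    ∃ (B : E1 ≃ₗ[ℂ] E1) (b : E1), (∀ z, f (z, 0) = (B z + b, 0)) ∧ ∀ v, ‖B v‖ ^ 2 ≤ k * ‖v‖ ^ 2 := by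
  have : CompleteSpace E1 := FiniteDimensional.complete ℂ E1
  obtain ⟨w0, p, z0, hp0, hpd, hpb⟩ := h.exists_p hk hk1
  set φ : E1 → E1 := fun z => (f (z, 0)).1 with hφ
  have hφd : Differentiable ℂ φ := h.diff_base.fst
  have hd1 : ∀ z v, p z ≠ 0 → ‖fderiv ℂ φ z v‖ ^ 2 ≤ k * ‖v‖ ^ 2 := by
    intro z v hz
    have hg : Differentiable ℂ fun t : ℂ => φ (z + t • v) := hφd.comp (by fun_prop)
    have hder : deriv (fun t : ℂ => φ (z + t • v)) 0 = fderiv ℂ φ z v := by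
      have h1 : HasDerivAt (fun t : ℂ => z + t • v) v 0 := by
        simpa using ((hasDerivAt_id (0 : ℂ)).smul_const v).const_add z
      have h2 : HasFDerivAt φ (fderiv ℂ φ z) (z + (0 : ℂ) • v) := by
        simpa using (hφd z).hasFDerivAt
      exact (h2.comp_hasDerivAt (0 : ℂ) h1).deriv
    rw [← hder]
    refine fbh_deriv_bound hg (hpd z v) (by simpa using hz) h.mu (C := ‖w0‖ ^ k + 1) (A := ‖z‖)
      (by positivity) fun t => ?_
    refine (hpb (z + t • v)).trans ?_
    unfold fbhS
    rw [mul_pow, ← Real.exp_nat_mul]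
    have h3 : ‖z + t • v‖ ≤ ‖z‖ + ‖v‖ * ‖t‖ := by
      refine (norm_add_le _ _).trans ?_
      rw [norm_smul, mul_comm]
    have := h.mu
    have h4 : (k : ℝ) * (μ * ‖z + t • v‖ ^ 2 / 2) ≤ k * μ * (‖z‖ + ‖v‖ * ‖t‖) ^ 2 / 2 := by
      have : (k : ℝ) * μ / 2 * ‖z + t • v‖ ^ 2 ≤ k * μ / 2 * (‖z‖ + ‖v‖ * ‖t‖) ^ 2 := by gcongr
      linarith
    gcongr
    · linarith
  have hdd : ∀ v, Differentiable ℂ fun z => fderiv ℂ φ z v := fun v =>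
    differentiableOn_univ.1 (fbh_diff_dir isOpen_univ hφd.differentiableOn v)
  have hd2 : ∀ z v, ‖fderiv ℂ φ z v‖ ^ 2 ≤ k * ‖v‖ ^ 2 := by
    intro z v
    have h1 := fbh_frequently_ne (hpd z (z0 - z)) (t0 := 1) (by simpa using hp0)
    have h2 : Continuous fun t : ℂ => ‖fderiv ℂ φ (z + t • (z0 - z)) v‖ ^ 2 := by
      have := (hdd v).continuous
      fun_prop
    have h3 := (h2.tendsto 0).mono_left (nhdsWithin_le_nhds (s := {0}ᶜ))
    have h4 := le_of_tendsto h3 (h1.mono fun t ht => hd1 _ v ht)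
    simpa using h4
  have hconst : ∀ z v, fderiv ℂ φ z v = fderiv ℂ φ 0 v := by
    intro z v
    refine (hdd v).apply_eq_apply_of_bounded ?_ z 0
    rw [isBounded_iff_forall_norm_le]
    refine ⟨Real.sqrt (k * ‖v‖ ^ 2), ?_⟩
    rintro _ ⟨y, rfl⟩
    exact Real.le_sqrt_of_sq_le (hd2 y v)
  set B := fderiv ℂ φ 0 with hB
  have haff : ∀ z, φ z = B z + φ 0 := by
    intro z
    have h1 : Differentiable ℂ fun z => φ z - B z := hφd.sub B.differentiable
    have h2 := is_const_of_fderiv_eq_zero h1 (fun x => by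
      rw [fderiv_fun_sub (hφd x) B.differentiableAt, B.fderiv]
      ext v
      simp [hconst x v, hB]) z 0
    simp only [map_zero, sub_zero] at h2
    rw [← h2]; abel
  have hf0 : ∀ z, f (z, 0) = (B z + φ 0, 0) := fun z => Prod.ext (haff z) (h.base_snd z)
  have hinj : Function.Injective (B : E1 →ₗ[ℂ] E1) := by
    rw [← LinearMap.ker_eq_bot, LinearMap.ker_eq_bot']
    intro v hv
    have hv : B v = 0 := hv
    exact h.line_const (z := 0) (v := v) (p0 := (φ 0, 0)) fun t => by simp [hf0, hv]
  refine ⟨LinearEquiv.ofInjectiveEndo (B : E1 →ₗ[ℂ] E1) hinj, φ 0, fun z => ?_, fun v => ?_⟩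
  · rw [hf0]; rfl
  · exact hd2 0 v

end affine

end partH2

section partH3

open Set Filter Topology Metric ComplexConjugate Asymptotics

section powersums

theorem fbh_recur {N : ℕ} (u : Fin N → ℂ) (hu : ∀ i, ‖u i‖ = 1) (m : ℕ) :
    ∃ j, m ≤ j ∧ ∀ i, 1 / 2 ≤ (u i ^ j).re := by
  have hc : IsCompact (Set.pi univ fun _ : Fin N => closedBall (0 : ℂ) 1) :=
    isCompact_univ_pi fun _ => isCompact_closedBall _ _
  obtain ⟨a, -, φ, hφ, hlim⟩ := hc.tendsto_subseq (x := fun n i => u i ^ n) (fun n i _ => by simp [hu])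
  have hcau := hlim.cauchySeq
  rw [Metric.cauchySeq_iff'] at hcau
  obtain ⟨n0, hn0⟩ := hcau (1 / 2) (by norm_num)
  have hge : φ n0 + m ≤ φ (n0 + m) := by
    clear hn0
    induction m with
    | zero => simp
    | succ m ih =>
      have := hφ (show n0 + m < n0 + (m + 1) by omega)
      omega
  refine ⟨φ (n0 + m) - φ n0, by omega, fun i => ?_⟩
  have h1 := hn0 (n0 + m) (by omega)
  have h2 := (dist_le_pi_dist _ _ i).trans_lt h1
  simp only [Function.comp] at h2
  have h3 : u i ^ φ (n0 + m) = u i ^ (φ (n0 + m) - φ n0) * u i ^ φ n0 := by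
    rw [← pow_add]; congr 1; omega
  rw [h3, dist_eq_norm] at h2
  have h4 : u i ^ (φ (n0 + m) - φ n0) * u i ^ φ n0 - u i ^ φ n0 =
    (u i ^ (φ (n0 + m) - φ n0) - 1) * u i ^ φ n0 := by ring
  rw [h4, norm_mul, norm_pow, hu, one_pow, mul_one] at h2
  have h5 := (Complex.abs_re_le_norm _).trans h2.le
  rw [Complex.sub_re, Complex.one_re, abs_le] at h5
  linarith [h5.1]

theorem fbh_Pinf {N : ℕ} (a : Fin N → ℂ) {M K : ℝ} (hK : 0 ≤ K)
    (h : ∀ j : ℕ, 1 ≤ j → ‖∑ i, a i ^ j‖ ≤ M * K ^ j) (i : Fin N) : ‖a i‖ ≤ K := by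
  by_contra hlt
  push Not at hlt
  have ha0 : 0 < ‖a i‖ := hK.trans_lt hlt
  -- polar form
  let u : Fin N → ℂ := fun i => Complex.exp (Complex.arg (a i) * Complex.I)
  have hu : ∀ i, ‖u i‖ = 1 := fun i => Complex.norm_exp_ofReal_mul_I _
  have hau : ∀ i, a i = ‖a i‖ * u i := fun i => (Complex.norm_mul_exp_arg_mul_I (a i)).symm
  have h1 : Tendsto (fun j : ℕ => 2 * M * (K / ‖a i‖) ^ j) atTop (𝓝 (2 * M * 0)) :=
    (tendsto_pow_atTop_nhds_zero_of_lt_one (by positivity) ((div_lt_one ha0).2 hlt)).const_mul _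
  rw [mul_zero] at h1
  obtain ⟨m, hm⟩ := eventually_atTop.1 (h1.eventually (gt_mem_nhds one_pos))
  obtain ⟨j, hj, hre⟩ := fbh_recur u hu (m + 1)
  have h2 := hm j (by omega)
  have h3 := h j (by omega)
  have h4 : ∀ l, (a l ^ j).re = ‖a l‖ ^ j * (u l ^ j).re := by
    intro l
    conv_lhs => rw [hau l, mul_pow, ← Complex.ofReal_pow, Complex.re_ofReal_mul]
  have h5 : ‖a i‖ ^ j * (1 / 2) ≤ (∑ l, a l ^ j).re := by
    rw [Complex.re_sum]
    refine le_trans ?_ (Finset.single_le_sum (f := fun l => (a l ^ j).re) (fun l _ => ?_) (Finset.mem_univ i))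
    · simp only [h4]
      have := hre i
      gcongr
    · rw [h4]
      have := hre l
      have : 0 ≤ (u l ^ j).re := by linarith
      positivity
  have h6 := (Complex.re_le_norm _).trans h3
  rw [div_pow, mul_div_assoc', div_lt_one (by positivity)] at h2
  linarith

theorem fbh_psum_zero {N : ℕ} (a : Fin N → ℂ)
    (h : ∀ j : ℕ, 1 ≤ j → j ≤ N → ∑ i, a i ^ j = 0) : a = 0 := by
  classical
  by_contra hne
  obtain ⟨i0, hi0⟩ := Function.ne_iff.1 hne
  have hi0 : a i0 ≠ 0 := hi0
  set s : Finset ℂ := (Finset.univ.image a).erase (a i0) with hs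
  set Q : Polynomial ℂ := Polynomial.X * ∏ v ∈ s, (Polynomial.X - Polynomial.C v) with hQ
  have hscard : s.card + 1 ≤ N := by
    have h1 : a i0 ∈ Finset.univ.image a := Finset.mem_image_of_mem _ (Finset.mem_univ _)
    have h2 := Finset.card_erase_add_one h1
    have h3 : (Finset.univ.image a).card ≤ N := by
      simpa using Finset.card_image_le (s := (Finset.univ : Finset (Fin N))) (f := a)
    rw [hs]; omega
  have hdeg : Q.natDegree ≤ N := by
    refine (Polynomial.natDegree_mul_le).trans ?_
    rw [Polynomial.natDegree_X, Polynomial.natDegree_prod_of_monic _ _ (fun v _ => Polynomial.monic_X_sub_C v)]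
    simp
    omega
  have hsum : ∑ i, Q.eval (a i) = 0 := by
    simp only [Polynomial.eval_eq_sum_range]
    rw [Finset.sum_comm]
    refine Finset.sum_eq_zero fun j hj => ?_
    rw [← Finset.mul_sum]
    rcases Nat.eq_zero_or_pos j with rfl | hj0
    · have : Q.coeff 0 = 0 := by simp [hQ]
      simp [this]
    · rw [h j hj0 (by rw [Finset.mem_range] at hj; omega), mul_zero]
  have hval : ∀ i, Q.eval (a i) = if a i = a i0 then Q.eval (a i0) else 0 := by
    intro i
    split_ifs with hi
    · rw [hi]
    · rw [hQ, Polynomial.eval_mul, Polynomial.eval_prod]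
      rw [Finset.prod_eq_zero (i := a i)]
      · simp
      · simp [hs, hi]
      · simp
  rw [Finset.sum_congr rfl fun i _ => hval i] at hsum
  rw [← Finset.sum_filter, Finset.sum_const, nsmul_eq_mul] at hsum
  have h7 : Q.eval (a i0) ≠ 0 := by
    rw [hQ, Polynomial.eval_mul, Polynomial.eval_prod]
    refine mul_ne_zero (by simpa using hi0) ?_
    rw [Finset.prod_ne_zero_iff]
    intro v hv
    have : v ≠ a i0 := Finset.ne_of_mem_erase hv
    simpa [sub_eq_zero] using this.symm
  rcases mul_eq_zero.1 hsum with h8 | h8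
  · have : (Finset.univ.filter fun i => a i = a i0).card = 0 := by exact_mod_cast h8
    rw [Finset.card_eq_zero] at this
    have h9 : i0 ∈ Finset.univ.filter fun i => a i = a i0 := by simp
    rw [this] at h9
    simp at h9
  · exact h7 h8

theorem fbh_PN (N : ℕ) : ∃ C : ℝ, 0 ≤ C ∧ ∀ (a : Fin N → ℂ) (r : ℝ), 0 ≤ r →
    (∀ j : ℕ, 1 ≤ j → j ≤ N → ‖∑ i, a i ^ j‖ ≤ r ^ j) → ∀ i, ‖a i‖ ≤ C * r := by
  classical
  set Φ : (Fin N → ℂ) → ℝ := fun a => ∑ j ∈ Finset.Icc 1 N, ‖∑ i, a i ^ j‖ with hΦ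
  have hΦc : Continuous Φ := by rw [hΦ]; fun_prop
  have hpos : ∀ a : Fin N → ℂ, ‖a‖ = 1 → 0 < Φ a := by
    intro a ha
    refine lt_of_le_of_ne (Finset.sum_nonneg fun _ _ => norm_nonneg _) fun h0 => ?_
    have h1 := (Finset.sum_eq_zero_iff_of_nonneg (fun _ _ => norm_nonneg _)).1 h0.symm
    have h2 := fbh_psum_zero a fun j hj1 hj2 => by
      simpa using h1 j (Finset.mem_Icc.2 ⟨hj1, hj2⟩)
    rw [h2] at ha
    simp at ha
  obtain ⟨δ, hδ, hδb⟩ : ∃ δ : ℝ, 0 < δ ∧ ∀ a : Fin N → ℂ, ‖a‖ = 1 → δ ≤ Φ a := by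
    rcases (sphere (0 : Fin N → ℂ) 1).eq_empty_or_nonempty with he | hn
    · refine ⟨1, one_pos, fun a ha => ?_⟩
      have : a ∈ sphere (0 : Fin N → ℂ) 1 := by simpa using ha
      rw [he] at this
      exact absurd this (notMem_empty _)
    · obtain ⟨a0, ha0, hmin⟩ := (isCompact_sphere (0 : Fin N → ℂ) 1).exists_isMinOn hn hΦc.continuousOn
      exact ⟨Φ a0, hpos a0 (by simpa using ha0), fun a ha => hmin (by simpa using ha)⟩
  refine ⟨max 1 (N / δ), by positivity, fun a r hr hj i => ?_⟩
  refine (norm_le_pi_norm a i).trans ?_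
  rcases (norm_nonneg a).eq_or_lt with h0 | h0
  · rw [← h0]; positivity
  by_contra hlt
  push Not at hlt
  have hrlt : r < ‖a‖ := by
    refine lt_of_le_of_lt ?_ hlt
    exact le_mul_of_one_le_left hr (le_max_left _ _)
  have h1 := hδb (((‖a‖⁻¹ : ℝ) : ℂ) • a) (by rw [norm_smul]; simp [h0.ne'])
  have h2 : Φ (((‖a‖⁻¹ : ℝ) : ℂ) • a) ≤ ∑ j ∈ Finset.Icc 1 N, (r / ‖a‖) := by
    refine Finset.sum_le_sum fun j hj' => ?_
    rw [Finset.mem_Icc] at hj'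
    have h3 : ∑ i, (((‖a‖⁻¹ : ℝ) : ℂ) • a) i ^ j = ((‖a‖⁻¹ : ℝ) : ℂ) ^ j * ∑ i, a i ^ j := by
      rw [Finset.mul_sum]
      refine Finset.sum_congr rfl fun l _ => ?_
      rw [Pi.smul_apply, smul_eq_mul, mul_pow]
    rw [h3, norm_mul, norm_pow, Complex.norm_real, Real.norm_of_nonneg (by positivity)]
    calc ‖a‖⁻¹ ^ j * ‖∑ i, a i ^ j‖ ≤ ‖a‖⁻¹ ^ j * r ^ j := by
          gcongr; exact hj j hj'.1 hj'.2
      _ = (r / ‖a‖) ^ j := by rw [← mul_pow]; congr 1; field_simp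
      _ ≤ r / ‖a‖ := pow_le_of_le_one (by positivity) ((div_le_one h0).2 hrlt.le) (by omega)
  rw [Finset.sum_const, Nat.card_Icc, Nat.add_sub_cancel, nsmul_eq_mul] at h2
  have h4 : N / δ * r < ‖a‖ := lt_of_le_of_lt (by gcongr; exact le_max_right _ _) hlt
  have h5 := h1.trans h2
  rw [mul_div_assoc', le_div_iff₀ h0] at h5
  rw [div_mul_eq_mul_div, div_lt_iff₀ hδ] at h4
  linarith
end powersums

end partH3

section partH4

open Set Filter Topology Metric ComplexConjugate Asymptotics

section tuple
variable {E1 E2 : Type*} [NormedAddCommGroup E1] [InnerProductSpace ℂ E1]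
  [NormedAddCommGroup E2] [InnerProductSpace ℂ E2] {μ : ℝ} {f : E1 × E2 → E1 × E2}

structure FbhTuple (μ : ℝ) (f : E1 × E2 → E1 × E2) (N : ℕ) (P : (E1 × E2 → ℂ) → E1 × E2 → ℂ) : Prop where
  surj : fbhD E1 E2 μ ⊆ f '' fbhD E1 E2 μ
  diff : ∀ h, DifferentiableOn ℂ h (fbhD E1 E2 μ) → DifferentiableOn ℂ (P h) (fbhD E1 E2 μ)
  tup : ∀ x0 ∈ fbhD E1 E2 μ, ∃ X : Fin N → E1 × E2, (∀ i, X i ∈ fbhD E1 E2 μ) ∧ (∀ i, f (X i) = f x0) ∧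
    (∃ i, X i = x0) ∧ ∀ h, DifferentiableOn ℂ h (fbhD E1 E2 μ) → P h (f x0) = ∑ i, h (X i)

theorem FbhProper.exists_tuple [FiniteDimensional ℂ E1] [FiniteDimensional ℂ E2] (h : FbhProper μ f) :
    ∃ N P, FbhTuple μ f N P := by
  obtain ⟨h1, N, P, h2, h3⟩ := fbh_tuple_gen fbhD_isOpen (fbhD_preconnected h.mu) ⟨0, fbhD_zero_mem⟩
    h.diff h.maps h.proper
  exact ⟨N, P, h1, h2, h3⟩

variable {N : ℕ} {P : (E1 × E2 → ℂ) → E1 × E2 → ℂ}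

theorem fbhH_pow_diff (u : E2) (d : E1) (j : ℕ) (V : Set (E1 × E2)) :
    DifferentiableOn ℂ (fun p => fbhH μ u d p ^ j) V :=
  ((fbhH_diff u d).pow j).differentiableOn

theorem FbhTuple.bound (T : FbhTuple μ f N P) {g : E1 × E2 → ℂ} (hg : DifferentiableOn ℂ g (fbhD E1 E2 μ))
    {y : E1 × E2} (hy : y ∈ fbhD E1 E2 μ) {M : ℝ} (hM : ∀ x ∈ fbhD E1 E2 μ, f x = y → ‖g x‖ ≤ M) :
    ‖P g y‖ ≤ N * M := by
  obtain ⟨x0, hx0, rfl⟩ := T.surj hy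
  obtain ⟨X, hX1, hX2, -, hX3⟩ := T.tup x0 hx0
  rw [hX3 g hg]
  refine (norm_sum_le _ _).trans ?_
  refine (Finset.sum_le_sum fun i _ => hM _ (hX1 i) (hX2 i)).trans ?_
  simp

theorem FbhTuple.Pinf (T : FbhTuple μ f N P) {u : E2} {d : E1} {x : E1 × E2} (hx : x ∈ fbhD E1 E2 μ)
    {M K : ℝ} (hK : 0 ≤ K)
    (h : ∀ j : ℕ, 1 ≤ j → ‖P (fun p => fbhH μ u d p ^ j) (f x)‖ ≤ M * K ^ j) : ‖fbhH μ u d x‖ ≤ K := by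
  obtain ⟨X, -, -, ⟨i, hi⟩, hX3⟩ := T.tup x hx
  have := fbh_Pinf (fun i => fbhH μ u d (X i)) hK (M := M) (fun j hj => by
    have := h j hj
    rwa [hX3 _ (fbhH_pow_diff u d j _)] at this) i
  simpa [hi] using this

theorem FbhTuple.T_le (h : FbhProper μ f) (T : FbhTuple μ f N P) {u : E2} (hu : ‖u‖ ≤ 1) (d : E1) (j : ℕ)
    {y : E1 × E2} (hy : y ∈ fbhD E1 E2 μ) : ‖P (fun p => fbhH μ u d p ^ j) y‖ ≤ N := by
  have := T.bound (fbhH_pow_diff u d j _) hy (M := 1) (fun x hx _ => by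
    rw [norm_pow]
    exact pow_le_one₀ (norm_nonneg _) ((fbhH_le h.mu hu d x).trans (fbhD_iff.1 hx).le))
  simpa using this

theorem FbhTuple.T_const (h : FbhProper μ f) (T : FbhTuple μ f N P) {u : E2} (hu : ‖u‖ ≤ 1) (d : E1) (j : ℕ)
    (c c' : E1) : P (fun p => fbhH μ u d p ^ j) (c, 0) = P (fun p => fbhH μ u d p ^ j) (c', 0) := by
  have hd : Differentiable ℂ fun c : E1 => P (fun p => fbhH μ u d p ^ j) (c, 0) := by
    rw [← differentiableOn_univ]
    exact (T.diff _ (fbhH_pow_diff u d j _)).comp (by fun_prop) fun c _ => fbhD_mem_zero c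
  refine hd.apply_eq_apply_of_bounded ?_ c c'
  rw [isBounded_iff_forall_norm_le]
  refine ⟨N, ?_⟩
  rintro _ ⟨y, rfl⟩
  exact T.T_le h hu d j (fbhD_mem_zero y)

theorem FbhTuple.zero_fibre [FiniteDimensional ℂ E1] [FiniteDimensional ℂ E2] [Nontrivial E1]
    (h : FbhProper μ f) (T : FbhTuple μ f N P) {x : E1 × E2} (hx : x ∈ fbhD E1 E2 μ)
    (hfx : (f x).2 = 0) : x.2 = 0 := by
  by_contra hx2
  have hfx' : f x = ((f x).1, 0) := Prod.ext rfl hfx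
  set c0 := (f x).1 with hc0
  -- sup of S on the fibre
  have hK := h.proper {(c0, 0)} (by simpa using fbhD_mem_zero c0) isCompact_singleton
  have hxK : x ∈ f ⁻¹' {(c0, 0)} ∩ fbhD E1 E2 μ := ⟨hfx', hx⟩
  obtain ⟨xm, hxm, hmax⟩ := hK.exists_isMaxOn ⟨x, hxK⟩ (fbhS_continuous (μ := μ)).continuousOn
  set K := fbhS μ xm with hKdef
  have hK1 : K < 1 := fbhD_iff.1 hxm.2
  have hK0 : 0 ≤ K := fbhS_nonneg _
  have hall : ∀ y ∈ fbhD E1 E2 μ, (f y).2 = 0 → fbhS μ y ≤ K := by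
    intro y hy hy2
    obtain ⟨u, hu, hatt⟩ := fbhH_attain (μ := μ) y
    rw [← hatt]
    refine T.Pinf hy hK0 (M := N) fun j _ => ?_
    have : f y = ((f y).1, 0) := Prod.ext rfl hy2
    rw [this, T.T_const h hu _ j _ c0]
    refine T.bound (fbhH_pow_diff u _ j _) (fbhD_mem_zero c0) fun x' hx' hfx' => ?_
    rw [norm_pow]
    gcongr
    exact (fbhH_le h.mu hu _ x').trans (hmax ⟨hfx', hx'⟩)
  obtain ⟨u, hu, hatt⟩ := fbhH_attain (μ := μ) ((0 : E1), x.2)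
  have hind : ∀ z w, fbhH μ u (0 : E1) (z, w) = inner ℂ u w := by simp [fbhH]
  simp only [hind] at hatt
  have hS0 : fbhS μ ((0 : E1), x.2) = ‖x.2‖ := by simp [fbhS]
  rw [hS0] at hatt
  have hm : 0 < ‖x.2‖ := norm_pos_iff.2 hx2
  set m := ‖x.2‖ with hmdef
  have hex : ∀ c : E1, ∃ y ∈ fbhD E1 E2 μ, f y = (c, 0) ∧ m ≤ ‖y.2‖ := by
    intro c
    obtain ⟨y, hy, hyc⟩ := T.surj (fbhD_mem_zero (E2 := E2) (μ := μ) c)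
    have hKc := h.proper {(c, 0)} (by simpa using fbhD_mem_zero c) isCompact_singleton
    have hcont : Continuous fun p : E1 × E2 => ‖(inner ℂ u p.2 : ℂ)‖ := by fun_prop
    obtain ⟨ym, hym, hymax⟩ := hKc.exists_isMaxOn ⟨y, ⟨hyc, hy⟩⟩ hcont.continuousOn
    refine ⟨ym, hym.2, hym.1, ?_⟩
    have h1 : ‖fbhH μ u (0 : E1) x‖ ≤ ‖(inner ℂ u ym.2 : ℂ)‖ := by
      refine T.Pinf hx (norm_nonneg _) (M := N) fun j _ => ?_
      rw [hfx', T.T_const h hu _ j _ c]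
      refine T.bound (fbhH_pow_diff u _ j _) (fbhD_mem_zero c) fun x' hx' hfx' => ?_
      rw [norm_pow]
      gcongr
      have := hymax ⟨hfx', hx'⟩
      simpa [fbhH] using this
    have h2 : fbhH μ u (0 : E1) x = inner ℂ u x.2 := hind x.1 x.2
    rw [h2, hatt] at h1
    refine h1.trans ((norm_inner_le_norm _ _).trans ?_)
    exact mul_le_of_le_one_left (norm_nonneg _) hu
  have hμ := h.mu
  set C := {p : E1 × E2 | fbhS μ p ≤ K ∧ ‖p.1‖ ≤ 2 / (μ * m) + 1} with hC
  have hCc : IsCompact C := fbhD_compact h.mu K _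
  have hCD : C ⊆ fbhD E1 E2 μ := fun p hp => fbhD_iff.2 (hp.1.trans_lt hK1)
  have him := hCc.image_of_continuousOn (h.diff.continuousOn.mono hCD)
  obtain ⟨R, hR⟩ := him.isBounded.exists_norm_le
  obtain ⟨c, hc⟩ := NormedSpace.exists_lt_norm ℂ E1 R
  obtain ⟨y, hy, hyc, hym⟩ := hex c
  have hyK := hall y hy (by rw [hyc])
  have hyC : y ∈ C := by
    refine ⟨hyK, ?_⟩
    have h3 : fbhS μ y < 1 := fbhD_iff.1 hy
    unfold fbhS at h3
    have h4 := Real.add_one_le_exp (μ * ‖y.1‖ ^ 2 / 2)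
    have h5 : m * (μ * ‖y.1‖ ^ 2 / 2) < 1 := by
      have : m * Real.exp (μ * ‖y.1‖ ^ 2 / 2) < 1 := lt_of_le_of_lt (by gcongr) h3
      nlinarith
    have h6 : ‖y.1‖ ^ 2 ≤ 2 / (μ * m) := by
      rw [le_div_iff₀ (by positivity)]; nlinarith
    have h7 : 0 ≤ 2 / (μ * m) := by positivity
    nlinarith [sq_nonneg (‖y.1‖ - 1)]
  have h8 := hR (f y) (mem_image_of_mem f hyC)
  rw [hyc] at h8
  have h9 : ‖c‖ ≤ ‖((c, 0) : E1 × E2)‖ := norm_fst_le ((c, 0) : E1 × E2)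
  linarith

end tuple

end partH4

section partH5

open Set Filter Topology Metric ComplexConjugate Asymptotics

section step5
variable {E1 E2 : Type*} [NormedAddCommGroup E1] [InnerProductSpace ℂ E1]
  [NormedAddCommGroup E2] [InnerProductSpace ℂ E2] {μ : ℝ} {f : E1 × E2 → E1 × E2}
  {N : ℕ} {P : (E1 × E2 → ℂ) → E1 × E2 → ℂ}

/-- vanishing order statement for the power sums -/
def FbhQ (μ : ℝ) (N : ℕ) (P : (E1 × E2 → ℂ) → E1 × E2 → ℂ) (j s : ℕ) : Prop :=
  ∀ u : E2, ‖u‖ ≤ 1 → ∀ d : E1, ∀ y ∈ fbhD E1 E2 μ, ‖P (fun p => fbhH μ u d p ^ j) y‖ ≤ N * fbhS μ y ^ s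

theorem FbhTuple.N_pos (T : FbhTuple μ f N P) : 1 ≤ N := by
  obtain ⟨X, -, -, ⟨i, -⟩, -⟩ := T.tup 0 fbhD_zero_mem
  exact Nat.one_le_of_lt i.2

theorem FbhTuple.of_Q (h : FbhProper μ f) (T : FbhTuple μ f N P) {s : ℕ → ℕ} {θ : ℝ} (hθ : 0 ≤ θ)
    (hs : ∀ j, 1 ≤ j → j ≤ N → FbhQ μ N P j (s j) ∧ θ * j ≤ s j) :
    ∀ x ∈ fbhD E1 E2 μ, fbhS μ x ≤ fbhS μ (f x) ^ θ := by
  obtain ⟨C, hC0, hC⟩ := fbh_PN N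
  have hN : (1 : ℝ) ≤ N := by exact_mod_cast T.N_pos
  -- rough bound
  have hrough : ∀ u : E2, ‖u‖ ≤ 1 → ∀ d : E1, ∀ x ∈ fbhD E1 E2 μ,
      ‖fbhH μ u d x‖ ≤ C * (N * fbhS μ (f x) ^ θ) := by
    intro u hu d x hx
    obtain ⟨X, -, -, ⟨i, hi⟩, hX3⟩ := T.tup x hx
    have hy := h.maps hx
    have hS0 := fbhS_nonneg (μ := μ) (f x)
    have hS1 := (fbhD_iff.1 hy).le
    have := hC (fun i => fbhH μ u d (X i)) (N * fbhS μ (f x) ^ θ) (by positivity) (fun j hj1 hj2 => by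
      obtain ⟨hQ, hle⟩ := hs j hj1 hj2
      have h1 := hQ u hu d (f x) hy
      rw [hX3 _ (fbhH_pow_diff u d j _)] at h1
      refine h1.trans ?_
      rw [mul_pow, ← Real.rpow_mul_natCast hS0]
      have h2 : fbhS μ (f x) ^ s j ≤ fbhS μ (f x) ^ (θ * j) := by
        rw [← Real.rpow_natCast]
        rcases hS0.eq_or_lt with h0 | h0
        · rw [← h0]
          rcases Nat.eq_zero_or_pos (s j) with h3 | h3
          · have : θ * j = 0 := le_antisymm (by simpa [h3] using hle) (by positivity)
            rw [this, h3]; simp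
          · rw [Real.zero_rpow (by positivity)]
            exact Real.zero_rpow_nonneg _
        · exact Real.rpow_le_rpow_of_exponent_ge h0 hS1 hle
      have h3 : (N : ℝ) ≤ (N : ℝ) ^ j := le_self_pow₀ hN (by omega)
      gcongr) i
    simpa [hi] using this
  -- refined bound
  have hfine : ∀ u : E2, ‖u‖ ≤ 1 → ∀ d : E1, ∀ j : ℕ, ∀ y ∈ fbhD E1 E2 μ,
      ‖P (fun p => fbhH μ u d p ^ j) y‖ ≤ N * fbhS μ y ^ ⌈θ * j⌉₊ := by
    intro u hu d j
    refine fbh_lemS (T.diff _ (fbhH_pow_diff u d j _)) (fun y hy => T.T_le h hu d j hy) fun z w i hi => ?_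
    have hi' : (i : ℝ) < θ * j := Nat.lt_ceil.1 hi
    have hpos : 0 < fbhS μ (z, w) + 1 := by linarith [fbhS_nonneg (μ := μ) (z, w)]
    have hb : ∀ c ∈ ball (0 : ℂ) (1 / (fbhS μ (z, w) + 1)), ‖P (fun p => fbhH μ u d p ^ j) (z, c • w)‖ ≤
        (N * (C * N) ^ j * fbhS μ (z, w) ^ (θ * j)) * ‖c‖ ^ (θ * j) := by
      intro c hc
      have hy := fbh_slice_mem hpos (by linarith) hc
      have h1 := T.bound (fbhH_pow_diff u d j _) hy (M := (C * (N * fbhS μ (z, c • w) ^ θ)) ^ j)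
        (fun x hx hfx => by
          rw [norm_pow, ← hfx]
          gcongr
          exact hrough u hu d x hx)
      refine h1.trans (le_of_eq ?_)
      rw [← mul_assoc C, mul_pow, ← Real.rpow_mul_natCast (fbhS_nonneg _), fbhS_smul_snd,
        Real.mul_rpow (norm_nonneg _) (fbhS_nonneg _)]
      ring
    have hO : (fun c : ℂ => P (fun p => fbhH μ u d p ^ j) (z, c • w)) =O[𝓝[≠] 0]
        fun c : ℂ => ‖c‖ ^ (θ * j) := by
      rw [isBigO_iff]
      refine ⟨N * (C * N) ^ j * fbhS μ (z, w) ^ (θ * j), ?_⟩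
      filter_upwards [mem_nhdsWithin_of_mem_nhds (ball_mem_nhds (0 : ℂ) (one_div_pos.2 hpos))] with c hc
      rw [Real.norm_of_nonneg (r := ‖c‖ ^ (θ * j)) (by positivity)]
      exact hb c hc
    refine hO.trans_isLittleO ?_
    rw [← isLittleO_norm_right, isLittleO_iff_tendsto']
    swap
    · filter_upwards [self_mem_nhdsWithin] with c hc h0
      exact absurd (norm_eq_zero.1 h0) (pow_ne_zero _ hc)
    have h2 : Tendsto (fun c : ℂ => ‖c‖ ^ (θ * j - i)) (𝓝[≠] 0) (𝓝 0) := by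
      have hc : Continuous fun c : ℂ => ‖c‖ ^ (θ * j - i) :=
        continuous_norm.rpow_const fun _ => Or.inr (by linarith)
      have := (hc.tendsto 0).mono_left (nhdsWithin_le_nhds (s := {0}ᶜ))
      rwa [norm_zero, Real.zero_rpow (by linarith)] at this
    refine h2.congr' ?_
    filter_upwards [self_mem_nhdsWithin] with c hc
    have hc0 : 0 < ‖c‖ := norm_pos_iff.2 hc
    rw [norm_pow, Real.rpow_sub hc0, Real.rpow_natCast]
  intro x hx
  obtain ⟨u, hu, hatt⟩ := fbhH_attain (μ := μ) x
  rw [← hatt]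
  have hS0 := fbhS_nonneg (μ := μ) (f x)
  have hy := h.maps hx
  have hS1 := (fbhD_iff.1 hy).le
  refine T.Pinf hx (by positivity) (M := N) fun j hj => ?_
  refine (hfine u hu _ j _ hy).trans ?_
  rw [← Real.rpow_mul_natCast hS0, ← Real.rpow_natCast (fbhS μ (f x))]
  refine mul_le_mul_of_nonneg_left ?_ (by positivity)
  rcases hS0.eq_or_lt with h0 | h0
  · rw [← h0]
    rcases (mul_nonneg hθ (Nat.cast_nonneg (α := ℝ) j)).eq_or_lt with h3 | h3
    · rw [← h3]; simp
    · rw [Real.zero_rpow (by have := Nat.ceil_pos.2 h3; positivity)]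
      exact Real.zero_rpow_nonneg _
  · exact Real.rpow_le_rpow_of_exponent_ge h0 hS1 (Nat.le_ceil _)

theorem FbhProper.fibre_nhds [FiniteDimensional ℂ E1] [FiniteDimensional ℂ E2] (h : FbhProper μ f)
    {y : E1 × E2} (hy : y ∈ fbhD E1 E2 μ) {U : Set (E1 × E2)}
    (hU : IsOpen U) (hfib : ∀ x ∈ fbhD E1 E2 μ, f x = y → x ∈ U) :
    ∀ᶠ y' in 𝓝 y, ∀ x ∈ fbhD E1 E2 μ, f x = y' → x ∈ U := by
  have : ProperSpace E1 := FiniteDimensional.proper ℂ E1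
  have : ProperSpace E2 := FiniteDimensional.proper ℂ E2
  obtain ⟨K, hKy, hKD, hK⟩ := local_compact_nhds (fbhD_isOpen.mem_nhds hy)
  have h1 := (h.proper K hKD hK).diff hU
  have h2 := h1.image_of_continuousOn (h.diff.continuousOn.mono fun x hx => hx.1.2)
  have h3 : y ∉ f '' ((f ⁻¹' K ∩ fbhD E1 E2 μ) \ U) := by
    rintro ⟨x, ⟨⟨-, hx⟩, hxU⟩, hxy⟩
    exact hxU (hfib x hx hxy)
  filter_upwards [hKy, h2.isClosed.isOpen_compl.mem_nhds h3] with y' hy1 hy2 x hx hxy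
  by_contra hxU
  exact hy2 ⟨x, ⟨⟨by rw [mem_preimage, hxy]; exact hy1, hx⟩, hxU⟩, hxy⟩
end step5

end partH5

section partH6

open Set Filter Topology Metric ComplexConjugate Asymptotics

section step5b
variable {E1 E2 : Type*} [NormedAddCommGroup E1] [InnerProductSpace ℂ E1]
  [NormedAddCommGroup E2] [InnerProductSpace ℂ E2] {μ : ℝ} {f : E1 × E2 → E1 × E2}
  {N : ℕ} {P : (E1 × E2 → ℂ) → E1 × E2 → ℂ}

theorem fbh_gauss_decay {B : E1 ≃ₗ[ℂ] E1} {b : E1} {k j s : ℕ} (hμ : 0 < μ)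
    (hBk : ∀ v, ‖B v‖ ^ 2 ≤ k * ‖v‖ ^ 2) (hks : k * s < j) :
    ∃ C : ℝ, ∀ z, s * (μ * ‖B z + b‖ ^ 2 / 2) - j * (μ * ‖z‖ ^ 2 / 2) ≤ C - μ * ‖z‖ ^ 2 / 4 := by
  set e : ℝ := 1 / (2 * (k * s + 1)) with he
  have he0 : 0 < e := by positivity
  have hes : (k * s : ℝ) * e ≤ 1 / 2 := by
    rw [he, mul_one_div, div_le_div_iff₀ (by positivity) (by norm_num)]
    linarith
  have hj : (k * s + 1 : ℝ) ≤ j := by exact_mod_cast hks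
  refine ⟨μ / 2 * (s * ((1 + 1 / e) * ‖b‖ ^ 2)), fun z => ?_⟩
  have h1 : ‖B z + b‖ ^ 2 ≤ (1 + e) * ‖B z‖ ^ 2 + (1 + 1 / e) * ‖b‖ ^ 2 := by
    have h2 : ‖B z + b‖ ^ 2 ≤ (‖B z‖ + ‖b‖) ^ 2 := by gcongr; exact norm_add_le _ _
    have h3 : (1 + e) * ‖B z‖ ^ 2 + (1 + 1 / e) * ‖b‖ ^ 2 - (‖B z‖ + ‖b‖) ^ 2 = (e * ‖B z‖ - ‖b‖) ^ 2 / e := by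
      field_simp; ring
    have h4 : 0 ≤ (e * ‖B z‖ - ‖b‖) ^ 2 / e := by positivity
    linarith
  have h5 : ‖B z + b‖ ^ 2 ≤ (1 + e) * (k * ‖z‖ ^ 2) + (1 + 1 / e) * ‖b‖ ^ 2 := by
    refine h1.trans ?_
    gcongr
    exact hBk z
  have h6 : s * (μ / 2 * ‖B z + b‖ ^ 2) ≤ s * (μ / 2 * ((1 + e) * (k * ‖z‖ ^ 2) + (1 + 1 / e) * ‖b‖ ^ 2)) := by
    gcongr
  have h7 : 0 ≤ μ / 2 * ‖z‖ ^ 2 * ((j - 1 / 2) - (k * s + k * s * e)) := by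
    apply mul_nonneg (by positivity); linarith
  linarith

theorem FbhTuple.Q_succ [FiniteDimensional ℂ E1] [FiniteDimensional ℂ E2] [Nontrivial E1]
    (h : FbhProper μ f) (T : FbhTuple μ f N P) {B : E1 ≃ₗ[ℂ] E1} {b : E1} {k j s : ℕ}
    (hB : ∀ z, f (z, 0) = (B z + b, 0)) (hBk : ∀ v, ‖B v‖ ^ 2 ≤ k * ‖v‖ ^ 2) (hks : k * s < j)
    {θ : ℝ} (hθ : θ * j = s) (hprop : ∀ x ∈ fbhD E1 E2 μ, fbhS μ x ≤ fbhS μ (f x) ^ θ)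
    (hQ : FbhQ μ N P j s) : FbhQ μ N P j (s + 1) := by
  intro u hu d0
  have hμ := h.mu
  have hd : ∀ d, DifferentiableOn ℂ (P fun p => fbhH μ u d p ^ j) (fbhD E1 E2 μ) := fun d =>
    T.diff _ (fbhH_pow_diff u d j _)
  choose q hq1 hq2 hq3 using fun d => fbh_lemV (hd d) (Nat.cast_nonneg N) (hQ u hu d)
  have hrel : ∀ d z w, q d (B z + b) w = fbhW μ d z ^ j * q 0 (B z + b) w := by
    intro d z w
    have hpos : 0 < fbhS μ (B z + b, w) + 1 := by linarith [fbhS_nonneg (μ := μ) (B z + b, w)]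
    have h1 := (hq1 d (B z + b) w).sub ((hq1 0 (B z + b) w).const_mul (fbhW μ d z ^ j))
    refine sub_eq_zero.1 (tendsto_nhds_unique h1 ?_)
    rw [tendsto_zero_iff_norm_tendsto_zero]
    set A : ℝ := N * fbhS μ (B z + b, w) ^ s with hA
    have hA0 : 0 ≤ A := by have := fbhS_nonneg (μ := μ) (B z + b, w); positivity
    rw [Metric.tendsto_nhds]
    intro ε hε
    set ε' := ε / (A + 1) with hε'
    have hε'0 : 0 < ε' := by positivity
    have hWc : Continuous fun x : E1 × E2 => ‖fbhW μ d x.1 ^ j - fbhW μ d z ^ j‖ := by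
      have := fbhW_continuous (μ := μ) d
      fun_prop
    have h2 := h.fibre_nhds (fbhD_mem_zero (B z + b))
      (U := {x | ‖fbhW μ d x.1 ^ j - fbhW μ d z ^ j‖ < ε'}) (isOpen_lt hWc continuous_const)
      (fun x hx hfx => by
        have hx2 := T.zero_fibre h hx (by rw [hfx])
        have hx' : x = (x.1, 0) := Prod.ext rfl hx2
        rw [hx', hB] at hfx
        have h3 : B x.1 = B z := by simpa using (Prod.ext_iff.1 hfx).1
        have h4 := B.injective h3
        simp [h4, hε'0])
    have h5 : Tendsto (fun c : ℂ => (B z + b, c • w)) (𝓝[≠] 0) (𝓝 (B z + b, 0)) := by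
      have : Continuous fun c : ℂ => (B z + b, c • w) := by fun_prop
      simpa using (this.tendsto 0).mono_left nhdsWithin_le_nhds
    filter_upwards [self_mem_nhdsWithin, mem_nhdsWithin_of_mem_nhds
      (ball_mem_nhds (0 : ℂ) (one_div_pos.2 hpos)), h5.eventually h2] with c hc1 hc2 hc3
    have hy := fbh_slice_mem hpos (by linarith) hc2
    have hc0 : 0 < ‖c‖ := norm_pos_iff.2 hc1
    obtain ⟨x0, hx0, hfx0⟩ := T.surj hy
    obtain ⟨X, hX1, hX2, -, hX3⟩ := T.tup x0 hx0
    rw [hfx0] at hX2 hX3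
    have h6 : ‖P (fun p => fbhH μ u d p ^ j) (B z + b, c • w) - fbhW μ d z ^ j *
        P (fun p => fbhH μ u 0 p ^ j) (B z + b, c • w)‖ ≤ ε' * A * ‖c‖ ^ s := by
      rw [hX3 _ (fbhH_pow_diff u d j _), hX3 _ (fbhH_pow_diff u 0 j _), Finset.mul_sum,
        ← Finset.sum_sub_distrib]
      refine (norm_sum_le _ _).trans ?_
      have h7 : ∀ i ∈ Finset.univ, ‖fbhH μ u d (X i) ^ j - fbhW μ d z ^ j * fbhH μ u 0 (X i) ^ j‖ ≤
          ε' * (‖c‖ ^ s * fbhS μ (B z + b, w) ^ s) := by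
        intro i _
        have h8 := hc3 (X i) (hX1 i) (hX2 i)
        have h9 : fbhH μ u d (X i) ^ j - fbhW μ d z ^ j * fbhH μ u 0 (X i) ^ j =
          (fbhW μ d (X i).1 ^ j - fbhW μ d z ^ j) * fbhH μ u 0 (X i) ^ j := by
          rw [fbhH_eq u d]; ring
        rw [h9, norm_mul, norm_pow (fbhH μ u 0 (X i))]
        have h10 : ‖fbhH μ u 0 (X i)‖ ^ j ≤ ‖c‖ ^ s * fbhS μ (B z + b, w) ^ s := by
          have h11 : ‖fbhH μ u 0 (X i)‖ ≤ fbhS μ (B z + b, c • w) ^ θ := by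
            have := (fbhH_le h.mu hu 0 (X i)).trans (hprop _ (hX1 i))
            rwa [hX2 i] at this
          calc ‖fbhH μ u 0 (X i)‖ ^ j ≤ (fbhS μ (B z + b, c • w) ^ θ) ^ j := by gcongr
            _ = ‖c‖ ^ s * fbhS μ (B z + b, w) ^ s := by
              rw [← Real.rpow_mul_natCast (fbhS_nonneg _), hθ, Real.rpow_natCast, fbhS_smul_snd, mul_pow]
        have h8' : ‖fbhW μ d (X i).1 ^ j - fbhW μ d z ^ j‖ ≤ ε' := le_of_lt h8
        gcongr
      refine (Finset.sum_le_sum h7).trans (le_of_eq ?_)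
      simp [hA]; ring
    rw [dist_zero_right, Real.norm_of_nonneg (norm_nonneg _), ← mul_div_assoc, ← sub_div, norm_div, norm_pow,
      div_lt_iff₀ (by positivity)]
    refine lt_of_le_of_lt h6 ?_
    gcongr
    rw [hε', div_mul_eq_mul_div, div_lt_iff₀ (by positivity)]
    nlinarith
  have hq0 : ∀ c w, q 0 c w = 0 := by
    intro c w
    obtain ⟨v, hv⟩ := exists_ne (0 : E1)
    have hvn : 0 < ‖v‖ := norm_pos_iff.2 hv
    obtain ⟨C, hC⟩ := fbh_gauss_decay (b := b) hμ hBk hks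
    obtain ⟨z1, hz1⟩ := B.surjective (c - b)
    have hc : c = B z1 + b := by rw [hz1]; abel
    have hbd : ∀ z, ‖q 0 (B z + b) w‖ ≤ N * ‖w‖ ^ s * Real.exp (C - μ * ‖z‖ ^ 2 / 4) := by
      intro z
      have h1 := hq2 z (B z + b) w
      rw [hrel, norm_mul, norm_pow, fbhW_self, ← Real.exp_nat_mul] at h1
      unfold fbhS at h1
      rw [mul_pow, ← Real.exp_nat_mul, ← le_div_iff₀' (Real.exp_pos _)] at h1
      refine h1.trans ?_
      rw [← mul_assoc, mul_div_assoc, ← Real.exp_sub]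
      exact mul_le_mul_of_nonneg_left (Real.exp_le_exp.2 (hC z)) (by positivity)
    have hlim : Tendsto (fun t : ℂ => q 0 (B z1 + b + t • B v) w) (cocompact ℂ) (𝓝 0) := by
      have hn : Tendsto (fun t : ℂ => ‖z1 + t • v‖) (cocompact ℂ) atTop := by
        have h1 : Tendsto (fun t : ℂ => ‖t‖ * ‖v‖ - ‖z1‖) (cocompact ℂ) atTop :=
          tendsto_atTop_add_const_right _ _ ((tendsto_norm_cocompact_atTop (E := ℂ)).atTop_mul_const hvn)
        refine tendsto_atTop_mono (fun t => ?_) h1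
        have := norm_sub_le (z1 + t • v) z1
        rw [add_sub_cancel_left, norm_smul] at this
        linarith
      have h2 : Tendsto (fun x : ℝ => N * ‖w‖ ^ s * Real.exp (C - μ * x ^ 2 / 4)) atTop (𝓝 (N * ‖w‖ ^ s * 0)) := by
        refine Tendsto.const_mul _ (Real.tendsto_exp_atBot.comp ?_)
        have h3 : Tendsto (fun x : ℝ => μ / 4 * x ^ 2) atTop atTop :=
          (tendsto_pow_atTop (by norm_num)).const_mul_atTop (by positivity)
        have h4 := tendsto_atBot_add_const_left atTop C (tendsto_neg_atTop_atBot.comp h3)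
        refine h4.congr fun x => ?_
        simp only [Function.comp]
        ring
      rw [mul_zero] at h2
      refine squeeze_zero_norm (fun t => ?_) (h2.comp hn)
      have := hbd (z1 + t • v)
      have h5 : B z1 + b + t • B v = B (z1 + t • v) + b := by
        rw [map_add, map_smul]; abel
      rw [h5]
      exact this
    have h6 := (hq3 0 (B z1 + b) (B v) w).apply_eq_of_tendsto_cocompact 0 hlim
    simpa [hc] using h6
  refine fbh_lemV_zero (hd d0) (Nat.cast_nonneg N) (hQ u hu d0) fun c w => ?_
  obtain ⟨z1, hz1⟩ := B.surjective (c - b)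
  have hc : c = B z1 + b := by rw [hz1]; abel
  have := hq1 d0 c w
  rwa [hc, hrel, hq0, mul_zero, ← hc] at this

theorem FbhProper.S_eq [FiniteDimensional ℂ E1] [FiniteDimensional ℂ E2] [Nontrivial E1]
    (h : FbhProper μ f) {B : E1 ≃ₗ[ℂ] E1} {b : E1} {k : ℕ} (hk1 : 1 ≤ k)
    (hB : ∀ z, f (z, 0) = (B z + b, 0)) (hBk : ∀ v, ‖B v‖ ^ 2 ≤ k * ‖v‖ ^ 2)
    (hk : ∀ x ∈ fbhD E1 E2 μ, fbhS μ (f x) ≤ fbhS μ x ^ k) :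
    ∀ x ∈ fbhD E1 E2 μ, fbhS μ (f x) = fbhS μ x ^ k := by
  classical
  obtain ⟨N, P, T⟩ := h.exists_tuple
  have hN := T.N_pos
  have hQ0 : ∀ j, FbhQ μ N P j 0 := fun j u hu d y hy => by
    simpa using T.T_le h hu d j hy
  let s : ℕ → ℕ := fun j => Nat.findGreatest (FbhQ μ N P j) j
  have hs : ∀ j, FbhQ μ N P j (s j) := fun j => Nat.findGreatest_spec (P := FbhQ μ N P j) (Nat.zero_le j) (hQ0 j)
  have hs1 : ∀ j, s j < j → ¬ FbhQ μ N P j (s j + 1) := fun j hj =>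
    Nat.findGreatest_is_greatest (Nat.lt_succ_self _) hj
  obtain ⟨j0, hj0, hmin⟩ := Finset.exists_min_image (Finset.Icc 1 N) (fun j => (s j : ℝ) / j) ⟨1, by simp [hN]⟩
  rw [Finset.mem_Icc] at hj0
  have hj0' : (0 : ℝ) < j0 := by exact_mod_cast hj0.1
  set θ : ℝ := (s j0 : ℝ) / j0 with hθ
  have hprop := T.of_Q h (θ := θ) (by positivity) (s := s) fun j hj1 hj2 => ⟨hs j, by
    have := hmin j (Finset.mem_Icc.2 ⟨hj1, hj2⟩)
    rwa [le_div_iff₀ (by exact_mod_cast hj1)] at this⟩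
  have hge : j0 ≤ k * s j0 := by
    by_contra hlt
    push Not at hlt
    have : s j0 < j0 := lt_of_le_of_lt (Nat.le_mul_of_pos_left _ hk1) hlt
    exact hs1 j0 this (T.Q_succ h hB hBk hlt (θ := θ) (by rw [hθ]; field_simp) hprop (hs j0))
  have hθk : 1 ≤ θ * k := by
    rw [hθ, div_mul_eq_mul_div, le_div_iff₀ hj0', one_mul, mul_comm]
    exact_mod_cast hge
  intro x hx
  refine le_antisymm (hk x hx) ?_
  have h1 := hprop x hx
  have hS0 := fbhS_nonneg (μ := μ) (f x)
  calc fbhS μ x ^ k ≤ (fbhS μ (f x) ^ θ) ^ k := by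
        have := fbhS_nonneg (μ := μ) x
        gcongr
    _ = fbhS μ (f x) ^ (θ * k) := by rw [Real.rpow_mul_natCast hS0]
    _ ≤ fbhS μ (f x) ^ (1 : ℝ) := by
        rcases hS0.eq_or_lt with h0 | h0
        · rw [← h0, Real.zero_rpow (by positivity), Real.zero_rpow one_ne_zero]
        · exact Real.rpow_le_rpow_of_exponent_ge h0 (fbhD_iff.1 (h.maps hx)).le hθk
    _ = fbhS μ (f x) := Real.rpow_one _
end step5b

end partH6

section partH7

open Set Filter Topology Metric ComplexConjugate Asymptotics

section step6
theorem fbh_inner_conj_diff {E : Type*} [NormedAddCommGroup E] [InnerProductSpace ℂ E] [FiniteDimensional ℂ E]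
    {g h : ℂ → E} {t : ℂ} (hg : DifferentiableAt ℂ g (conj t)) (hh : DifferentiableAt ℂ h t) :
    DifferentiableAt ℂ (fun s => inner ℂ (g (conj s)) (h s)) t := by
  have h1 : (fun s => inner ℂ (g (conj s)) (h s)) = fun s =>
      ∑ i, (conj ∘ (fun r => inner ℂ (stdOrthonormalBasis ℂ E i) (g r)) ∘ conj) s *
        inner ℂ (stdOrthonormalBasis ℂ E i) (h s) := by
    funext s
    rw [← OrthonormalBasis.sum_inner_mul_inner (stdOrthonormalBasis ℂ E)]
    refine Finset.sum_congr rfl fun i _ => ?_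
    simp only [Function.comp_apply, inner_conj_symm]
  rw [h1]
  refine DifferentiableAt.fun_sum fun i _ => DifferentiableAt.mul ?_ ?_
  · have : DifferentiableAt ℂ (fun r => inner ℂ (stdOrthonormalBasis ℂ E i) (g r)) (conj t) :=
      ((innerSL ℂ (stdOrthonormalBasis ℂ E i)).differentiableAt).comp _ hg
    have := this.conj_conj
    simpa using this
  · exact ((innerSL ℂ (stdOrthonormalBasis ℂ E i)).differentiableAt).comp _ hh

theorem fbh_polarize {E : Type*} [NormedAddCommGroup E] [NormedSpace ℂ E] {D : Set E} (hD : IsOpen D)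
    (h0 : (0 : E) ∈ D) (hbal : ∀ x ∈ D, ∀ c : ℂ, ‖c‖ ≤ 1 → c • x ∈ D) {Ψ : E → E → ℂ}
    (hd : ∀ (a c : ℂ → E) (t : ℂ), DifferentiableAt ℂ a (conj t) → DifferentiableAt ℂ c t →
      a (conj t) ∈ D → c t ∈ D → DifferentiableAt ℂ (fun s => Ψ (a (conj s)) (c s)) t)
    (hz : ∀ x ∈ D, Ψ x x = 0) : ∀ x ∈ D, ∀ y ∈ D, Ψ x y = 0 := by
  obtain ⟨R, hR0, hR⟩ := Metric.isOpen_iff.1 hD 0 h0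
  have hloc : ∀ x y : E, ‖x‖ < R / 3 → ‖y‖ < R / 3 → Ψ x y = 0 := by
    intro x y hx hy
    set u : E := (1 / 2 : ℂ) • (x + y) with hu
    set v : E := (1 / (2 * Complex.I) : ℂ) • (y - x) with hv
    have hun : ‖u‖ < R / 3 := by
      rw [hu, norm_smul]
      have := norm_add_le x y
      norm_num; linarith
    have hvn : ‖v‖ < R / 3 := by
      rw [hv, norm_smul]
      have := norm_sub_le y x
      norm_num; linarith
    have hmem : ∀ t : ℂ, ‖t‖ < 2 → u + t • v ∈ D := by
      intro t ht
      apply hR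
      rw [mem_ball_zero_iff]
      have h1 := norm_add_le u (t • v)
      rw [norm_smul t v] at h1
      have h2 : ‖t‖ * ‖v‖ ≤ 2 * ‖v‖ := by gcongr
      linarith
    have hdiff : DifferentiableOn ℂ (fun s : ℂ => Ψ (u + conj s • v) (u + s • v)) (ball 0 2) := by
      intro t ht
      rw [mem_ball_zero_iff] at ht
      refine (hd (fun s => u + s • v) (fun s => u + s • v) t (by fun_prop) (by fun_prop)
        (hmem _ (by simpa using ht)) (hmem _ ht)).differentiableWithinAt
    have han := hdiff.analyticOnNhd isOpen_ball
    have hfreq : ∃ᶠ s in 𝓝[≠] (0 : ℂ), Ψ (u + conj s • v) (u + s • v) = 0 := by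
      have hlim : Tendsto (fun n : ℕ => ((1 / ((n : ℝ) + 1) : ℝ) : ℂ)) atTop (𝓝[≠] (0 : ℂ)) := by
        rw [tendsto_nhdsWithin_iff]
        constructor
        · have := (Complex.continuous_ofReal.tendsto 0).comp (tendsto_one_div_add_atTop_nhds_zero_nat (𝕜 := ℝ))
          rw [Complex.ofReal_zero] at this; exact this
        · refine Eventually.of_forall fun n => ?_
          have : (1 / ((n : ℝ) + 1)) ≠ 0 := by positivity
          simpa using Complex.ofReal_ne_zero.2 this
      refine hlim.frequently (Eventually.frequently (Eventually.of_forall fun n => ?_))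
      rw [Complex.conj_ofReal]
      apply hz
      apply hmem
      rw [Complex.norm_real, Real.norm_of_nonneg (by positivity)]
      have : 1 / ((n : ℝ) + 1) ≤ 1 := by
        rw [div_le_one (by positivity)]; linarith [Nat.cast_nonneg (α := ℝ) n]
      linarith
    have key := han.eqOn_zero_of_preconnected_of_frequently_eq_zero (convex_ball _ _).isPreconnected
      (mem_ball_self (by norm_num)) hfreq (show Complex.I ∈ ball (0 : ℂ) 2 by simp)
    simp only [Pi.zero_apply, Complex.conj_I] at key
    have h1 : u + Complex.I • v = y := by
      rw [hu, hv, smul_smul]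
      have : Complex.I * (1 / (2 * Complex.I)) = 1 / 2 := by field_simp
      rw [this]; module
    have h2 : u + (-Complex.I) • v = x := by
      rw [hu, hv, smul_smul]
      have : -Complex.I * (1 / (2 * Complex.I)) = -1 / 2 := by field_simp
      rw [this]; module
    rwa [h1, h2] at key
  intro x hx y hy
  set L : Set ℂ := {t | conj t • x ∈ D ∧ t • y ∈ D} with hL
  have hLo : IsOpen L := by
    refine IsOpen.inter (hD.preimage ?_) (hD.preimage ?_)
    · exact (Complex.continuous_conj).smul continuous_const
    · fun_prop
  have hLs : StarConvex ℝ (0 : ℂ) L := by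
    rw [starConvex_zero_iff]
    intro t ht a ha0 ha1
    have hn : ‖(a : ℂ)‖ ≤ 1 := by rw [Complex.norm_real, Real.norm_of_nonneg ha0]; exact ha1
    refine ⟨?_, ?_⟩
    · have := hbal _ ht.1 a hn
      simpa [smul_smul] using this
    · have := hbal _ ht.2 a hn
      simpa [smul_smul] using this
  have h0L : (0 : ℂ) ∈ L := by simp [hL, h0]
  have hLc : IsPreconnected L := (hLs.isPathConnected h0L).isConnected.isPreconnected
  have hdiff : DifferentiableOn ℂ (fun s : ℂ => Ψ (conj s • x) (s • y)) L := by
    intro t ht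
    exact (hd (fun s => s • x) (fun s => s • y) t (by fun_prop) (by fun_prop) ht.1 ht.2).differentiableWithinAt
  have hev : (fun s : ℂ => Ψ (conj s • x) (s • y)) =ᶠ[𝓝 0] 0 := by
    have e1 : ∀ᶠ s : ℂ in 𝓝 0, ‖conj s • x‖ < R / 3 := by
      have : Continuous (fun s : ℂ => ‖conj s • x‖) := ((Complex.continuous_conj).smul continuous_const).norm
      exact this.tendsto' 0 0 (by simp) (Iio_mem_nhds (by positivity))
    have e2 : ∀ᶠ s : ℂ in 𝓝 0, ‖s • y‖ < R / 3 := by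
      have : Continuous (fun s : ℂ => ‖s • y‖) := by fun_prop
      exact this.tendsto' 0 0 (by simp) (Iio_mem_nhds (by positivity))
    filter_upwards [e1, e2] with s h1 h2 using hloc _ _ h1 h2
  have := fbh_identity hLo hLc hdiff h0L hev 1 (by simp [hL, hx, hy])
  simpa using this

variable {E1 E2 : Type*} [NormedAddCommGroup E1] [InnerProductSpace ℂ E1]
  [NormedAddCommGroup E2] [InnerProductSpace ℂ E2] {μ : ℝ} {f : E1 × E2 → E1 × E2}

noncomputable def fbhK (μ : ℝ) (x y : E1 × E2) : ℂ :=
  inner ℂ x.2 y.2 * Complex.exp (μ * inner ℂ x.1 y.1)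

theorem fbhK_self (x : E1 × E2) : fbhK μ x x = ((fbhS μ x ^ 2 : ℝ) : ℂ) := by
  unfold fbhK fbhS
  rw [inner_self_eq_norm_sq_to_K, inner_self_eq_norm_sq_to_K]
  push_cast
  rw [mul_pow, ← Complex.exp_nat_mul]
  simp only [Complex.coe_algebraMap]
  congr 2
  push_cast; ring

theorem fbhK_diff [FiniteDimensional ℂ E1] [FiniteDimensional ℂ E2] {a c : ℂ → E1 × E2} {t : ℂ}
    (ha : DifferentiableAt ℂ a (conj t)) (hc : DifferentiableAt ℂ c t) :
    DifferentiableAt ℂ (fun s => fbhK μ (a (conj s)) (c s)) t := by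
  unfold fbhK
  refine DifferentiableAt.mul ?_ (DifferentiableAt.cexp (DifferentiableAt.const_mul ?_ _))
  · exact fbh_inner_conj_diff (g := fun s => (a s).2) (h := fun s => (c s).2) ha.snd hc.snd
  · exact fbh_inner_conj_diff (g := fun s => (a s).1) (h := fun s => (c s).1) ha.fst hc.fst

theorem FbhProper.K_eq [FiniteDimensional ℂ E1] [FiniteDimensional ℂ E2] (h : FbhProper μ f) {k : ℕ}
    (hS : ∀ x ∈ fbhD E1 E2 μ, fbhS μ (f x) = fbhS μ x ^ k) :
    ∀ x ∈ fbhD E1 E2 μ, ∀ y ∈ fbhD E1 E2 μ, fbhK μ (f x) (f y) = fbhK μ x y ^ k := by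
  intro x hx y hy
  rw [← sub_eq_zero]
  refine fbh_polarize (Ψ := fun x y => fbhK μ (f x) (f y) - fbhK μ x y ^ k) fbhD_isOpen fbhD_zero_mem
    (fun x hx c hc => fbhD_smul_mem h.mu hx hc) ?_ ?_ x hx y hy
  · intro a c t ha hc haD hcD
    have h1 : DifferentiableAt ℂ (fun s => f (a s)) (conj t) :=
      (h.diff.differentiableAt (fbhD_isOpen.mem_nhds haD)).comp _ ha
    have h2 : DifferentiableAt ℂ (fun s => f (c s)) t :=
      (h.diff.differentiableAt (fbhD_isOpen.mem_nhds hcD)).comp _ hc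
    exact (fbhK_diff (a := fun s => f (a s)) (c := fun s => f (c s)) h1 h2).sub ((fbhK_diff ha hc).pow k)
  · intro x hx
    simp only [fbhK_self, hS x hx]
    push_cast; ring

end step6

end partH7

section partH8

open Set Filter Topology Metric ComplexConjugate Asymptotics

section step7
variable {E1 E2 : Type*} [NormedAddCommGroup E1] [InnerProductSpace ℂ E1]
  [NormedAddCommGroup E2] [InnerProductSpace ℂ E2] {μ : ℝ} {f : E1 × E2 → E1 × E2}

theorem FbhProper.gram [FiniteDimensional ℂ E1] [FiniteDimensional ℂ E2] (h : FbhProper μ f) {k : ℕ}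
    {b : E1} (hb : f (0, 0) = (b, 0))
    (hK : ∀ x ∈ fbhD E1 E2 μ, ∀ y ∈ fbhD E1 E2 μ, fbhK μ (f x) (f y) = fbhK μ x y ^ k)
    {J : Type} [Fintype J] (w : J → E2) :
    ∃ Q : J → E2, ∀ i j, inner ℂ (Q i) (Q j) * Complex.exp (μ * inner ℂ b b) = inner ℂ (w i) (w j) ^ k := by
  have : ProperSpace E2 := FiniteDimensional.proper ℂ E2
  set s : ℕ → ℝ := fun n => 1 / ((n : ℝ) + 1) with hs
  have hs0 : ∀ n, 0 < s n := fun n => by simp only [hs]; positivity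
  have hsl : Tendsto s atTop (𝓝 0) := tendsto_one_div_add_atTop_nhds_zero_nat
  set p : ℕ → J → E1 × E2 := fun n j => (0, (s n : ℂ) • w j) with hp
  have hpl : ∀ j, Tendsto (fun n => p n j) atTop (𝓝 0) := by
    intro j
    have hc : Continuous (fun r : ℝ => ((0 : E1), (r : ℂ) • w j)) :=
      continuous_const.prodMk (Complex.continuous_ofReal.smul continuous_const)
    have := (hc.tendsto 0).comp hsl
    simp only [Complex.ofReal_zero, zero_smul] at this
    exact this
  have hpD : ∀ᶠ n in atTop, ∀ j, p n j ∈ fbhD E1 E2 μ := by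
    rw [eventually_all]
    intro j
    exact (hpl j) (fbhD_isOpen.mem_nhds fbhD_zero_mem)
  have hfl : ∀ j, Tendsto (fun n => (f (p n j)).1) atTop (𝓝 b) := by
    intro j
    have h1 : ContinuousAt f 0 := (h.diff.differentiableAt (fbhD_isOpen.mem_nhds fbhD_zero_mem)).continuousAt
    have h2 := h1.tendsto.comp (hpl j)
    have h3 := (continuous_fst.tendsto _).comp h2
    have h4 : (f 0).1 = b := by rw [show (0 : E1 × E2) = (0, 0) from rfl, hb]
    rw [h4] at h3
    exact h3
  set q : ℕ → J → E2 := fun n j => ((1 / s n ^ k : ℝ) : ℂ) • (f (p n j)).2 with hq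
  have hid : ∀ᶠ n in atTop, ∀ i j, inner ℂ (q n i) (q n j) * Complex.exp (μ * inner ℂ (f (p n i)).1 (f (p n j)).1)
      = inner ℂ (w i) (w j) ^ k := by
    filter_upwards [hpD] with n hn i j
    have h1 := hK _ (hn i) _ (hn j)
    have hsn : (s n : ℂ) ≠ 0 := Complex.ofReal_ne_zero.2 (hs0 n).ne'
    have h2 : fbhK μ (p n i) (p n j) = (s n : ℂ) ^ 2 * inner ℂ (w i) (w j) := by
      simp only [fbhK, hp, inner_smul_left, inner_smul_right, Complex.conj_ofReal, inner_zero_left, mul_zero,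
        Complex.exp_zero, mul_one]
      ring
    rw [h2, fbhK] at h1
    simp only [hq, inner_smul_left, inner_smul_right, Complex.conj_ofReal]
    have h3 : ((1 / s n ^ k : ℝ) : ℂ) = ((s n : ℂ) ^ k)⁻¹ := by push_cast; simp
    rw [h3, mul_assoc, mul_assoc, h1]
    field_simp
    ring
  have hexpl : ∀ i j, Tendsto (fun n => Complex.exp (μ * inner ℂ (f (p n i)).1 (f (p n j)).1)) atTop
      (𝓝 (Complex.exp (μ * inner ℂ b b))) := by
    intro i j
    exact (Complex.continuous_exp.tendsto _).comp (((hfl i).inner (hfl j)).const_mul _)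
  have hgram : ∀ i j, Tendsto (fun n => inner ℂ (q n i) (q n j)) atTop
      (𝓝 (inner ℂ (w i) (w j) ^ k / Complex.exp (μ * inner ℂ b b))) := by
    intro i j
    have h1 := (tendsto_const_nhds (x := inner ℂ (w i) (w j) ^ k)).div (hexpl i j) (Complex.exp_ne_zero _)
    refine h1.congr' ?_
    filter_upwards [hid] with n hn
    rw [← hn i j]
    simp
  have hbd : ∀ j, ∃ C : ℝ, ∀ᶠ n in atTop, ‖q n j‖ ≤ C := by
    intro j
    have h1 := (hgram j j).norm
    refine ⟨‖inner ℂ (w j) (w j) ^ k / Complex.exp (μ * inner ℂ b b)‖ + 2, ?_⟩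
    filter_upwards [h1 (Iio_mem_nhds (lt_add_one _))] with n hn
    have h2 : ‖q n j‖ ^ 2 < ‖inner ℂ (w j) (w j) ^ k / Complex.exp (μ * inner ℂ b b)‖ + 1 := by
      have h3 : ‖inner ℂ (q n j) (q n j)‖ = ‖q n j‖ ^ 2 := by
        rw [inner_self_eq_norm_sq_to_K]; simp
      rw [← h3]; exact hn
    nlinarith [sq_nonneg (‖q n j‖ - 1)]
  choose C hC using hbd
  have hbdd : Bornology.IsBounded (Set.pi univ (fun j => closedBall (0 : E2) (C j))) :=
    Bornology.IsBounded.pi fun j => isBounded_closedBall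
  obtain ⟨Q, -, φ, hφ, hlim⟩ := tendsto_subseq_of_frequently_bounded (x := q) hbdd (by
    apply Eventually.frequently
    filter_upwards [eventually_all.2 hC] with n hn j _
    simpa using hn j)
  refine ⟨Q, fun i j => ?_⟩
  rw [tendsto_pi_nhds] at hlim
  have h1 := (hlim i).inner (𝕜 := ℂ) (hlim j)
  have h2 := tendsto_nhds_unique h1 ((hgram i j).comp hφ.tendsto_atTop)
  rw [h2, div_mul_cancel₀ _ (Complex.exp_ne_zero _)]

theorem fbh_k_one [FiniteDimensional ℂ E2] (hd : 2 ≤ Module.finrank ℂ E2) {k : ℕ} (hk1 : 1 ≤ k) {c : ℂ} (hc : c ≠ 0)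
    (hQ : ∀ w : Option (Fin (Module.finrank ℂ E2)) → E2, ∃ Q : Option (Fin (Module.finrank ℂ E2)) → E2,
      ∀ i j, inner ℂ (Q i) (Q j) * c = inner ℂ (w i) (w j) ^ k) : k = 1 := by
  classical
  set e := stdOrthonormalBasis ℂ E2 with he
  set α : Fin (Module.finrank ℂ E2) := ⟨0, by omega⟩
  set β : Fin (Module.finrank ℂ E2) := ⟨1, by omega⟩
  have hαβ : α ≠ β := by simp [α, β]
  obtain ⟨Q, hQ⟩ := hQ (fun o => o.elim (e α + e β) e)
  have hk0 : k ≠ 0 := by omega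
  have hee : ∀ i j, inner ℂ (e i) (e j) = if i = j then (1 : ℂ) else 0 := orthonormal_iff_ite.1 e.orthonormal
  have h1 : ∀ i j, inner ℂ (Q (some i)) (Q (some j)) * c = if i = j then (1 : ℂ) else 0 := by
    intro i j
    rw [hQ]
    simp only [Option.elim, hee]
    split_ifs <;> simp [hk0]
  have h2 : ∀ i, inner ℂ (Q (some i)) (Q none) * c = (if i = α then (1 : ℂ) else 0) + if i = β then (1 : ℂ) else 0 := by
    intro i
    rw [hQ]
    simp only [Option.elim, inner_add_right, hee]
    split_ifs with u v
    · exact absurd (u.symm.trans v) hαβ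
    all_goals simp [hk0]
  have h3 : inner ℂ (Q none) (Q none) * c = 2 ^ k := by
    rw [hQ]
    simp only [Option.elim, inner_add_right, inner_add_left, hee]
    simp [hαβ, hαβ.symm]
    norm_num
  have hli : LinearIndependent ℂ (fun i => Q (some i)) := by
    refine linearIndependent_of_ne_zero_of_inner_eq_zero (𝕜 := ℂ) ?_ ?_
    · intro i h0
      have := h1 i i
      simp [h0] at this
    · intro i j hij
      have := h1 i j
      simpa [hij, hc] using this
  have hcard : Fintype.card (Fin (Module.finrank ℂ E2)) = Module.finrank ℂ E2 := by simp
  have : Nonempty (Fin (Module.finrank ℂ E2)) := ⟨α⟩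
  have hr : Q none = Q (some α) + Q (some β) := by
    refine InnerProductSpace.ext_inner_left_basis (𝕜 := ℂ) (basisOfLinearIndependentOfCardEqFinrank hli hcard) fun i => ?_
    rw [coe_basisOfLinearIndependentOfCardEqFinrank]
    apply mul_right_cancel₀ hc
    rw [h2, inner_add_right, add_mul, h1, h1]
  have h4 : inner ℂ (Q none) (Q none) * c = 2 := by
    conv_lhs => rw [hr]
    rw [inner_add_left, ← hr, add_mul, h2, h2]
    simp [hαβ, hαβ.symm]
    try norm_num
  rw [h3] at h4
  have h5 : (2 : ℕ) ^ k = 2 ^ 1 := by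
    have : ((2 ^ k : ℕ) : ℂ) = ((2 ^ 1 : ℕ) : ℂ) := by push_cast; simpa using h4
    exact_mod_cast this
  exact Nat.pow_right_injective le_rfl h5

theorem FbhProper.K_one [FiniteDimensional ℂ E1] [FiniteDimensional ℂ E2] [Nontrivial E1]
    (h : FbhProper μ f) (hd : 2 ≤ Module.finrank ℂ E2) :
    ∃ (B : E1 ≃ₗ[ℂ] E1) (b : E1), (∀ z, f (z, 0) = (B z + b, 0)) ∧
      ∀ x ∈ fbhD E1 E2 μ, ∀ y ∈ fbhD E1 E2 μ, fbhK μ (f x) (f y) = fbhK μ x y := by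
  have : Nontrivial E2 := Module.nontrivial_of_finrank_pos (R := ℂ) (by omega)
  obtain ⟨k, hk, hk'⟩ := h.exists_k
  obtain ⟨B, b, hB, hBk⟩ := h.affine hk hk'
  have hk1 : 1 ≤ k := by
    rcases Nat.eq_zero_or_pos k with h0 | h0
    · obtain ⟨v, hv⟩ := exists_ne (0 : E1)
      have h1 := hBk v
      rw [h0] at h1
      have h2 : B v = 0 := by
        have : ‖B v‖ ^ 2 ≤ 0 := by simpa using h1
        have : ‖B v‖ = 0 := by nlinarith [norm_nonneg (B v)]
        exact norm_eq_zero.1 this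
      exact absurd (B.map_eq_zero_iff.1 h2) hv
    · exact h0
  have hK := h.K_eq (h.S_eq hk1 hB hBk hk)
  have hb : f (0, 0) = (b, 0) := by rw [hB]; simp
  have := fbh_k_one hd hk1 (Complex.exp_ne_zero _) (fun w => h.gram hb hK w)
  subst this
  exact ⟨B, b, hB, by simpa using hK⟩

end step7

end partH8

section partH9

open Set Filter Topology Metric ComplexConjugate Asymptotics

section step8
variable {E1 E2 : Type*} [NormedAddCommGroup E1] [InnerProductSpace ℂ E1]
  [NormedAddCommGroup E2] [InnerProductSpace ℂ E2] {μ : ℝ} {f : E1 × E2 → E1 × E2}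

theorem fbhD_exists_eps (z : E1) (u : E2) : ∃ e : ℂ, e ≠ 0 ∧ (z, e • u) ∈ fbhD E1 E2 μ := by
  have h0 := fbhS_nonneg (μ := μ) (z, u)
  refine ⟨((1 / (1 + fbhS μ (z, u)) : ℝ) : ℂ), ?_, ?_⟩
  · rw [Complex.ofReal_ne_zero]; positivity
  · rw [fbhD_iff, fbhS_smul_snd, Complex.norm_real, Real.norm_of_nonneg (by positivity), one_div_mul_eq_div,
      div_lt_one (by positivity)]
    linarith

theorem FbhProper.injOn (h : FbhProper μ f) {B : E1 ≃ₗ[ℂ] E1} {b : E1} (hB : ∀ z, f (z, 0) = (B z + b, 0))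
    (hK : ∀ x ∈ fbhD E1 E2 μ, ∀ y ∈ fbhD E1 E2 μ, fbhK μ (f x) (f y) = fbhK μ x y) :
    InjOn f (fbhD E1 E2 μ) := by
  rintro ⟨z, w⟩ hx ⟨z', w'⟩ hx' hff
  have hk : ∀ y ∈ fbhD E1 E2 μ, fbhK μ y (z, w) = fbhK μ y (z', w') := fun y hy => by
    rw [← hK y hy _ hx, ← hK y hy _ hx', hff]
  have hw : w = w' := by
    refine ext_inner_left ℂ fun u => ?_
    obtain ⟨e, he, hm⟩ := fbhD_exists_eps (μ := μ) (0 : E1) u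
    have := hk _ hm
    simpa [fbhK, inner_smul_left, he] using this
  subst hw
  by_cases hw0 : w = 0
  · subst hw0
    rw [hB, hB] at hff
    have : B z = B z' := by simpa using hff
    rw [B.injective this]
  · obtain ⟨e, he, hm⟩ := fbhD_exists_eps (μ := μ) (z - z') w
    have h1 := hk _ hm
    have h2 : inner ℂ (e • w) w ≠ 0 := by
      rw [inner_smul_left]
      exact mul_ne_zero (by simpa using he) (by simpa using hw0)
    simp only [fbhK] at h1
    have h3 := mul_left_cancel₀ h2 h1
    have h4 : Complex.exp (μ * inner ℂ (z - z') (z - z')) = 1 := by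
      rw [inner_sub_right, mul_sub, Complex.exp_sub, h3, div_self (Complex.exp_ne_zero _)]
    rw [inner_self_eq_norm_sq_to_K] at h4
    have h5 : Real.exp (μ * ‖z - z'‖ ^ 2) = 1 := by
      have : ((Real.exp (μ * ‖z - z'‖ ^ 2) : ℝ) : ℂ) = ((1 : ℝ) : ℂ) := by
        push_cast; simpa using h4
      exact_mod_cast this
    rw [Real.exp_eq_one_iff] at h5
    have h6 : ‖z - z'‖ ^ 2 = 0 := (mul_eq_zero.1 h5).resolve_left h.mu.ne'
    have h7 : z - z' = 0 := by simpa using h6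
    rw [sub_eq_zero.1 h7]

theorem fbhK_hasDeriv (y x v : E1 × E2) :
    HasDerivAt (fun t : ℂ => fbhK μ y (x + t • v))
      ((inner ℂ y.2 v.2 + inner ℂ y.2 x.2 * (μ * inner ℂ y.1 v.1)) * Complex.exp (μ * inner ℂ y.1 x.1)) 0 := by
  have h1 : (fun t : ℂ => fbhK μ y (x + t • v)) = fun t : ℂ =>
      (inner ℂ y.2 x.2 + t * inner ℂ y.2 v.2) * Complex.exp (μ * (inner ℂ y.1 x.1 + t * inner ℂ y.1 v.1)) := by
    funext t
    simp [fbhK, inner_add_right, inner_smul_right]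
  rw [h1]
  have h2 : ∀ a c : ℂ, HasDerivAt (fun t : ℂ => a + t * c) c 0 := fun a c => by
    simpa using ((hasDerivAt_id (0 : ℂ)).mul_const c).const_add a
  have h3 := (h2 (inner ℂ y.2 x.2) (inner ℂ y.2 v.2)).mul
    ((h2 (inner ℂ y.1 x.1) (inner ℂ y.1 v.1)).const_mul (μ : ℂ)).cexp
  refine HasDerivAt.congr_deriv h3 ?_
  simp only [zero_mul, add_zero]; ring

theorem fbhK_differentiable [FiniteDimensional ℂ E1] [FiniteDimensional ℂ E2] (y : E1 × E2) :
    Differentiable ℂ (fbhK μ y) := by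
  unfold fbhK
  have h1 : Differentiable ℂ (fun x : E1 × E2 => inner ℂ y.2 x.2) :=
    ((innerSL ℂ y.2).comp (ContinuousLinearMap.snd ℂ E1 E2)).differentiable
  have h2 : Differentiable ℂ (fun x : E1 × E2 => inner ℂ y.1 x.1) :=
    ((innerSL ℂ y.1).comp (ContinuousLinearMap.fst ℂ E1 E2)).differentiable
  exact h1.mul (h2.const_mul _).cexp

theorem FbhProper.fderiv_inj [FiniteDimensional ℂ E1] [FiniteDimensional ℂ E2] (h : FbhProper μ f)
    {B : E1 ≃ₗ[ℂ] E1} {b : E1} (hB : ∀ z, f (z, 0) = (B z + b, 0))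
    (hK : ∀ x ∈ fbhD E1 E2 μ, ∀ y ∈ fbhD E1 E2 μ, fbhK μ (f x) (f y) = fbhK μ x y)
    {x : E1 × E2} (hx : x ∈ fbhD E1 E2 μ) {v : E1 × E2} (hv : fderiv ℂ f x v = 0) : v = 0 := by
  have hfx := h.diff.differentiableAt (fbhD_isOpen.mem_nhds hx)
  have hline : HasDerivAt (fun t : ℂ => x + t • v) v 0 := by
    simpa using ((hasDerivAt_id (0 : ℂ)).smul_const v).const_add x
  have hcomp : HasDerivAt (fun t : ℂ => f (x + t • v)) 0 0 := by
    have h1 : HasFDerivAt f (fderiv ℂ f x) (x + (0 : ℂ) • v) := by simpa using hfx.hasFDerivAt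
    have h2 := h1.comp_hasDerivAt (0 : ℂ) hline
    rw [hv] at h2
    exact h2
  have hev : ∀ᶠ t : ℂ in 𝓝 0, x + t • v ∈ fbhD E1 E2 μ := by
    have : Continuous (fun t : ℂ => x + t • v) := by fun_prop
    exact this.tendsto' 0 x (by simp) (fbhD_isOpen.mem_nhds hx)
  have key : ∀ y ∈ fbhD E1 E2 μ, inner ℂ y.2 v.2 + inner ℂ y.2 x.2 * (μ * inner ℂ y.1 v.1) = 0 := by
    intro y hy
    have h1 := fbhK_hasDeriv (μ := μ) y x v
    have h2 : HasDerivAt (fun t : ℂ => fbhK μ (f y) (f (x + t • v))) 0 0 := by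
      have h3 := ((fbhK_differentiable (μ := μ) (f y)) (f (x + (0 : ℂ) • v))).hasFDerivAt.comp_hasDerivAt (0 : ℂ) hcomp
      rw [map_zero] at h3
      exact h3
    have h4 : HasDerivAt (fun t : ℂ => fbhK μ y (x + t • v)) 0 0 := by
      refine h2.congr_of_eventuallyEq ?_
      filter_upwards [hev] with t ht
      exact (hK y hy _ ht).symm
    have h5 := h1.unique h4
    exact (mul_eq_zero.1 h5).resolve_right (Complex.exp_ne_zero _)
  have hv2 : v.2 = 0 := by
    refine ext_inner_left ℂ fun u => ?_
    obtain ⟨e, he, hm⟩ := fbhD_exists_eps (μ := μ) (0 : E1) u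
    have := key _ hm
    simpa [inner_smul_left, he] using this
  have hv1 : v.1 = 0 := by
    by_cases hx2 : x.2 = 0
    · have h1 : HasDerivAt (fun t : ℂ => (f (x + t • v)).1) 0 0 := by
        have := (ContinuousLinearMap.fst ℂ E1 E2).hasFDerivAt.comp_hasDerivAt (0 : ℂ) hcomp
        rw [map_zero] at this
        exact this
      have h2 : (fun t : ℂ => (f (x + t • v)).1) = fun t : ℂ => (B x.1 + b) + t • B v.1 := by
        funext t
        have : x + t • v = (x.1 + t • v.1, 0) := by ext <;> simp [hx2, hv2]
        rw [this, hB]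
        simp only [map_add, map_smul]
        abel
      rw [h2] at h1
      have h3 : HasDerivAt (fun t : ℂ => (B x.1 + b) + t • B v.1) (B v.1) 0 := by
        simpa using ((hasDerivAt_id (0 : ℂ)).smul_const (B v.1)).const_add (B x.1 + b)
      exact B.map_eq_zero_iff.1 (h3.unique h1)
    · obtain ⟨e, he, hm⟩ := fbhD_exists_eps (μ := μ) v.1 x.2
      have := key _ hm
      simpa [inner_smul_left, he, hv2, hx2, h.mu.ne'] using this
  exact Prod.ext hv1 hv2

theorem FbhProper.automorphism [FiniteDimensional ℂ E1] [FiniteDimensional ℂ E2] [Nontrivial E1]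
    (h : FbhProper μ f) (hd : 2 ≤ Module.finrank ℂ E2) :
    BijOn f (fbhD E1 E2 μ) (fbhD E1 E2 μ) ∧ ∃ g : E1 × E2 → E1 × E2,
      DifferentiableOn ℂ g (fbhD E1 E2 μ) ∧ MapsTo g (fbhD E1 E2 μ) (fbhD E1 E2 μ) ∧
      (∀ x ∈ fbhD E1 E2 μ, g (f x) = x) ∧ (∀ y ∈ fbhD E1 E2 μ, f (g y) = y) := by
  have : CompleteSpace (E1 × E2) := FiniteDimensional.complete ℂ _
  obtain ⟨B, b, hB, hK⟩ := h.K_one hd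
  obtain ⟨N, P, T⟩ := h.exists_tuple
  have hinj := h.injOn hB hK
  have hsurj : SurjOn f (fbhD E1 E2 μ) (fbhD E1 E2 μ) := T.surj
  set g := Function.invFunOn f (fbhD E1 E2 μ) with hg
  have hgf : ∀ x ∈ fbhD E1 E2 μ, g (f x) = x := fun x hx => hinj.leftInvOn_invFunOn hx
  have hfg : ∀ y ∈ fbhD E1 E2 μ, f (g y) = y := fun y hy => hsurj.rightInvOn_invFunOn hy
  refine ⟨⟨h.maps, hinj, hsurj⟩, g, ?_, hsurj.mapsTo_invFunOn, hgf, hfg⟩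
  intro y hy
  obtain ⟨x, hx, rfl⟩ := hsurj hy
  have hstrict : HasStrictFDerivAt f (fderiv ℂ f x) x :=
    ((fbh_contDiffOn_nat fbhD_isOpen h.diff 1).contDiffAt (fbhD_isOpen.mem_nhds hx)).hasStrictFDerivAt (by norm_num)
  have hinj' : Function.Injective (fderiv ℂ f x : E1 × E2 →ₗ[ℂ] E1 × E2) := by
    rw [← LinearMap.ker_eq_bot, LinearMap.ker_eq_bot']
    intro v hv
    exact h.fderiv_inj hB hK hx hv
  set e : (E1 × E2) ≃L[ℂ] (E1 × E2) := (LinearEquiv.ofInjectiveEndo _ hinj').toContinuousLinearEquiv with he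
  have hee : (e : E1 × E2 →L[ℂ] E1 × E2) = fderiv ℂ f x := by ext v <;> rfl
  rw [← hee] at hstrict
  have h1 := hstrict.to_localInverse.hasFDerivAt.differentiableAt
  refine (h1.congr_of_eventuallyEq ?_).differentiableWithinAt
  have h2 := hstrict.localInverse_tendsto (fbhD_isOpen.mem_nhds hx)
  filter_upwards [h2, hstrict.eventually_right_inverse] with y' h3 h4
  rw [← hgf _ h3, h4]

end step8

end partH9

/-- Every proper holomorphic self-mapping of the Fock–Bargmann–Hartogs domain
`D_{n,m}(μ)` with `m ≥ 2` is an automorphism: a holomorphic bijection of the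
domain onto itself with holomorphic inverse. -/
theorem proper_holomorphic_self_map_is_automorphism
    (n m : ℕ) (hn : 0 < n) (hm : 0 < m) (hm2 : 2 ≤ m) (μ : ℝ) (hμ : 0 < μ)
    (f : EuclideanSpace ℂ (Fin n) × EuclideanSpace ℂ (Fin m) →
      EuclideanSpace ℂ (Fin n) × EuclideanSpace ℂ (Fin m))
    (hol : DifferentiableOn ℂ f (FBH n m μ))
    (hmaps : Set.MapsTo f (FBH n m μ) (FBH n m μ))
    (hproper : ∀ K : Set (EuclideanSpace ℂ (Fin n) × EuclideanSpace ℂ (Fin m)),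
      K ⊆ FBH n m μ → IsCompact K → IsCompact (f ⁻¹' K ∩ FBH n m μ)) :
    Set.BijOn f (FBH n m μ) (FBH n m μ) ∧
    ∃ g : EuclideanSpace ℂ (Fin n) × EuclideanSpace ℂ (Fin m) →
        EuclideanSpace ℂ (Fin n) × EuclideanSpace ℂ (Fin m),
      DifferentiableOn ℂ g (FBH n m μ) ∧
      Set.MapsTo g (FBH n m μ) (FBH n m μ) ∧
      (∀ x ∈ FBH n m μ, g (f x) = x) ∧
      (∀ y ∈ FBH n m μ, f (g y) = y) := by
  have : Nonempty (Fin n) := ⟨⟨0, hn⟩⟩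
  have h : FbhProper μ f := ⟨hμ, hol, hmaps, hproper⟩
  exact h.automorphism (by simpa using hm2)
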